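/- arXiv:2210.02125 — 4 statements merged into one kernel-verified Lean document; each statement's English description precedes it below -/
import Mathlib

section
/- Let T ≥ 6 be an integer and fix B ∈ ℂ^{T×3} with B^H B = I_3. Let μ be the Haar probability measure on U(T). Then the pushforward of μ under the map U ↦ det(I_3 − B^H (UE)(UE)^H B) is the measure on ℝ having density f_3(x;T) = (1/288)(T−1)(T−2)²(T−3)³(T−4)²(T−5) x^{T−6} (1 + 80x − 162x² + 80x³ + x⁴ + 24x·log x − 24x³·log x − 36x²·log²x) for x ∈ (0,1) and 0 elsewhere, with respect to Lebesgue measure on ℝ. -/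
open Matrix MeasureTheory

noncomputable instance {m n : ℕ} : MeasureSpace (Matrix (Fin m) (Fin n) ℂ) := by
  unfold Matrix; infer_instance

/-- The `T × 3` matrix whose columns are the first 3 standard basis vectors of `ℂ^T`. -/
def stdFrame (T M : ℕ) : Matrix (Fin T) (Fin M) ℂ :=
  Matrix.of fun i j => if (i : ℕ) = (j : ℕ) then 1 else 0


/-- Complex Gaussian density. -/
noncomputable def gDens (z : ℂ) : ENNReal := ENNReal.ofReal (Real.pi⁻¹ * Real.exp (-‖z‖ ^ 2))

lemma gDens_meas : Measurable gDens := by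
  unfold gDens; fun_prop

/-- standard complex Gaussian. -/
noncomputable def gM : Measure ℂ := volume.withDensity gDens

lemma gM_moment (k : ℕ) : ∫⁻ z, ENNReal.ofReal (‖z‖ ^ 2) ^ k ∂gM = (k.factorial : ENNReal) := by
  have h := Complex.integral_rpow_mul_exp_neg_rpow (p := 2) (q := 2 * k) (by norm_num)
    (by have : (0:ℝ) ≤ k := by positivity
        linarith)
  have e : ((2 * (k:ℝ) + 2) / 2) = k + 1 := by ring
  rw [e, Real.Gamma_nat_eq_factorial] at h
  have h2 : ∫ x : ℂ, Real.pi⁻¹ * Real.exp (-‖x‖ ^ 2) * (‖x‖ ^ 2) ^ k = k.factorial := by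
    have : ∀ x : ℂ, Real.pi⁻¹ * Real.exp (-‖x‖ ^ 2) * (‖x‖ ^ 2) ^ k =
        Real.pi⁻¹ * (‖x‖ ^ (2 * (k:ℝ)) * Real.exp (-‖x‖ ^ (2:ℝ))) := by
      intro x
      have h1 : ‖x‖ ^ (2 * (k:ℝ)) = (‖x‖ ^ 2) ^ k := by
        rw [← pow_mul, ← Real.rpow_natCast]; norm_cast
      have h2 : ‖x‖ ^ (2:ℝ) = ‖x‖ ^ 2 := by norm_cast
      rw [h1, h2]; ring
    simp_rw [this]
    rw [integral_const_mul, h]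
    have := Real.pi_ne_zero
    field_simp
  unfold gM
  rw [lintegral_withDensity_eq_lintegral_mul _ gDens_meas (by fun_prop)]
  have h3 : ∀ x : ℂ, (gDens * (fun z : ℂ => ENNReal.ofReal (‖z‖ ^ 2) ^ k) : ℂ → ENNReal) x =
      ENNReal.ofReal (Real.pi⁻¹ * Real.exp (-‖x‖ ^ 2) * (‖x‖ ^ 2) ^ k) := by
    intro x
    simp only [Pi.mul_apply, gDens]
    rw [← ENNReal.ofReal_pow (by positivity), ← ENNReal.ofReal_mul (by positivity)]
  simp_rw [h3]
  rw [← ofReal_integral_eq_lintegral_ofReal, h2]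
  · simp
  · by_contra hn
    rw [integral_undef hn] at h2
    have : (0:ℝ) < k.factorial := by exact_mod_cast k.factorial_pos
    linarith
  · exact Filter.Eventually.of_forall fun x => by positivity

instance : IsProbabilityMeasure gM := ⟨by
  have := gM_moment 0
  simpa using this⟩

/-- Standard complex Gaussian vector. -/
noncomputable def gV (n : ℕ) : Measure (Fin n → ℂ) := Measure.pi fun _ => gM

instance (n : ℕ) : IsProbabilityMeasure (gV n) := by unfold gV; infer_instance

lemma cons_eq (n : ℕ) (z : ℂ) (g : Fin n → ℂ) :
    (MeasurableEquiv.piFinSuccAbove (fun _ : Fin (n+1) => ℂ) 0).symm (z, g) = Fin.cons z g := by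
  simp [MeasurableEquiv.piFinSuccAbove, Fin.insertNthEquiv]

lemma meas_cons (n : ℕ) : Measurable fun p : ℂ × (Fin n → ℂ) => (Fin.cons p.1 p.2 : Fin (n+1) → ℂ) := by
  have := (MeasurableEquiv.piFinSuccAbove (fun _ : Fin (n+1) => ℂ) 0).symm.measurable
  convert this using 1
  ext p : 1
  exact (cons_eq n p.1 p.2).symm

lemma lintegral_gV_succ (n : ℕ) (f : (Fin (n+1) → ℂ) → ENNReal) (hf : Measurable f) :
    ∫⁻ g, f g ∂(gV (n+1)) = ∫⁻ z, ∫⁻ g, f (Fin.cons z g) ∂(gV n) ∂gM := by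
  have h := (measurePreserving_piFinSuccAbove (fun _ : Fin (n+1) => gM) 0).symm
  unfold gV
  rw [← h.lintegral_comp hf, lintegral_prod]
  · simp only [cons_eq]
  · exact (hf.comp h.measurable).aemeasurable

lemma gV_eq (n : ℕ) : gV n = (volume : Measure (Fin n → ℂ)).withDensity (fun g => ∏ i, gDens (g i)) := by
  induction n with
  | zero =>
    unfold gV
    rw [volume_pi]
    simp only [Finset.univ_eq_empty, Finset.prod_empty]
    rw [show (fun _ : Fin 0 → ℂ => (1:ENNReal)) = 1 from rfl, withDensity_one,
      Measure.pi_of_empty _ (default : Fin 0 → ℂ), Measure.pi_of_empty _ (default : Fin 0 → ℂ)]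
  | succ n ih =>
    have h := (measurePreserving_piFinSuccAbove (fun _ : Fin (n+1) => gM) 0).symm
    have h' := (measurePreserving_piFinSuccAbove (fun _ : Fin (n+1) => (volume : Measure ℂ)) 0).symm
    have hm : ∀ m, Measurable (fun g : Fin m → ℂ => ∏ i, gDens (g i)) := fun m =>
      Finset.measurable_prod _ fun i _ => gDens_meas.comp (measurable_pi_apply i)
    refine Measure.ext_of_lintegral _ fun f hf => ?_
    rw [lintegral_gV_succ _ _ hf, lintegral_withDensity_eq_lintegral_mul _ (hm _) hf, volume_pi,
      ← h'.lintegral_comp ((hm _).mul hf), lintegral_prod]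
    swap
    · exact (((hm _).mul hf).comp h'.measurable).aemeasurable
    unfold gM
    rw [lintegral_withDensity_eq_lintegral_mul _ gDens_meas]
    swap
    · have : Measurable fun p : ℂ × (Fin n → ℂ) => f (Fin.cons p.1 p.2) := hf.comp (meas_cons n)
      exact this.lintegral_prod_right'
    refine lintegral_congr fun z => ?_
    simp only [Pi.mul_apply]
    have hfz : Measurable fun g : Fin n → ℂ => f (Fin.cons z g) :=
      (hf.comp (meas_cons n)).comp measurable_prodMk_left
    rw [ih, lintegral_withDensity_eq_lintegral_mul _ (hm _) hfz, ← lintegral_const_mul _ ((hm n).mul hfz)]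
    refine lintegral_congr fun g => ?_
    rw [cons_eq]
    rw [Fin.prod_univ_succ]
    simp [mul_assoc]

lemma asc_sum (n k : ℕ) : ∑ j ∈ Finset.range (k+1), k.choose j * (n.ascFactorial j * (k-j).factorial)
    = (n+1).ascFactorial k := by
  induction k with
  | zero => simp
  | succ k ih =>
    rw [Finset.sum_range_succ]
    have : ∀ j ∈ Finset.range (k+1), (k+1).choose j * (n.ascFactorial j * (k+1-j).factorial) =
        (k+1) * (k.choose j * (n.ascFactorial j * (k-j).factorial)) := by
      intro j hj
      have hj' : j ≤ k := by simpa [Nat.lt_succ_iff] using hj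
      have h1 := Nat.choose_mul_factorial_mul_factorial hj'
      have h2 := Nat.choose_mul_factorial_mul_factorial (Nat.le_succ_of_le hj')
      rw [Nat.factorial_succ k] at h2
      have hp := j.factorial_pos
      apply Nat.eq_of_mul_eq_mul_left hp
      calc _ = ((k+1).choose j * j.factorial * (k+1-j).factorial) * n.ascFactorial j := by ring
        _ = (k.choose j * j.factorial * (k-j).factorial) * (k+1) * n.ascFactorial j := by
          rw [h1]; simp only [Nat.succ_eq_add_one] at h2; rw [h2]; ring
        _ = _ := by ring
    rw [Finset.sum_congr rfl this, ← Finset.mul_sum, ih]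
    simp only [Nat.choose_self, Nat.sub_self, Nat.factorial_zero]
    have := Nat.succ_ascFactorial n k
    simp only [Nat.succ_eq_add_one] at this
    rw [Nat.ascFactorial_succ, Nat.ascFactorial_succ, ← this]
    ring

lemma gV_moment (n k : ℕ) :
    ∫⁻ g, (∑ i, ENNReal.ofReal (‖g i‖ ^ 2)) ^ k ∂(gV n) = (n.ascFactorial k : ENNReal) := by
  induction n generalizing k with
  | zero => 
    simp
    cases k with
    | zero => simp
    | succ k => simp [Nat.zero_ascFactorial]
  | succ n ih =>
    rw [lintegral_gV_succ _ _ (by fun_prop)]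
    simp only [Fin.sum_univ_succ, Fin.cons_zero, Fin.cons_succ]
    simp_rw [add_comm (ENNReal.ofReal _), add_pow]
    have h1 : ∀ z : ℂ, ∫⁻ g, ∑ m ∈ Finset.range (k + 1),
        (∑ i, ENNReal.ofReal (‖g i‖ ^ 2)) ^ m * ENNReal.ofReal (‖z‖ ^ 2) ^ (k - m) * (k.choose m) ∂(gV n)
        = ∑ m ∈ Finset.range (k + 1), (n.ascFactorial m : ENNReal) * ENNReal.ofReal (‖z‖ ^ 2) ^ (k - m) * (k.choose m) := by
      intro z
      rw [lintegral_finsetSum _ (fun m _ => by fun_prop)]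
      refine Finset.sum_congr rfl fun m _ => ?_
      rw [lintegral_mul_const _ (by fun_prop), lintegral_mul_const _ (by fun_prop), ih]
    simp_rw [h1]
    rw [lintegral_finsetSum _ (fun m _ => by fun_prop), ← asc_sum]
    push_cast
    refine Finset.sum_congr rfl fun m _ => ?_
    rw [lintegral_mul_const _ (by fun_prop), lintegral_const_mul _ (by fun_prop), gM_moment]
    ring


lemma gDens_prod (n : ℕ) (g : Fin n → ℂ) :
    ∏ i, gDens (g i) = ENNReal.ofReal ((Real.pi⁻¹) ^ n * Real.exp (-∑ i, ‖g i‖ ^ 2)) := by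
  unfold gDens
  rw [← ENNReal.ofReal_prod_of_nonneg (fun i _ => by positivity), Finset.prod_mul_distrib,
    ← Real.exp_sum]
  simp

lemma dot_self_eq {ι : Type*} [Fintype ι] (g : ι → ℂ) : star g ⬝ᵥ g = ((∑ i, ‖g i‖ ^ 2 : ℝ) : ℂ) := by
  simp only [dotProduct, Pi.star_apply]
  push_cast
  refine Finset.sum_congr rfl fun i _ => ?_
  simpa using Complex.conj_mul' (g i)

lemma unitary_norm {n : ℕ} (V : Matrix (Fin n) (Fin n) ℂ) (hV : V ∈ unitaryGroup (Fin n) ℂ)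
    (g : Fin n → ℂ) : ∑ i, ‖(V *ᵥ g) i‖ ^ 2 = ∑ i, ‖g i‖ ^ 2 := by
  have h : star (V *ᵥ g) ⬝ᵥ (V *ᵥ g) = star g ⬝ᵥ g := by
    rw [star_mulVec, dotProduct_mulVec, vecMul_vecMul]
    have : Vᴴ * V = 1 := (mem_unitaryGroup_iff').1 hV
    rw [this, vecMul_one]
  rw [dot_self_eq, dot_self_eq] at h
  exact_mod_cast h

lemma gV_unitary {n : ℕ} (V : Matrix (Fin n) (Fin n) ℂ) (hV : V ∈ unitaryGroup (Fin n) ℂ)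
    (f : (Fin n → ℂ) → ENNReal) (hf : Measurable f) :
    ∫⁻ g, f (V *ᵥ g) ∂(gV n) = ∫⁻ g, f g ∂(gV n) := by
  let L : (Fin n → ℂ) →ₗ[ℝ] (Fin n → ℂ) := (Matrix.mulVecLin V).restrictScalars ℝ
  let L' : (Fin n → ℂ) →ₗ[ℝ] (Fin n → ℂ) := (Matrix.mulVecLin Vᴴ).restrictScalars ℝ
  have h1 : Vᴴ * V = 1 := (mem_unitaryGroup_iff').1 hV
  have hL : L' ∘ₗ L = LinearMap.id := by
    refine LinearMap.ext fun g => ?_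
    simp [L, L', mulVec_mulVec, h1]
  have hdet : LinearMap.det L ≠ 0 := by
    intro h0
    have := congrArg LinearMap.det hL
    rw [LinearMap.det_comp, h0] at this
    simp at this
  have hmap := Measure.map_linearMap_addHaar_eq_smul_addHaar (volume : Measure (Fin n → ℂ)) hdet
  set c := ENNReal.ofReal |(LinearMap.det L)⁻¹|
  have hLm : Measurable L := L.continuous_of_finiteDimensional.measurable
  have hm : Measurable (fun g : Fin n → ℂ => ∏ i, gDens (g i)) :=
      Finset.measurable_prod _ fun i _ => gDens_meas.comp (measurable_pi_apply i)
  have key : ∀ f : (Fin n → ℂ) → ENNReal, Measurable f →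
      ∫⁻ g, f (V *ᵥ g) ∂(gV n) = c * ∫⁻ g, f g ∂(gV n) := by
    intro f hf
    rw [gV_eq, lintegral_withDensity_eq_lintegral_mul _ hm hf,
      lintegral_withDensity_eq_lintegral_mul _ hm (show Measurable fun g => f (V *ᵥ g) from hf.comp hLm)]
    rw [← smul_eq_mul c, ← lintegral_smul_measure, ← hmap, lintegral_map (hm.mul hf) hLm]
    refine lintegral_congr fun g => ?_
    simp only [Pi.mul_apply]
    rw [gDens_prod, gDens_prod]
    show _ = ENNReal.ofReal (Real.pi⁻¹ ^ n * Real.exp (-∑ i, ‖(V *ᵥ g) i‖ ^ 2)) * f (V *ᵥ g)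
    rw [unitary_norm V hV]
  have h2 := key (fun _ => 1) measurable_const
  simp at h2
  rw [key f hf, ← h2, one_mul]

lemma gV_marginal (m e : ℕ) (f : (Fin e → ℂ) → ENNReal) (hf : Measurable f) :
    ∫⁻ g, f (fun i => g (Fin.natAdd m i)) ∂(gV (m+e)) = ∫⁻ g, f g ∂(gV e) := by
  have hm : Measurable (fun (g : Fin (m+e) → ℂ) (i : Fin e) => g (Fin.natAdd m i)) := by fun_prop
  have : (gV (m+e)).map (fun g i => g (Fin.natAdd m i)) = gV e := by
    symm
    refine Measure.pi_eq fun s hs => ?_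
    rw [Measure.map_apply hm (MeasurableSet.univ_pi hs)]
    have : (fun (g : Fin (m+e) → ℂ) (i : Fin e) => g (Fin.natAdd m i)) ⁻¹' (Set.univ.pi s) =
        Set.univ.pi (Fin.addCases (fun _ => Set.univ) s : Fin (m+e) → Set ℂ) := by
      ext g
      simp only [Set.mem_preimage, Set.mem_univ_pi]
      constructor
      · intro h i
        refine Fin.addCases (fun j => ?_) (fun j => ?_) i
        · simp
        · simpa using h j
      · intro h i
        simpa using h (Fin.natAdd m i)
    rw [this]
    unfold gV
    rw [Measure.pi_pi, Fin.prod_univ_add]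
    simp
  rw [← this, lintegral_map hf hm]

lemma stdFrame_gram (m e : ℕ) : (stdFrame (m+e) m)ᴴ * stdFrame (m+e) m = 1 := by
  ext i j
  simp only [mul_apply, conjTranspose_apply, stdFrame, of_apply]
  rw [Fin.sum_univ_add]
  have h2 : ∀ x : Fin e, ¬ (m + (x:ℕ) = i) := fun x => by omega
  simp [Fin.val_inj, h2]
  simp [Matrix.one_apply, eq_comm]

lemma qr_exists (m e : ℕ) (A : Matrix (Fin (m+e)) (Fin m) ℂ) :
    ∃ V ∈ unitaryGroup (Fin (m+e)) ℂ, ∃ R : Matrix (Fin m) (Fin m) ℂ,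
      A = V * (stdFrame (m+e) m * R) := by
  let F : Fin (m+e) → EuclideanSpace ℂ (Fin (m+e)) := fun i =>
    WithLp.toLp 2 (Fin.addCases (fun j k => A k j) (fun _ _ => 0) i)
  let b := InnerProductSpace.gramSchmidtOrthonormalBasis (𝕜 := ℂ) (by simp) F
  let V : Matrix (Fin (m+e)) (Fin (m+e)) ℂ := of fun i j => b j i
  have hV1 : Vᴴ * V = 1 := by
    ext i j
    have := orthonormal_iff_ite.1 b.orthonormal i j
    simp only [PiLp.inner_apply, RCLike.inner_apply] at this
    rw [one_apply, ← this]
    simp [mul_apply, V, mul_comm]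
  have hV : V ∈ unitaryGroup (Fin (m+e)) ℂ := (mem_unitaryGroup_iff').2 hV1
  refine ⟨V, hV, of fun i j => (Vᴴ * A) (Fin.castAdd e i) j, ?_⟩
  have : stdFrame (m+e) m * (of fun i j => (Vᴴ * A) (Fin.castAdd e i) j) = Vᴴ * A := by
    ext i j
    rw [mul_apply]
    refine Fin.addCases (fun k => ?_) (fun k => ?_) i
    · simp [stdFrame, Fin.val_inj]
    · have h0 : (Vᴴ * A) (Fin.natAdd m k) j = 0 := by
        have := InnerProductSpace.gramSchmidtOrthonormalBasis_inv_triangular (𝕜 := ℂ) (by simp) F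
          (i := Fin.castAdd e j) (j := Fin.natAdd m k) (by
            rw [Fin.lt_def]; simp; omega)
        rw [← this]
        simp [mul_apply, PiLp.inner_apply, V, F, b, mul_comm]
      rw [h0]
      refine Finset.sum_eq_zero fun x _ => ?_
      have : ¬ (m + (k:ℕ) = x) := by omega
      simp [stdFrame, this]
  rw [this, ← Matrix.mul_assoc, show V * Vᴴ = 1 from (mem_unitaryGroup_iff).1 hV, Matrix.one_mul]


/-- append a column. -/
def snocM {n m : ℕ} (A : Matrix (Fin n) (Fin m) ℂ) (g : Fin n → ℂ) : Matrix (Fin n) (Fin (m+1)) ℂ :=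
  of fun i => Fin.snoc (A i) (g i)

/-- real part of the Gram determinant. -/
noncomputable def gD {n m : ℕ} (A : Matrix (Fin n) (Fin m) ℂ) : ℝ := (Aᴴ * A).det.re

lemma snocM_mul {n m : ℕ} (V : Matrix (Fin n) (Fin n) ℂ) (A : Matrix (Fin n) (Fin m) ℂ) (g : Fin n → ℂ) :
    V * snocM A g = snocM (V * A) (V *ᵥ g) := by
  ext i j
  refine Fin.lastCases ?_ (fun j => ?_) j
  · simp [snocM, mul_apply, mulVec, dotProduct]
  · simp [snocM, mul_apply]

lemma gD_unitary {n m : ℕ} (V : Matrix (Fin n) (Fin n) ℂ) (hV : V ∈ unitaryGroup (Fin n) ℂ)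
    (A : Matrix (Fin n) (Fin m) ℂ) : gD (V * A) = gD A := by
  have h1 : Vᴴ * V = 1 := (mem_unitaryGroup_iff').1 hV
  unfold gD
  rw [conjTranspose_mul, Matrix.mul_assoc, ← Matrix.mul_assoc Vᴴ, h1, Matrix.one_mul]

lemma gD_square {m : ℕ} (R : Matrix (Fin m) (Fin m) ℂ) : gD R = ‖R.det‖ ^ 2 := by
  unfold gD
  rw [det_mul, det_conjTranspose]
  have := Complex.conj_mul' R.det
  rw [show star R.det * R.det = ((‖R.det‖ ^ 2 : ℝ) : ℂ) by simpa using this]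
  exact Complex.ofReal_re _

lemma gD_frame (m e : ℕ) (R : Matrix (Fin m) (Fin m) ℂ) : gD (stdFrame (m+e) m * R) = ‖R.det‖ ^ 2 := by
  rw [← gD_square]
  unfold gD
  rw [conjTranspose_mul, Matrix.mul_assoc, ← Matrix.mul_assoc _ _ R, stdFrame_gram, Matrix.one_mul]

lemma frame_mul_castAdd (m e p : ℕ) (R : Matrix (Fin m) (Fin p) ℂ) (i : Fin m) (j : Fin p) :
    (stdFrame (m+e) m * R) (Fin.castAdd e i) j = R i j := by
  simp [mul_apply, stdFrame, Fin.val_inj]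

lemma frame_mul_natAdd (m e p : ℕ) (R : Matrix (Fin m) (Fin p) ℂ) (i : Fin e) (j : Fin p) :
    (stdFrame (m+e) m * R) (Fin.natAdd m i) j = 0 := by
  rw [mul_apply]
  refine Finset.sum_eq_zero fun x _ => ?_
  have : ¬ (m + (i:ℕ) = x) := by omega
  simp [stdFrame, this]

lemma gD_snoc_frame (m e : ℕ) (R : Matrix (Fin m) (Fin m) ℂ) (h : Fin (m+e) → ℂ) :
    gD (snocM (stdFrame (m+e) m * R) h) = ‖R.det‖ ^ 2 * ∑ i : Fin e, ‖h (Fin.natAdd m i)‖ ^ 2 := by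
  set s2 : ℝ := ∑ i : Fin e, ‖h (Fin.natAdd m i)‖ ^ 2 with hs2
  have hs : 0 ≤ s2 := by positivity
  let s : ℝ := Real.sqrt s2
  have hss : s * s = s2 := Real.mul_self_sqrt hs
  let K : Matrix (Fin m ⊕ Fin 1) (Fin m ⊕ Fin 1) ℂ :=
    fromBlocks R (of fun i _ => h (Fin.castAdd e i)) 0 (of fun _ _ => (s:ℂ))
  have hK : K.det = R.det * s := by
    simp [K, det_fromBlocks_zero₂₁]
  have hM1 := frame_mul_castAdd m e m R
  have hM2 := frame_mul_natAdd m e m R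
  generalize stdFrame (m+e) m * R = M at hM1 hM2 ⊢
  have hG : (snocM M h)ᴴ * snocM M h =
      (reindex finSumFinEquiv finSumFinEquiv) (Kᴴ * K) := by
    ext a b
    rw [mul_apply, Fin.sum_univ_add]
    have hsum : ∑ i : Fin e, star (h (Fin.natAdd m i)) * h (Fin.natAdd m i) = (s:ℂ) * s := by
      have : (s:ℂ) * s = (s2 : ℂ) := by exact_mod_cast hss
      rw [this, hs2, ← dot_self_eq]
      simp [dotProduct]
    have e1 : ∀ (i : Fin m) (x : Fin 1), (Fin.natAdd m x : Fin (m+1)) = Fin.last m := by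
      intro i x; ext; simp
    refine Fin.addCases (fun a => ?_) (fun a => ?_) a <;> refine Fin.addCases (fun b => ?_) (fun b => ?_) b
    · simp [snocM, hM1, hM2, K, mul_apply, Fin.snoc]
    · simp [snocM, hM1, hM2, K, mul_apply, Fin.snoc]
    · simp [snocM, hM1, hM2, K, mul_apply, Fin.snoc]
    · simp [snocM, hM1, hM2, K, mul_apply, Fin.snoc]
      simpa using hsum
  unfold gD
  rw [hG, det_reindex_self, det_mul, det_conjTranspose, hK]
  have := Complex.conj_mul' (R.det * s)
  rw [show star (R.det * s) * (R.det * s) = ((‖R.det * s‖ ^ 2 : ℝ) : ℂ) by simpa using this]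
  rw [Complex.ofReal_re, norm_mul, mul_pow, ← hss]
  congr 1
  simp [s, sq]

lemma step (m e k : ℕ) (A : Matrix (Fin (m+e)) (Fin m) ℂ) :
    ∫⁻ g, ENNReal.ofReal (gD (snocM A g)) ^ k ∂(gV (m+e)) =
      ENNReal.ofReal (gD A) ^ k * (e.ascFactorial k : ENNReal) := by
  obtain ⟨V, hV, R, rfl⟩ := qr_exists m e A
  have hV' : Vᴴ ∈ unitaryGroup (Fin (m+e)) ℂ := Unitary.star_mem hV
  have h1 : V * Vᴴ = 1 := (mem_unitaryGroup_iff).1 hV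
  have h2 : ∀ g, ENNReal.ofReal (gD (snocM (V * (stdFrame (m+e) m * R)) g)) ^ k =
      ENNReal.ofReal (‖R.det‖ ^ 2) ^ k * (∑ i : Fin e, ENNReal.ofReal (‖(Vᴴ *ᵥ g) (Fin.natAdd m i)‖ ^ 2)) ^ k := by
    intro g
    have : snocM (V * (stdFrame (m+e) m * R)) g = V * snocM (stdFrame (m+e) m * R) (Vᴴ *ᵥ g) := by
      rw [snocM_mul, mulVec_mulVec, h1, one_mulVec]
    rw [this, gD_unitary V hV, gD_snoc_frame, ENNReal.ofReal_mul (by positivity), mul_pow,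
      ENNReal.ofReal_sum_of_nonneg (fun i _ => by positivity)]
  simp_rw [h2]
  have hm : Measurable fun g : Fin (m+e) → ℂ => (∑ i : Fin e, ENNReal.ofReal (‖g (Fin.natAdd m i)‖ ^ 2)) ^ k := by
    fun_prop
  have hm2 : Measurable fun g : Fin (m+e) → ℂ => Vᴴ *ᵥ g :=
    ((Matrix.mulVecLin Vᴴ).continuous_of_finiteDimensional).measurable
  have hm3 : Measurable fun g : Fin (m+e) → ℂ =>
      (∑ i : Fin e, ENNReal.ofReal (‖(Vᴴ *ᵥ g) (Fin.natAdd m i)‖ ^ 2)) ^ k := hm.comp hm2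
  rw [lintegral_const_mul _ hm3, gV_unitary Vᴴ hV' _ hm,
    gV_marginal m e (fun g => (∑ i : Fin e, ENNReal.ofReal (‖g i‖ ^ 2)) ^ k) (by fun_prop), gV_moment,
    gD_unitary V hV, gD_frame]

lemma step' (n m e k : ℕ) (hn : n = m + e) (A : Matrix (Fin n) (Fin m) ℂ) :
    ∫⁻ g, ENNReal.ofReal (gD (snocM A g)) ^ k ∂(gV n) =
      ENNReal.ofReal (gD A) ^ k * (e.ascFactorial k : ENNReal) := by
  subst hn; exact step m e k A

/-- matrix with three given columns -/
def mat3 {n : ℕ} (a b c : Fin n → ℂ) : Matrix (Fin n) (Fin 3) ℂ :=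
  snocM (snocM (snocM (0 : Matrix (Fin n) (Fin 0) ℂ) a) b) c

instance matBorel (m n : ℕ) : BorelSpace (Matrix (Fin m) (Fin n) ℂ) :=
  inferInstanceAs (BorelSpace (Fin m → Fin n → ℂ))

lemma cont_gD {n m : ℕ} : Continuous fun A : Matrix (Fin n) (Fin m) ℂ => gD A := by
  unfold gD
  exact Complex.continuous_re.comp (Continuous.matrix_det (by fun_prop))

lemma meas_gD {n m : ℕ} : Measurable fun A : Matrix (Fin n) (Fin m) ℂ => gD A := cont_gD.measurable

lemma meas_snocM {n m : ℕ} : Measurable fun p : (Matrix (Fin n) (Fin m) ℂ) × (Fin n → ℂ) => snocM p.1 p.2 := by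
  refine measurable_pi_iff.2 fun i => measurable_pi_iff.2 fun j => ?_
  refine Fin.lastCases ?_ (fun j => ?_) j
  · simp only [snocM, of_apply, Fin.snoc_last]
    fun_prop
  · simp only [snocM, of_apply, Fin.snoc_castSucc]
    have : Measurable fun A : Matrix (Fin n) (Fin m) ℂ => A i j :=
      (measurable_pi_apply j).comp (measurable_pi_apply i)
    exact this.comp measurable_fst

lemma wishart (e k : ℕ) :
    ∫⁻ a, ∫⁻ b, ∫⁻ c, ENNReal.ofReal (gD (mat3 a b c)) ^ k ∂(gV (e+3)) ∂(gV (e+3)) ∂(gV (e+3)) =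
      ((e+1).ascFactorial k : ENNReal) * ((e+2).ascFactorial k) * ((e+3).ascFactorial k) := by
  unfold mat3
  simp_rw [step' (e+3) 2 (e+1) k (by ring)]
  have hd : Measurable fun A : Matrix (Fin (e+3)) (Fin 2) ℂ => ENNReal.ofReal (gD A) ^ k :=
    meas_gD.ennreal_ofReal.pow_const k
  have hd' : Measurable fun A : Matrix (Fin (e+3)) (Fin 1) ℂ => ENNReal.ofReal (gD A) ^ k :=
    meas_gD.ennreal_ofReal.pow_const k
  have : ∀ a : Fin (e+3) → ℂ, Measurable fun b => ENNReal.ofReal (gD (snocM (snocM (0 : Matrix (Fin (e+3)) (Fin 0) ℂ) a) b)) ^ k :=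
    fun a => hd.comp (meas_snocM.comp measurable_prodMk_left)
  simp_rw [lintegral_mul_const _ (this _), step' (e+3) 1 (e+2) k (by ring)]
  rw [lintegral_mul_const, lintegral_mul_const, step' (e+3) 0 (e+3) k (by ring)]
  · simp [gD]; ring
  · exact hd'.comp (meas_snocM.comp measurable_prodMk_left)
  · exact (hd'.comp (meas_snocM.comp measurable_prodMk_left)).mul_const _


/-- lower block of a matrix. -/
def lowM {d m : ℕ} (A : Matrix (Fin (3+d)) (Fin m) ℂ) : Matrix (Fin d) (Fin m) ℂ :=
  A.submatrix (Fin.natAdd 3) id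

lemma lowM_gram (d m : ℕ) (A : Matrix (Fin (3+d)) (Fin m) ℂ) :
    (lowM A)ᴴ * lowM A = Aᴴ * A - (Aᴴ * stdFrame (3+d) 3) * ((stdFrame (3+d) 3)ᴴ * A) := by
  have hS : ∀ (j : Fin 3) (l : Fin m), ((stdFrame (3+d) 3)ᴴ * A) j l = A (Fin.castAdd d j) l := by
    intro j l
    rw [mul_apply, Fin.sum_univ_add]
    have h2 : ∀ x : Fin d, ¬ (3 + (x:ℕ) = j) := fun x => by omega
    simp [stdFrame, Fin.val_inj, h2]
  have hS' : ∀ (j : Fin 3) (l : Fin m), (Aᴴ * stdFrame (3+d) 3) l j = star (A (Fin.castAdd d j) l) := by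
    intro j l
    have : Aᴴ * stdFrame (3+d) 3 = ((stdFrame (3+d) 3)ᴴ * A)ᴴ := by
      rw [conjTranspose_mul, conjTranspose_conjTranspose]
    rw [this, conjTranspose_apply, hS]
  ext i j
  rw [Matrix.sub_apply, mul_apply, mul_apply (M := Aᴴ) (N := A), mul_apply (M := Aᴴ * _), Fin.sum_univ_add]
  simp only [hS, hS']
  simp [lowM]

open ComplexOrder in
lemma gD_nonneg {n m : ℕ} (A : Matrix (Fin n) (Fin m) ℂ) : 0 ≤ gD A := by
  have := (posSemidef_conjTranspose_mul_self A).det_nonneg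
  exact (Complex.le_def.1 this).1

lemma gD_mul_right {n m : ℕ} (A : Matrix (Fin n) (Fin m) ℂ) (R : Matrix (Fin m) (Fin m) ℂ) :
    gD (A * R) = gD A * ‖R.det‖ ^ 2 := by
  unfold gD
  have : (A * R)ᴴ * (A * R) = Rᴴ * (Aᴴ * A) * R := by
    rw [conjTranspose_mul]; simp only [Matrix.mul_assoc]
  rw [this, det_mul, det_mul, det_conjTranspose]
  have h2 : star R.det * R.det = ((‖R.det‖ ^ 2 : ℝ) : ℂ) := by simpa using Complex.conj_mul' R.det
  rw [mul_right_comm, h2, mul_comm, Complex.re_mul_ofReal]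

lemma lowM_mul {d m p : ℕ} (A : Matrix (Fin (3+d)) (Fin m) ℂ) (R : Matrix (Fin m) (Fin p) ℂ) :
    lowM (A * R) = lowM A * R := by
  ext i j
  simp [lowM, mul_apply]

lemma target_eq (d : ℕ) (B : Matrix (Fin (3+d)) (Fin 3) ℂ) (hB : Bᴴ * B = 1)
    (U : unitaryGroup (Fin (3+d)) ℂ) :
    ((1 - Bᴴ * ((U : Matrix (Fin (3+d)) (Fin (3+d)) ℂ) * stdFrame (3+d) 3) *
            ((U : Matrix (Fin (3+d)) (Fin (3+d)) ℂ) * stdFrame (3+d) 3)ᴴ * B).det).re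
     = gD (lowM ((U : Matrix (Fin (3+d)) (Fin (3+d)) ℂ)ᴴ * B)) := by
  unfold gD
  rw [lowM_gram]
  have h1 : (U : Matrix (Fin (3+d)) (Fin (3+d)) ℂ) * (U : Matrix (Fin (3+d)) (Fin (3+d)) ℂ)ᴴ = 1 :=
    (mem_unitaryGroup_iff).1 U.2
  have h2 : ((U : Matrix (Fin (3+d)) (Fin (3+d)) ℂ)ᴴ * B)ᴴ * ((U : Matrix (Fin (3+d)) (Fin (3+d)) ℂ)ᴴ * B) = 1 := by
    rw [conjTranspose_mul, conjTranspose_conjTranspose, Matrix.mul_assoc, ← Matrix.mul_assoc _ _ B, h1,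
      Matrix.one_mul, hB]
  rw [h2]
  congr 3
  simp only [conjTranspose_mul, conjTranspose_conjTranspose, Matrix.mul_assoc]

lemma meas_UA (d : ℕ) : Measurable fun p : Matrix (Fin (3+d)) (Fin (3+d)) ℂ × Matrix (Fin (3+d)) (Fin 3) ℂ =>
    gD (lowM (p.1ᴴ * p.2)) := by
  have : SecondCountableTopology (Matrix (Fin (3+d)) (Fin (3+d)) ℂ) :=
    inferInstanceAs (SecondCountableTopology (Fin (3+d) → Fin (3+d) → ℂ))
  have : SecondCountableTopology (Matrix (Fin (3+d)) (Fin 3) ℂ) :=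
    inferInstanceAs (SecondCountableTopology (Fin (3+d) → Fin 3 → ℂ))
  apply Continuous.measurable
  refine cont_gD.comp ?_
  unfold lowM
  exact Continuous.matrix_submatrix (by fun_prop) _ _

lemma meas_mat3 (n : ℕ) : Measurable fun p : (Fin n → ℂ) × (Fin n → ℂ) × (Fin n → ℂ) =>
    mat3 p.1 p.2.1 p.2.2 := by
  unfold mat3
  refine meas_snocM.comp (Measurable.prodMk (meas_snocM.comp (Measurable.prodMk
    (meas_snocM.comp (Measurable.prodMk measurable_const measurable_fst)) (by fun_prop))) (by fun_prop))

lemma meas_mulU (d : ℕ) (g : unitaryGroup (Fin d) ℂ) : Measurable fun U : unitaryGroup (Fin d) ℂ => g * U := by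
  refine Measurable.subtype_mk ?_
  have : Continuous fun M : Matrix (Fin d) (Fin d) ℂ => (g : Matrix (Fin d) (Fin d) ℂ) * M := by fun_prop
  exact this.measurable.comp measurable_subtype_coe

section haar
variable (d : ℕ) (μ : Measure (unitaryGroup (Fin (3+d)) ℂ))

/-- the moments -/
noncomputable def mom (k : ℕ) : ENNReal :=
  ∫⁻ U, ENNReal.ofReal (gD (lowM ((U : Matrix (Fin (3+d)) (Fin (3+d)) ℂ)ᴴ * stdFrame (3+d) 3))) ^ k ∂μ

lemma meas_UA' (k : ℕ) (A : Matrix (Fin (3+d)) (Fin 3) ℂ) : Measurable fun U : unitaryGroup (Fin (3+d)) ℂ =>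
    ENNReal.ofReal (gD (lowM ((U : Matrix (Fin (3+d)) (Fin (3+d)) ℂ)ᴴ * A))) ^ k := by
  refine ((meas_UA d).comp (Measurable.prodMk ?_ measurable_const)).ennreal_ofReal.pow_const k
  exact measurable_subtype_coe

lemma mom_A [μ.IsMulLeftInvariant] (k : ℕ) (A : Matrix (Fin (3+d)) (Fin 3) ℂ) :
    ∫⁻ U, ENNReal.ofReal (gD (lowM ((U : Matrix (Fin (3+d)) (Fin (3+d)) ℂ)ᴴ * A))) ^ k ∂μ =
      ENNReal.ofReal (gD A) ^ k * mom d μ k := by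
  obtain ⟨V, hV, R, rfl⟩ := qr_exists 3 d A
  let V' : unitaryGroup (Fin (3+d)) ℂ := ⟨Vᴴ, Unitary.star_mem hV⟩
  rw [gD_unitary V hV, gD_frame]
  unfold mom
  have h := map_mul_left_eq_self μ V'
  have hmm : Measurable fun U : unitaryGroup (Fin (3+d)) ℂ => ENNReal.ofReal (gD (lowM
      (((V' * U : unitaryGroup (Fin (3+d)) ℂ) : Matrix (Fin (3+d)) (Fin (3+d)) ℂ)ᴴ * stdFrame (3+d) 3))) ^ k :=
    (meas_UA' d k _).comp (meas_mulU _ V')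
  conv_rhs => rw [← h]
  rw [lintegral_map (meas_UA' d k _) (meas_mulU _ V'), ← lintegral_const_mul _ hmm]
  refine lintegral_congr fun U => ?_
  have : ((V' * U : unitaryGroup (Fin (3+d)) ℂ) : Matrix (Fin (3+d)) (Fin (3+d)) ℂ)ᴴ =
     (U : Matrix (Fin (3+d)) (Fin (3+d)) ℂ)ᴴ * V := by
    have : ((V' * U : unitaryGroup (Fin (3+d)) ℂ) : Matrix (Fin (3+d)) (Fin (3+d)) ℂ) = Vᴴ * U := rfl
    rw [this, conjTranspose_mul, conjTranspose_conjTranspose]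
  rw [this, ← mul_pow, ← ENNReal.ofReal_mul (by positivity)]
  congr 2
  rw [← Matrix.mul_assoc V, ← Matrix.mul_assoc, lowM_mul, gD_mul_right, mul_comm, Matrix.mul_assoc]

instance gV_prod_sfinite (n : ℕ) : SFinite ((gV n).prod (gV n)) := by
  have : SFinite (gV n) := inferInstance
  exact Measure.prod.instSFinite

lemma nested_eq (n : ℕ) (F : (Fin n → ℂ) × (Fin n → ℂ) × (Fin n → ℂ) → ENNReal) (hF : Measurable F) :
    ∫⁻ p, F p ∂((gV n).prod ((gV n).prod (gV n))) = ∫⁻ a, ∫⁻ b, ∫⁻ c, F (a, b, c) ∂(gV n) ∂(gV n) ∂(gV n) := by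
  rw [lintegral_prod _ hF.aemeasurable]
  refine lintegral_congr fun a => ?_
  exact lintegral_prod (fun q => F (a, q)) (hF.comp measurable_prodMk_left).aemeasurable

lemma mat3_mul {n : ℕ} (V : Matrix (Fin n) (Fin n) ℂ) (a b c : Fin n → ℂ) :
    V * mat3 a b c = mat3 (V *ᵥ a) (V *ᵥ b) (V *ᵥ c) := by
  unfold mat3
  rw [snocM_mul, snocM_mul, snocM_mul]
  simp

lemma nested_inv (n : ℕ) (F : (Fin n → ℂ) × (Fin n → ℂ) × (Fin n → ℂ) → ENNReal) (hF : Measurable F)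
    (V : Matrix (Fin n) (Fin n) ℂ) (hV : V ∈ unitaryGroup (Fin n) ℂ) :
    ∫⁻ a, ∫⁻ b, ∫⁻ c, F (V *ᵥ a, V *ᵥ b, V *ᵥ c) ∂(gV n) ∂(gV n) ∂(gV n) =
    ∫⁻ a, ∫⁻ b, ∫⁻ c, F (a, b, c) ∂(gV n) ∂(gV n) ∂(gV n) := by
  have h1 : ∀ a b, ∫⁻ c, F (a, b, V *ᵥ c) ∂(gV n) = ∫⁻ c, F (a, b, c) ∂(gV n) := fun a b =>
    gV_unitary V hV (fun c => F (a, b, c)) (hF.comp (measurable_prodMk_left.comp measurable_prodMk_left))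
  have h2 : ∀ a, ∫⁻ b, ∫⁻ c, F (a, V *ᵥ b, c) ∂(gV n) ∂(gV n) = ∫⁻ b, ∫⁻ c, F (a, b, c) ∂(gV n) ∂(gV n) := fun a =>
    gV_unitary V hV (fun b => ∫⁻ c, F (a, b, c) ∂(gV n))
      (Measurable.lintegral_prod_right' (f := fun p : (Fin n → ℂ) × (Fin n → ℂ) => F (a, p))
        (hF.comp measurable_prodMk_left))
  simp_rw [h1, h2]
  refine gV_unitary V hV (fun a => ∫⁻ b, ∫⁻ c, F (a, b, c) ∂(gV n) ∂(gV n)) ?_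
  have : ∀ a, ∫⁻ b, ∫⁻ c, F (a, b, c) ∂(gV n) ∂(gV n) = ∫⁻ p, F (a, p) ∂((gV n).prod (gV n)) := fun a => by
    exact (lintegral_prod (fun q => F (a, q)) (hF.comp measurable_prodMk_left).aemeasurable).symm
  simp_rw [this]
  exact hF.lintegral_prod_right'

lemma lowM_mat3 (a b c : Fin (3+d) → ℂ) : lowM (mat3 a b c) =
    mat3 (fun i => a (Fin.natAdd 3 i)) (fun i => b (Fin.natAdd 3 i)) (fun i => c (Fin.natAdd 3 i)) := by
  ext i j
  fin_cases j <;> rfl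

lemma nested_marginal (F : (Fin d → ℂ) × (Fin d → ℂ) × (Fin d → ℂ) → ENNReal) (hF : Measurable F) :
    ∫⁻ a, ∫⁻ b, ∫⁻ c, F (fun i => a (Fin.natAdd 3 i), fun i => b (Fin.natAdd 3 i), fun i => c (Fin.natAdd 3 i))
      ∂(gV (3+d)) ∂(gV (3+d)) ∂(gV (3+d)) =
    ∫⁻ a, ∫⁻ b, ∫⁻ c, F (a, b, c) ∂(gV d) ∂(gV d) ∂(gV d) := by
  have h1 : ∀ a b, ∫⁻ c, F (a, b, fun i => c (Fin.natAdd 3 i)) ∂(gV (3+d)) = ∫⁻ c, F (a, b, c) ∂(gV d) := fun a b =>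
    gV_marginal 3 d (fun c => F (a, b, c)) (hF.comp (measurable_prodMk_left.comp measurable_prodMk_left))
  have h2 : ∀ a, ∫⁻ b, ∫⁻ c, F (a, fun i => b (Fin.natAdd 3 i), c) ∂(gV d) ∂(gV (3+d)) = ∫⁻ b, ∫⁻ c, F (a, b, c) ∂(gV d) ∂(gV d) := fun a =>
    gV_marginal 3 d (fun b => ∫⁻ c, F (a, b, c) ∂(gV d))
      (Measurable.lintegral_prod_right' (f := fun p : (Fin d → ℂ) × (Fin d → ℂ) => F (a, p))
        (hF.comp measurable_prodMk_left))
  simp_rw [h1, h2]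
  refine gV_marginal 3 d (fun a => ∫⁻ b, ∫⁻ c, F (a, b, c) ∂(gV d) ∂(gV d)) ?_
  have : ∀ a, ∫⁻ b, ∫⁻ c, F (a, b, c) ∂(gV d) ∂(gV d) = ∫⁻ p, F (a, p) ∂((gV d).prod (gV d)) := fun a => by
    exact (lintegral_prod (fun q => F (a, q)) (hF.comp measurable_prodMk_left).aemeasurable).symm
  simp_rw [this]
  exact hF.lintegral_prod_right'

lemma mom_eq [IsProbabilityMeasure μ] [μ.IsMulLeftInvariant] (k : ℕ) :
    (∫⁻ a, ∫⁻ b, ∫⁻ c, ENNReal.ofReal (gD (mat3 a b c)) ^ k ∂(gV d) ∂(gV d) ∂(gV d)) =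
    (∫⁻ a, ∫⁻ b, ∫⁻ c, ENNReal.ofReal (gD (mat3 a b c)) ^ k ∂(gV (3+d)) ∂(gV (3+d)) ∂(gV (3+d))) * mom d μ k := by
  have hm : ∀ n, Measurable fun p : (Fin n → ℂ) × (Fin n → ℂ) × (Fin n → ℂ) =>
    ENNReal.ofReal (gD (mat3 p.1 p.2.1 p.2.2)) ^ k := fun n =>
      (meas_gD.comp (meas_mat3 n)).ennreal_ofReal.pow_const k
  have hm2 : Measurable fun p : unitaryGroup (Fin (3+d)) ℂ × ((Fin (3+d) → ℂ) × (Fin (3+d) → ℂ) × (Fin (3+d) → ℂ)) =>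
      ENNReal.ofReal (gD (lowM ((p.1 : Matrix (Fin (3+d)) (Fin (3+d)) ℂ)ᴴ * mat3 p.2.1 p.2.2.1 p.2.2.2))) ^ k := by
    refine ((meas_UA d).comp (Measurable.prodMk (measurable_subtype_coe.comp measurable_fst)
      ((meas_mat3 _).comp measurable_snd))).ennreal_ofReal.pow_const k
  have hm3 : Measurable fun p : (Fin (3+d) → ℂ) × (Fin (3+d) → ℂ) × (Fin (3+d) → ℂ) =>
      ENNReal.ofReal (gD (lowM (mat3 p.1 p.2.1 p.2.2))) ^ k := by
    have := hm2.comp (measurable_prodMk_left (x := (1 : unitaryGroup (Fin (3+d)) ℂ)))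
    simpa [Function.comp_def] using this
  have e1 := nested_marginal d _ (hm d)
  simp only [← lowM_mat3] at e1
  have e2 : ∀ U : unitaryGroup (Fin (3+d)) ℂ,
      ∫⁻ p, ENNReal.ofReal (gD (lowM ((U : Matrix (Fin (3+d)) (Fin (3+d)) ℂ)ᴴ * mat3 p.1 p.2.1 p.2.2))) ^ k
        ∂((gV (3+d)).prod ((gV (3+d)).prod (gV (3+d)))) =
      ∫⁻ a, ∫⁻ b, ∫⁻ c, ENNReal.ofReal (gD (mat3 a b c)) ^ k ∂(gV d) ∂(gV d) ∂(gV d) := by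
    intro U
    have hm4 : Measurable fun p : (Fin (3+d) → ℂ) × (Fin (3+d) → ℂ) × (Fin (3+d) → ℂ) =>
        ENNReal.ofReal (gD (lowM ((U : Matrix (Fin (3+d)) (Fin (3+d)) ℂ)ᴴ * mat3 p.1 p.2.1 p.2.2))) ^ k :=
      ((meas_UA d).comp (Measurable.prodMk measurable_const (meas_mat3 _))).ennreal_ofReal.pow_const k
    have s1 := nested_eq _ _ hm4
    have s2 := nested_inv _ _ hm3 (U : Matrix (Fin (3+d)) (Fin (3+d)) ℂ)ᴴ (Unitary.star_mem U.2)
    simp only [mat3_mul] at s1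
    simp only at s2
    simp only [mat3_mul]
    exact s1.trans (s2.trans e1)
  calc _ = ∫⁻ U, ∫⁻ p, ENNReal.ofReal (gD (lowM ((U : Matrix (Fin (3+d)) (Fin (3+d)) ℂ)ᴴ * mat3 p.1 p.2.1 p.2.2))) ^ k
        ∂((gV (3+d)).prod ((gV (3+d)).prod (gV (3+d)))) ∂μ := by
        simp_rw [e2]
        simp
    _ = ∫⁻ p, ∫⁻ U, ENNReal.ofReal (gD (lowM ((U : Matrix (Fin (3+d)) (Fin (3+d)) ℂ)ᴴ * mat3 p.1 p.2.1 p.2.2))) ^ k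
        ∂μ ∂((gV (3+d)).prod ((gV (3+d)).prod (gV (3+d)))) := lintegral_lintegral_swap hm2.aemeasurable
    _ = _ := by
        simp_rw [mom_A]
        rw [lintegral_mul_const _ (hm _), nested_eq _ _ (hm _)]

end haar


lemma wishart' (n e k : ℕ) (hn : n = e + 3) :
    ∫⁻ a, ∫⁻ b, ∫⁻ c, ENNReal.ofReal (gD (mat3 a b c)) ^ k ∂(gV n) ∂(gV n) ∂(gV n) =
      ((e+1).ascFactorial k : ENNReal) * ((e+2).ascFactorial k) * ((e+3).ascFactorial k) := by
  subst hn; exact wishart e k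

lemma asc_rec (n k : ℕ) : ((n.ascFactorial k : ℕ) : ℝ) * (n + k) = n * ((n+1).ascFactorial k : ℕ) := by
  have h1 := Nat.succ_ascFactorial n k
  simp only [Nat.succ_eq_add_one] at h1
  have : (n.ascFactorial k) * (n + k) = n * ((n+1).ascFactorial k) := by
    rw [h1]; ring
  exact_mod_cast this

lemma mom_val (e k : ℕ) (μ : Measure (unitaryGroup (Fin (3+(e+3))) ℂ))
    [IsProbabilityMeasure μ] [μ.IsMulLeftInvariant] :
    (mom (e+3) μ k).toReal =
      (((e:ℝ)+1) * (e+2)^2 * (e+3)^3 * (e+4)^2 * (e+5)) /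
        (((e:ℝ)+k+1) * (e+k+2)^2 * (e+k+3)^3 * (e+k+4)^2 * (e+k+5)) := by
  have h := mom_eq (e+3) μ k
  rw [wishart' (e+3) e k rfl, wishart' (3+(e+3)) (e+3) k (by ring)] at h
  have h' := congrArg ENNReal.toReal h
  simp only [ENNReal.toReal_mul, ENNReal.toReal_natCast] at h'
  have r1 := asc_rec (e+1) k
  have r2 := asc_rec (e+2) k
  have r3 := asc_rec (e+3) k
  have r4 := asc_rec (e+4) k
  have r5 := asc_rec (e+5) k
  simp only [show e+1+1 = e+2 from rfl, show e+2+1 = e+3 from rfl, show e+3+1 = e+4 from rfl,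
    show e+3+2 = e+5 from rfl, show e+3+3 = e+6 from rfl,
    show e+4+1 = e+5 from rfl, show e+5+1 = e+6 from rfl] at r1 r2 r3 r4 r5 h'
  have p6 : (0:ℝ) < ((e+6).ascFactorial k : ℕ) := by exact_mod_cast Nat.ascFactorial_pos _ _
  have p5 : (0:ℝ) < ((e+5).ascFactorial k : ℕ) := by exact_mod_cast Nat.ascFactorial_pos _ _
  have p4 : (0:ℝ) < ((e+4).ascFactorial k : ℕ) := by exact_mod_cast Nat.ascFactorial_pos _ _
  push_cast at r1 r2 r3 r4 r5
  generalize (((e+1).ascFactorial k : ℕ) : ℝ) = a1 at *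
  generalize (((e+2).ascFactorial k : ℕ) : ℝ) = a2 at *
  generalize (((e+3).ascFactorial k : ℕ) : ℝ) = a3 at *
  generalize (((e+4).ascFactorial k : ℕ) : ℝ) = a4 at *
  generalize (((e+5).ascFactorial k : ℕ) : ℝ) = a5 at *
  generalize (((e+6).ascFactorial k : ℕ) : ℝ) = a6 at *
  generalize (mom (e+3) μ k).toReal = M at *
  have he : (0:ℝ) ≤ e := by positivity
  have hk : (0:ℝ) ≤ k := by positivity
  generalize (e:ℝ) = x at *
  generalize (k:ℝ) = y at *
  have s1 : a1 = (x+1)*a2/(x+1+y) := by rw [eq_div_iff (by positivity)]; linarith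
  have s2 : a2 = (x+2)*a3/(x+2+y) := by rw [eq_div_iff (by positivity)]; linarith
  have s3 : a3 = (x+3)*a4/(x+3+y) := by rw [eq_div_iff (by positivity)]; linarith
  have s4 : a4 = (x+4)*a5/(x+4+y) := by rw [eq_div_iff (by positivity)]; linarith
  have s5 : a5 = (x+5)*a6/(x+5+y) := by rw [eq_div_iff (by positivity)]; linarith
  have hM : M = a1*a2*a3/(a4*a5*a6) := by
    rw [eq_div_iff (by positivity)]; linarith
  rw [hM, s1, s2, s3, s4, s5]
  field_simp
  ring

lemma moment_ext (P P' : Measure ℝ) [IsFiniteMeasure P] [IsFiniteMeasure P'] (M : ℝ)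
    (hP : ∀ᵐ x ∂P, x ∈ Set.Icc (-M) M) (hP' : ∀ᵐ x ∂P', x ∈ Set.Icc (-M) M)
    (h : ∀ k : ℕ, ∫ x, x ^ k ∂P = ∫ x, x ^ k ∂P') : P = P' := by
  have hInteg : ∀ (Q : Measure ℝ) [IsFiniteMeasure Q], (∀ᵐ x ∂Q, x ∈ Set.Icc (-M) M) →
      ∀ f : ℝ → ℝ, Continuous f → Integrable f Q := by
    intro Q _ hQ f hf
    obtain ⟨C, hC⟩ := isCompact_Icc.exists_bound_of_continuousOn (hf.continuousOn (s := Set.Icc (-M) M))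
    exact Integrable.of_bound hf.aestronglyMeasurable C (hQ.mono hC)
  have hpoly : ∀ p : Polynomial ℝ, ∫ x, p.eval x ∂P = ∫ x, p.eval x ∂P' := by
    intro p
    simp_rw [Polynomial.eval_eq_sum_range]
    rw [integral_finsetSum _ (fun i _ => hInteg P hP _ (by fun_prop)),
      integral_finsetSum _ (fun i _ => hInteg P' hP' _ (by fun_prop))]
    simp_rw [integral_const_mul, h]
  refine ext_of_forall_integral_eq_of_IsFiniteMeasure fun f => ?_
  have hb : ∀ ε > 0, |∫ x, f x ∂P - ∫ x, f x ∂P'| ≤ ε * (P.real Set.univ + P'.real Set.univ) := by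
    intro ε hε
    obtain ⟨p, hp⟩ := exists_polynomial_near_of_continuousOn (-M) M f f.continuous.continuousOn ε hε
    have key : ∀ (Q : Measure ℝ) [IsFiniteMeasure Q], (∀ᵐ x ∂Q, x ∈ Set.Icc (-M) M) →
        |∫ x, f x ∂Q - ∫ x, p.eval x ∂Q| ≤ ε * Q.real Set.univ := by
      intro Q _ hQ
      rw [← integral_sub (hInteg Q hQ _ f.continuous) (hInteg Q hQ _ p.continuous), ← Real.norm_eq_abs]
      refine norm_integral_le_of_norm_le_const (hQ.mono fun x hx => ?_)
      rw [Real.norm_eq_abs, abs_sub_comm]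
      exact (hp x hx).le
    have k1 := key P hP
    have k2 := key P' hP'
    rw [hpoly] at k1
    rw [abs_le] at *
    constructor <;> linarith
  have hz : |∫ x, f x ∂P - ∫ x, f x ∂P'| ≤ 0 := by
    refine le_of_forall_pos_le_add fun δ hδ => ?_
    have hc : 0 ≤ P.real Set.univ + P'.real Set.univ := by positivity
    refine (hb (δ / (P.real Set.univ + P'.real Set.univ + 1)) (by positivity)).trans ?_
    rw [zero_add, div_mul_eq_mul_div, div_le_iff₀ (by positivity)]
    nlinarith
  exact sub_eq_zero.1 (abs_nonpos_iff.1 hz)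

lemma J1 (n : ℕ) : ∫ x in (0:ℝ)..1, x ^ n * (x * Real.log x) = -1 / ((n:ℝ)+2)^2 := by
  have hc := Real.continuous_mul_log
  have := intervalIntegral.integral_eq_sub_of_hasDerivAt_of_le (a := 0) (b := 1)
    (f := fun x : ℝ => x ^ (n+1) * (x * Real.log x) / (n+2) - x ^ (n+2) / ((n:ℝ)+2)^2)
    (f' := fun x => x ^ n * (x * Real.log x)) zero_le_one
    (Continuous.continuousOn (by fun_prop)) (fun x hx => ?_)
    (Continuous.intervalIntegrable (by fun_prop) _ _)
  · rw [this]; simp; ring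
  · have hx0 : x ≠ 0 := hx.1.ne'
    have h1 := ((hasDerivAt_pow (n+1) x).mul ((hasDerivAt_id x).mul (Real.hasDerivAt_log hx0))).div_const ((n:ℝ)+2)
    have h2 := (hasDerivAt_pow (n+2) x).div_const (((n:ℝ)+2)^2)
    refine HasDerivAt.congr_deriv (h1.sub h2) ?_
    simp only [id, Pi.mul_apply, Nat.add_sub_cancel, show n + 2 - 1 = n + 1 from rfl]
    push_cast
    field_simp
    ring

lemma J2 (n : ℕ) : ∫ x in (0:ℝ)..1, x ^ n * (x * Real.log x) ^ 2 = 2 / ((n:ℝ)+3)^3 := by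
  have hc := Real.continuous_mul_log
  have := intervalIntegral.integral_eq_sub_of_hasDerivAt_of_le (a := 0) (b := 1)
    (f := fun x : ℝ => x ^ (n+1) * (x * Real.log x) ^ 2 / (n+3) - 2 * (x ^ (n+2) * (x * Real.log x)) / ((n:ℝ)+3)^2
      + 2 * x ^ (n+3) / ((n:ℝ)+3)^3)
    (f' := fun x => x ^ n * (x * Real.log x) ^ 2) zero_le_one
    (Continuous.continuousOn (by fun_prop)) (fun x hx => ?_)
    (Continuous.intervalIntegrable (by fun_prop) _ _)
  · rw [this]; simp
  · have hx0 : x ≠ 0 := hx.1.ne'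
    have hL := (hasDerivAt_id x).mul (Real.hasDerivAt_log hx0)
    have h1 := ((hasDerivAt_pow (n+1) x).mul (hL.pow 2)).div_const ((n:ℝ)+3)
    have h2 := (((hasDerivAt_pow (n+2) x).mul hL).const_mul 2).div_const (((n:ℝ)+3)^2)
    have h3 := ((hasDerivAt_pow (n+3) x).const_mul 2).div_const (((n:ℝ)+3)^3)
    refine HasDerivAt.congr_deriv ((h1.sub h2).add h3) ?_
    simp only [id, Pi.mul_apply, Pi.pow_apply, Nat.add_sub_cancel, show n + 2 - 1 = n + 1 from rfl, show n + 3 - 1 = n + 2 from rfl]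
    push_cast
    field_simp
    ring

/-- the density formula -/
noncomputable def dens (e : ℕ) (x : ℝ) : ℝ :=
  (1 / 288) * ((e:ℝ)+5) * (e+4)^2 * (e+3)^3 * (e+2)^2 * (e+1) * x ^ e *
    (1 + 80 * x - 162 * x ^ 2 + 80 * x ^ 3 + x ^ 4 + 24 * x * Real.log x -
                24 * x ^ 3 * Real.log x - 36 * x ^ 2 * Real.log x ^ 2)

lemma dens_eq (e : ℕ) (x : ℝ) : dens e x =
  ((1 / 288) * ((e:ℝ)+5) * (e+4)^2 * (e+3)^3 * (e+2)^2 * (e+1)) *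
    (x ^ e + 80 * x ^ (e+1) - 162 * x ^ (e+2) + 80 * x ^ (e+3) + x ^ (e+4) + 24 * (x ^ e * (x * Real.log x)) -
                24 * (x ^ (e+2) * (x * Real.log x)) - 36 * (x ^ e * (x * Real.log x) ^ 2)) := by
  unfold dens; ring

lemma dens_cont (e : ℕ) : Continuous (dens e) := by
  have hc := Real.continuous_mul_log
  have : dens e = _ := funext (dens_eq e)
  rw [this]
  fun_prop

lemma dens_moment (e k : ℕ) : ∫ x in (0:ℝ)..1, x ^ k * dens e x =
      (((e:ℝ)+1) * (e+2)^2 * (e+3)^3 * (e+4)^2 * (e+5)) /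
        (((e:ℝ)+k+1) * (e+k+2)^2 * (e+k+3)^3 * (e+k+4)^2 * (e+k+5)) := by
  have hc := Real.continuous_mul_log
  set C : ℝ := ((1 / 288) * ((e:ℝ)+5) * (e+4)^2 * (e+3)^3 * (e+2)^2 * (e+1)) with hC
  have h : ∀ x, x ^ k * dens e x = C *
    (x ^ (e+k) + 80 * x ^ (e+k+1) - 162 * x ^ (e+k+2) + 80 * x ^ (e+k+3) + x ^ (e+k+4) + 24 * (x ^ (e+k) * (x * Real.log x)) -
                24 * (x ^ (e+k+2) * (x * Real.log x)) - 36 * (x ^ (e+k) * (x * Real.log x) ^ 2)) := by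
    intro x; rw [dens_eq]; ring
  simp_rw [h]
  rw [intervalIntegral.integral_const_mul, intervalIntegral.integral_sub, intervalIntegral.integral_sub,
    intervalIntegral.integral_add, intervalIntegral.integral_add, intervalIntegral.integral_add,
    intervalIntegral.integral_sub, intervalIntegral.integral_add]
  rotate_left
  iterate 14 exact Continuous.intervalIntegrable (by fun_prop) _ _
  simp only [intervalIntegral.integral_const_mul, J1, J2, integral_pow]
  rw [hC]
  push_cast
  have he : (0:ℝ) ≤ e := by positivity
  have hk : (0:ℝ) ≤ k := by positivity
  generalize (e:ℝ) = x at *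
  generalize (k:ℝ) = y at *
  have e1 : 1 ^ (e+k+1) - (0:ℝ) ^ (e+k+1) = 1 := by simp
  have e2 : 1 ^ (e+k+1+1) - (0:ℝ) ^ (e+k+1+1) = 1 := by simp
  have e3 : 1 ^ (e+k+2+1) - (0:ℝ) ^ (e+k+2+1) = 1 := by simp
  have e4 : 1 ^ (e+k+3+1) - (0:ℝ) ^ (e+k+3+1) = 1 := by simp
  have e5 : 1 ^ (e+k+4+1) - (0:ℝ) ^ (e+k+4+1) = 1 := by simp
  rw [e1, e2, e3, e4, e5]
  have key : ∀ s : ℝ, 0 ≤ s → 1 / (s+1) + 80 * (1 / (s+1+1)) - 162 * (1 / (s+2+1)) + 80 * (1/(s+3+1)) + 1 / (s+4+1)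
     + 24 * (-1 / (s+2)^2) - 24 * (-1 / (s+2+2)^2) - 36 * (2 / (s+3)^3) =
     288 / ((s+1) * (s+2)^2 * (s+3)^3 * (s+4)^2 * (s+5)) := by
    intro s hs
    rw [show s+1+1 = s+2 by ring, show s+2+1 = s+3 by ring, show s+3+1 = s+4 by ring, show s+4+1 = s+5 by ring,
      show s+2+2 = s+4 by ring]
    field_simp
    ring
  rw [key (x+y) (by positivity)]
  field_simp

lemma bounded_phi (d : ℕ) (B : Matrix (Fin (3+d)) (Fin 3) ℂ) : ∃ M : ℝ, ∀ U : unitaryGroup (Fin (3+d)) ℂ,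
    |gD (lowM ((U : Matrix (Fin (3+d)) (Fin (3+d)) ℂ)ᴴ * B))| ≤ M := by
  let K : Set (Matrix (Fin (3+d)) (Fin (3+d)) ℂ) :=
    Set.univ.pi fun _ => Set.univ.pi fun _ => Metric.closedBall (0:ℂ) 1
  have hK : IsCompact K := isCompact_univ_pi fun _ => isCompact_univ_pi fun _ => isCompact_closedBall _ _
  have hc : Continuous fun U : Matrix (Fin (3+d)) (Fin (3+d)) ℂ => gD (lowM (Uᴴ * B)) := by
    refine cont_gD.comp ?_
    unfold lowM
    exact Continuous.matrix_submatrix (by fun_prop) _ _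
  obtain ⟨M, hM⟩ := hK.exists_bound_of_continuousOn hc.continuousOn
  refine ⟨M, fun U => ?_⟩
  rw [← Real.norm_eq_abs]
  refine hM _ ?_
  intro i _ j _
  simpa using entry_norm_bound_of_unitary U.2 i j


lemma meas_identify (e : ℕ) (ν : Measure ℝ) [IsProbabilityMeasure ν] (M : ℝ)
    (hν : ∀ᵐ x ∂ν, x ∈ Set.Icc (-M) M)
    (h : ∀ k : ℕ, ∫ x, x ^ k ∂ν = ∫ x in (0:ℝ)..1, x ^ k * dens e x) :
    ν = (volume.restrict (Set.Ioo (0:ℝ) 1)).withDensity (fun x => ENNReal.ofReal (dens e x)) := by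
  set lam : Measure ℝ := volume.restrict (Set.Ioo (0:ℝ) 1) with hlam
  have hcont := dens_cont e
  have hIntegC : ∀ f : ℝ → ℝ, Continuous f → Integrable f lam := fun f hf =>
    (hf.integrableOn_Icc (a := 0) (b := 1)).mono_set Set.Ioo_subset_Icc_self
  have hm : Measurable (fun x => ENNReal.ofReal (dens e x)) := hcont.measurable.ennreal_ofReal
  have hm' : Measurable (fun x => ENNReal.ofReal (-dens e x)) := hcont.neg.measurable.ennreal_ofReal
  set P1 := lam.withDensity (fun x => ENNReal.ofReal (dens e x)) with hP1
  set P2 := lam.withDensity (fun x => ENNReal.ofReal (-dens e x)) with hP2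
  have : IsFiniteMeasure P1 := isFiniteMeasure_withDensity_ofReal (hIntegC _ hcont).2
  have : IsFiniteMeasure P2 := isFiniteMeasure_withDensity_ofReal (hIntegC _ hcont.neg).2
  have hl : ∀ᵐ x ∂lam, x ∈ Set.Icc (-(max M 1)) (max M 1) := by
    filter_upwards [ae_restrict_mem measurableSet_Ioo] with x hx
    have := le_max_right M 1
    exact ⟨by linarith [hx.1], by linarith [hx.2]⟩
  have a1 : ∀ᵐ x ∂P1, x ∈ Set.Icc (-(max M 1)) (max M 1) := (withDensity_absolutelyContinuous _ _).ae_le hl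
  have a2 : ∀ᵐ x ∂P2, x ∈ Set.Icc (-(max M 1)) (max M 1) := (withDensity_absolutelyContinuous _ _).ae_le hl
  have a3 : ∀ᵐ x ∂ν, x ∈ Set.Icc (-(max M 1)) (max M 1) := by
    filter_upwards [hν] with x hx
    have := le_max_left M 1
    exact ⟨by linarith [hx.1], by linarith [hx.2]⟩
  have hInteg : ∀ (Q : Measure ℝ) [IsFiniteMeasure Q], (∀ᵐ x ∂Q, x ∈ Set.Icc (-(max M 1)) (max M 1)) →
      ∀ f : ℝ → ℝ, Continuous f → Integrable f Q := by
    intro Q _ hQ f hf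
    obtain ⟨C, hC⟩ := isCompact_Icc.exists_bound_of_continuousOn (hf.continuousOn (s := Set.Icc (-(max M 1)) (max M 1)))
    exact Integrable.of_bound hf.aestronglyMeasurable C (hQ.mono hC)
  have key : P1 = ν + P2 := by
    refine moment_ext P1 (ν + P2) (max M 1) a1 (ae_add_measure_iff.2 ⟨a3, a2⟩) fun k => ?_
    have hk : Continuous fun x : ℝ => x ^ k := by fun_prop
    rw [integral_add_measure (hInteg ν a3 _ hk) (hInteg P2 a2 _ hk), h k, hP1, hP2,
      integral_withDensity_eq_integral_toReal_smul hm (by simp),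
      integral_withDensity_eq_integral_toReal_smul hm' (by simp),
      intervalIntegral.integral_of_le zero_le_one, integral_Ioc_eq_integral_Ioo, ← hlam,
      ← integral_add (hIntegC _ (by fun_prop))]
    · refine integral_congr_ae (Filter.Eventually.of_forall fun x => ?_)
      simp only [ENNReal.toReal_ofReal', smul_eq_mul]
      rcases le_total (dens e x) 0 with hx | hx
      · rw [max_eq_right hx, max_eq_left (by linarith)]; ring
      · rw [max_eq_left hx, max_eq_right (by linarith)]; ring
    · simp only [ENNReal.toReal_ofReal', smul_eq_mul]
      exact hIntegC _ (by fun_prop)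
  have hS : MeasurableSet {x | dens e x < 0} := (isOpen_lt hcont continuous_const).measurableSet
  have z1 : P1 {x | dens e x < 0} = 0 := by
    rw [hP1, withDensity_apply _ hS, setLIntegral_congr_fun hS (g := fun _ => 0)]
    · simp
    · intro x hx
      exact ENNReal.ofReal_of_nonpos (le_of_lt hx)
  have z2 : P2 {x | dens e x < 0}ᶜ = 0 := by
    rw [hP2, withDensity_apply _ hS.compl, setLIntegral_congr_fun hS.compl (g := fun _ => 0)]
    · simp
    · intro x hx
      have : 0 ≤ dens e x := not_lt.1 hx
      exact ENNReal.ofReal_of_nonpos (by linarith)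
  have z3 : P2 {x | dens e x < 0} = 0 := by
    rw [key, Measure.add_apply] at z1
    exact (add_eq_zero.1 z1).2
  have : P2 = 0 := by
    rw [← Measure.measure_univ_eq_zero, ← measure_add_measure_compl hS, z2, z3, add_zero]
  rw [key, this, add_zero]

lemma meas_phi (d : ℕ) (A : Matrix (Fin (3+d)) (Fin 3) ℂ) : Measurable fun U : unitaryGroup (Fin (3+d)) ℂ =>
    gD (lowM ((U : Matrix (Fin (3+d)) (Fin (3+d)) ℂ)ᴴ * A)) := by
  have h := (meas_UA' d 1 A).ennreal_toReal
  simp only [pow_one, ENNReal.toReal_ofReal (gD_nonneg _)] at h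
  exact h

lemma final_aux (e : ℕ)
    (B : Matrix (Fin (3+(e+3))) (Fin 3) ℂ) (hB : Bᴴ * B = 1)
    (μ : Measure (Matrix.unitaryGroup (Fin (3+(e+3))) ℂ))
    [IsProbabilityMeasure μ] [μ.IsMulLeftInvariant] :
    μ.map (fun U : unitaryGroup (Fin (3+(e+3))) ℂ =>
      gD (lowM ((U : Matrix (Fin (3+(e+3))) (Fin (3+(e+3))) ℂ)ᴴ * B))) =
     (volume.restrict (Set.Ioo (0:ℝ) 1)).withDensity (fun x => ENNReal.ofReal (dens e x)) := by
  have hφ : Measurable fun U : unitaryGroup (Fin (3+(e+3))) ℂ =>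
      gD (lowM ((U : Matrix (Fin (3+(e+3))) (Fin (3+(e+3))) ℂ)ᴴ * B)) :=
    meas_phi (e+3) B
  obtain ⟨M, hM⟩ := bounded_phi (e+3) B
  have : IsProbabilityMeasure (μ.map fun U : unitaryGroup (Fin (3+(e+3))) ℂ =>
      gD (lowM ((U : Matrix (Fin (3+(e+3))) (Fin (3+(e+3))) ℂ)ᴴ * B))) :=
    Measure.isProbabilityMeasure_map hφ.aemeasurable
  refine meas_identify e _ M ?_ fun k => ?_
  · refine (ae_map_iff (p := fun x => x ∈ Set.Icc (-M) M) hφ.aemeasurable measurableSet_Icc).2 ?_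
    exact Filter.Eventually.of_forall fun U => abs_le.1 (hM U)
  · rw [dens_moment, ← mom_val e k μ, integral_map hφ.aemeasurable (by fun_prop),
      integral_eq_lintegral_of_nonneg_ae (Filter.Eventually.of_forall fun U => pow_nonneg (gD_nonneg _) k)
        (hφ.pow_const k).aestronglyMeasurable]
    congr 1
    have h := mom_A (e+3) μ k B
    have hgB : gD B = 1 := by unfold gD; rw [hB]; simp
    rw [hgB, ENNReal.ofReal_one, one_pow, one_mul] at h
    rw [← h]
    refine lintegral_congr fun U => ?_
    rw [ENNReal.ofReal_pow (gD_nonneg _)]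

lemma rhs_eq (e : ℕ) : (fun x : ℝ =>
          ENNReal.ofReal (if x ∈ Set.Ioo (0 : ℝ) 1 then
            (1 / 288) * (((3 + (e + 3) : ℕ) : ℝ) - 1) * (((3 + (e + 3) : ℕ) : ℝ) - 2) ^ 2 * (((3 + (e + 3) : ℕ) : ℝ) - 3) ^ 3 *
              (((3 + (e + 3) : ℕ) : ℝ) - 4) ^ 2 * (((3 + (e + 3) : ℕ) : ℝ) - 5) * x ^ (3 + (e + 3) - 6) *
              (1 + 80 * x - 162 * x ^ 2 + 80 * x ^ 3 + x ^ 4 + 24 * x * Real.log x -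
                24 * x ^ 3 * Real.log x - 36 * x ^ 2 * Real.log x ^ 2)
          else 0)) = (Set.Ioo (0:ℝ) 1).indicator (fun x => ENNReal.ofReal (dens e x)) := by
  funext x
  by_cases hx : x ∈ Set.Ioo (0:ℝ) 1
  · rw [if_pos hx, Set.indicator_of_mem hx]
    congr 1
    rw [show 3 + (e + 3) - 6 = e by omega]
    unfold dens
    push_cast
    rw [show (3 + ((e:ℝ) + 3)) - 1 = e + 5 by ring, show (3 + ((e:ℝ) + 3)) - 2 = e + 4 by ring,
      show (3 + ((e:ℝ) + 3)) - 3 = e + 3 by ring, show (3 + ((e:ℝ) + 3)) - 4 = e + 2 by ring,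
      show (3 + ((e:ℝ) + 3)) - 5 = e + 1 by ring]
  · rw [if_neg hx, Set.indicator_of_notMem hx, ENNReal.ofReal_zero]

theorem chordal_product_pdf_M3
    (T : ℕ) (hT : 6 ≤ T)
    (B : Matrix (Fin T) (Fin 3) ℂ) (hB : Bᴴ * B = 1)
    (μ : Measure (Matrix.unitaryGroup (Fin T) ℂ))
    [IsProbabilityMeasure μ] [μ.IsMulLeftInvariant] :
    μ.map (fun U : Matrix.unitaryGroup (Fin T) ℂ =>
        ((1 - Bᴴ * ((U : Matrix (Fin T) (Fin T) ℂ) * stdFrame T 3) *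
            ((U : Matrix (Fin T) (Fin T) ℂ) * stdFrame T 3)ᴴ * B).det).re)
      = volume.withDensity (fun x : ℝ =>
          ENNReal.ofReal (if x ∈ Set.Ioo (0 : ℝ) 1 then
            (1 / 288) * ((T : ℝ) - 1) * ((T : ℝ) - 2) ^ 2 * ((T : ℝ) - 3) ^ 3 *
              ((T : ℝ) - 4) ^ 2 * ((T : ℝ) - 5) * x ^ (T - 6) *
              (1 + 80 * x - 162 * x ^ 2 + 80 * x ^ 3 + x ^ 4 + 24 * x * Real.log x -
                24 * x ^ 3 * Real.log x - 36 * x ^ 2 * Real.log x ^ 2)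
          else 0)) := by
  obtain ⟨e, rfl⟩ : ∃ e, T = 3 + (e + 3) := ⟨T - 6, by omega⟩
  rw [rhs_eq, withDensity_indicator measurableSet_Ioo]
  rw [funext (target_eq (e+3) B hB)]
  exact final_aux e B hB μ
end

section
/- Let T ≥ 6 be an integer and let p be a real number with p > 5 − T. Then ∫_0^1 x^p · (1/288)(T−1)(T−2)²(T−3)³(T−4)²(T−5) x^{T−6}(1 + 80x − 162x² + 80x³ + x⁴ + 24x·log x − 24x³·log x − 36x²·log²x) dx = [(T−1)(T−2)²(T−3)³(T−4)²(T−5)] / [(T+p−1)(T+p−2)²(T+p−3)³(T+p−4)²(T+p−5)]. -/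
lemma aux_cont {a : ℝ} (ha : 0 < a) :
    ContinuousOn (fun x : ℝ => x ^ a * Real.log x) (Set.Icc 0 1) := by
  intro x hx
  rcases hx.1.eq_or_lt with h | h
  · subst h
    have h1 := tendsto_log_mul_rpow_nhdsGT_zero ha
    have h2 : ContinuousWithinAt (fun x : ℝ => x ^ a * Real.log x) (Set.Ioi 0) 0 := by
      unfold ContinuousWithinAt
      simpa [mul_comm] using h1
    have h3 := continuousWithinAt_insert_self.mpr h2
    refine h3.mono ?_
    intro y hy
    rcases hy.1.eq_or_lt with h | h
    · exact Or.inl h.symm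
    · exact Or.inr h
  · exact ((Real.continuousAt_rpow_const x a (Or.inl h.ne')).mul
      (Real.continuousAt_log h.ne')).continuousWithinAt

lemma aux_cont2 {a : ℝ} (ha : 0 < a) :
    ContinuousOn (fun x : ℝ => x ^ a * Real.log x ^ 2) (Set.Icc 0 1) := by
  refine ((aux_cont (half_pos ha)).pow 2).congr ?_
  intro x hx
  have : x ^ a = x ^ (a / 2) * x ^ (a / 2) := by
    rw [← Real.rpow_add_of_nonneg hx.1 (by positivity) (by positivity)]
    ring_nf
  simp only [this, Pi.pow_apply]
  ring

lemma aux_rpow {a : ℝ} (ha : 0 < a) : ContinuousOn (fun x : ℝ => x ^ a) (Set.Icc 0 1) :=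
  (Real.continuous_rpow_const ha.le).continuousOn

lemma aux_ii1 {a : ℝ} (ha : 0 < a) :
    IntervalIntegrable (fun x : ℝ => x ^ a * Real.log x) MeasureTheory.volume 0 1 := by
  apply ContinuousOn.intervalIntegrable
  rw [Set.uIcc_of_le zero_le_one]
  exact aux_cont ha

lemma aux_ii2 {a : ℝ} (ha : 0 < a) :
    IntervalIntegrable (fun x : ℝ => x ^ a * Real.log x ^ 2) MeasureTheory.volume 0 1 := by
  apply ContinuousOn.intervalIntegrable
  rw [Set.uIcc_of_le zero_le_one]
  exact aux_cont2 ha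

lemma aux_deriv {a x : ℝ} (hx : 0 < x) : HasDerivAt (fun x : ℝ => x ^ (a + 1))
    ((a + 1) * x ^ a) x := by
  simpa using Real.hasDerivAt_rpow_const (x := x) (p := a + 1) (Or.inl hx.ne')

lemma aux_int1 {a : ℝ} (ha : 0 < a) :
    ∫ x in (0 : ℝ)..1, x ^ a * Real.log x = - 1 / (a + 1) ^ 2 := by
  have ha1 : 0 < a + 1 := by linarith
  rw [intervalIntegral.integral_eq_sub_of_hasDerivAt_of_le zero_le_one
    (f := fun x => (x ^ (a + 1) * Real.log x) / (a + 1) - x ^ (a + 1) / (a + 1) ^ 2)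
    _ _ (aux_ii1 ha)]
  · simp [Real.zero_rpow ha1.ne']
    ring
  · exact ((aux_cont ha1).div_const _).sub ((aux_rpow ha1).div_const _)
  · intro x hx
    have h0 := hx.1
    convert (((aux_deriv (a := a) h0).mul (Real.hasDerivAt_log h0.ne')).div_const (a + 1)).sub
      ((aux_deriv (a := a) h0).div_const ((a + 1) ^ 2)) using 1
    · rfl
    rw [Real.rpow_add_one h0.ne']
    field_simp
    ring

lemma aux_int2 {a : ℝ} (ha : 0 < a) :
    ∫ x in (0 : ℝ)..1, x ^ a * Real.log x ^ 2 = 2 / (a + 1) ^ 3 := by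
  have ha1 : 0 < a + 1 := by linarith
  rw [intervalIntegral.integral_eq_sub_of_hasDerivAt_of_le zero_le_one
    (f := fun x => (x ^ (a + 1) * Real.log x ^ 2) / (a + 1)
      - 2 * (x ^ (a + 1) * Real.log x) / (a + 1) ^ 2 + 2 * x ^ (a + 1) / (a + 1) ^ 3)
    _ _ (aux_ii2 ha)]
  · simp [Real.zero_rpow ha1.ne']
  · exact (((aux_cont2 ha1).div_const _).sub (((aux_cont ha1).const_mul 2).div_const _)).add
      (((aux_rpow ha1).const_mul 2).div_const _)
  · intro x hx
    have h0 := hx.1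
    have hl := Real.hasDerivAt_log h0.ne'
    have hd := aux_deriv (a := a) h0
    convert (((hd.mul (hl.pow 2)).div_const (a + 1)).sub
      (((hd.mul hl).const_mul 2).div_const ((a + 1) ^ 2))).add
      ((hd.const_mul 2).div_const ((a + 1) ^ 3)) using 1
    · rfl
    rw [Real.rpow_add_one h0.ne']
    simp
    field_simp
    ring

lemma aux_int0 {a : ℝ} (ha : -1 < a) : ∫ x in (0 : ℝ)..1, x ^ a = 1 / (a + 1) := by
  rw [integral_rpow (Or.inl ha)]
  simp [Real.zero_rpow (by linarith : a + 1 ≠ 0)]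


theorem moments_pdf_M3
    (T : ℕ) (hT : 6 ≤ T) (p : ℝ) (hp : 5 - (T : ℝ) < p) :
    (∫ x in (0 : ℝ)..1,
        x ^ p * ((1 / 288) * ((T : ℝ) - 1) * ((T : ℝ) - 2) ^ 2 * ((T : ℝ) - 3) ^ 3 *
          ((T : ℝ) - 4) ^ 2 * ((T : ℝ) - 5) * x ^ (T - 6) *
          (1 + 80 * x - 162 * x ^ 2 + 80 * x ^ 3 + x ^ 4 + 24 * x * Real.log x -
            24 * x ^ 3 * Real.log x - 36 * x ^ 2 * Real.log x ^ 2)))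
      = (((T : ℝ) - 1) * ((T : ℝ) - 2) ^ 2 * ((T : ℝ) - 3) ^ 3 * ((T : ℝ) - 4) ^ 2 *
            ((T : ℝ) - 5)) /
          (((T : ℝ) + p - 1) * ((T : ℝ) + p - 2) ^ 2 * ((T : ℝ) + p - 3) ^ 3 *
            ((T : ℝ) + p - 4) ^ 2 * ((T : ℝ) + p - 5)) := by

  obtain ⟨s, hs⟩ : ∃ s : ℝ, s = (T : ℝ) + p - 5 := ⟨_, rfl⟩
  have hs0 : 0 < s := by linarith
  set C : ℝ := ((T : ℝ) - 1) * ((T : ℝ) - 2) ^ 2 * ((T : ℝ) - 3) ^ 3 *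
          ((T : ℝ) - 4) ^ 2 * ((T : ℝ) - 5) with hC
  have hcongr : ∀ x ∈ Set.uIoc (0 : ℝ) 1,
      x ^ p * ((1 / 288) * ((T : ℝ) - 1) * ((T : ℝ) - 2) ^ 2 * ((T : ℝ) - 3) ^ 3 *
          ((T : ℝ) - 4) ^ 2 * ((T : ℝ) - 5) * x ^ (T - 6) *
          (1 + 80 * x - 162 * x ^ 2 + 80 * x ^ 3 + x ^ 4 + 24 * x * Real.log x -
            24 * x ^ 3 * Real.log x - 36 * x ^ 2 * Real.log x ^ 2))
      = C / 288 * (x ^ (s - 1) + 80 * x ^ s - 162 * x ^ (s + 1) + 80 * x ^ (s + 2) + x ^ (s + 3)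
        + 24 * (x ^ s * Real.log x) - 24 * (x ^ (s + 2) * Real.log x)
        - 36 * (x ^ (s + 1) * Real.log x ^ 2)) := by
    intro x hx
    rw [Set.uIoc_of_le zero_le_one] at hx
    have h0 := hx.1
    have e : x ^ p * x ^ (T - 6) = x ^ (s - 1) := by
      rw [← Real.rpow_natCast, ← Real.rpow_add h0, Nat.cast_sub hT, hs]
      congr 1
      push_cast
      ring
    have en : ∀ n : ℕ, x ^ (s - 1 + n) = x ^ (s - 1) * x ^ n := fun n =>
      Real.rpow_add_natCast h0.ne' _ _
    have e1 : x ^ s = x ^ (s - 1) * x := by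
      have := en 1
      norm_num at this
      exact this
    have e2 : x ^ (s + 1) = x ^ (s - 1) * x ^ 2 := by
      rw [← en 2]; congr 1; push_cast; ring
    have e3 : x ^ (s + 2) = x ^ (s - 1) * x ^ 3 := by
      rw [← en 3]; congr 1; push_cast; ring
    have e4 : x ^ (s + 3) = x ^ (s - 1) * x ^ 4 := by
      rw [← en 4]; congr 1; push_cast; ring
    rw [e1, e2, e3, e4, ← e, hC]
    ring
  rw [intervalIntegral.integral_congr_ae (Filter.Eventually.of_forall hcongr), intervalIntegral.integral_const_mul]
  have i {a : ℝ} (ha : -1 < a) :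
      IntervalIntegrable (fun x : ℝ => x ^ a) MeasureTheory.volume 0 1 :=
    intervalIntegral.intervalIntegrable_rpow' ha
  have j0 := i (a := s - 1) (by linarith)
  have j1 := (i (a := s) (by linarith)).const_mul 80
  have j2 := (i (a := s + 1) (by linarith)).const_mul 162
  have j3 := (i (a := s + 2) (by linarith)).const_mul 80
  have j4 := i (a := s + 3) (by linarith)
  have j5 := (aux_ii1 (a := s) (by linarith)).const_mul 24
  have j6 := (aux_ii1 (a := s + 2) (by linarith)).const_mul 24
  have j7 := (aux_ii2 (a := s + 1) (by linarith)).const_mul 36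
  rw [intervalIntegral.integral_sub (((((((j0.add j1).sub j2).add j3).add j4).add j5).sub j6)) j7,
    intervalIntegral.integral_sub ((((((j0.add j1).sub j2).add j3).add j4).add j5)) j6,
    intervalIntegral.integral_add (((((j0.add j1).sub j2).add j3).add j4)) j5,
    intervalIntegral.integral_add ((((j0.add j1).sub j2).add j3)) j4,
    intervalIntegral.integral_add (((j0.add j1).sub j2)) j3,
    intervalIntegral.integral_sub ((j0.add j1)) j2,
    intervalIntegral.integral_add j0 j1]
  simp only [intervalIntegral.integral_const_mul]
  rw [aux_int0 (by linarith), aux_int0 (by linarith), aux_int0 (by linarith),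
    aux_int0 (by linarith), aux_int0 (by linarith), aux_int1 (by linarith),
    aux_int1 (by linarith), aux_int2 (by linarith)]
  have t1 : (T : ℝ) + p - 1 = s + 4 := by linarith
  have t2 : (T : ℝ) + p - 2 = s + 3 := by linarith
  have t3 : (T : ℝ) + p - 3 = s + 2 := by linarith
  have t4 : (T : ℝ) + p - 4 = s + 1 := by linarith
  rw [t1, t2, t3, t4, ← hs]
  have u1 : s - 1 + 1 = s := by ring
  have u2 : s + 1 + 1 = s + 2 := by ring
  have u3 : s + 2 + 1 = s + 3 := by ring
  have u4 : s + 3 + 1 = s + 4 := by ring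
  rw [u1, u2, u3, u4]
  clear_value C
  field_simp
  ring
end

section
/- Let T ≥ 4 be an integer and let δ ∈ (0,1). Set F_2(δ;T) = (1/2)(T−1)(T−2)²(T−3) δ^{T−3} [ 1/(T−3) − 2δ/(T−2)² − δ²/(T−1) + 2δ·log(δ)/(T−2) ]. Then there exist an integer K with K ≥ 1/F_2(δ;T) and matrices X_1, …, X_K ∈ ℂ^{T×2} with X_i^H X_i = I_2 for all i, such that det(I_2 − X_i^H X_j X_j^H X_i) ≥ δ for all i ≠ j. -/
open Matrix
namespace GV
open MeasureTheory Module Set Filter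

set_option linter.unusedSectionVars false

noncomputable section

attribute [local instance] InnerProductSpace.complexToReal

/-- Gaussian probability measure with density `exp(-π‖z‖²)`. -/
def gauss (E : Type*) [NormedAddCommGroup E] [InnerProductSpace ℂ E] [FiniteDimensional ℂ E]
    [MeasurableSpace E] [BorelSpace E] : Measure E :=
  (volume : Measure E).withDensity (fun z => ENNReal.ofReal (Real.exp (-Real.pi * ‖z‖ ^ 2)))

variable {E : Type*} [NormedAddCommGroup E] [InnerProductSpace ℂ E] [FiniteDimensional ℂ E]
    [MeasurableSpace E] [BorelSpace E]


lemma measurable_dens : Measurable (fun z : E => ENNReal.ofReal (Real.exp (-Real.pi * ‖z‖ ^ 2))) := by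
  fun_prop

instance : IsProbabilityMeasure (gauss E) := by
  constructor
  have h := GaussianFourier.integral_rexp_neg_mul_sq_norm (V := E) Real.pi_pos
  rw [div_self Real.pi_ne_zero, Real.one_rpow] at h
  rw [gauss, withDensity_apply _ MeasurableSet.univ, Measure.restrict_univ,
    ← ofReal_integral_eq_lintegral_ofReal, h, ENNReal.ofReal_one]
  · by_contra hc
    rw [integral_undef hc] at h
    exact zero_ne_one h
  · exact Eventually.of_forall fun _ => (Real.exp_pos _).le

/-- orthogonal splitting as a map to the product -/
def split (K : Submodule ℂ E) (z : E) : K × Kᗮ :=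
  (K.orthogonalProjectionOnto z, Kᗮ.orthogonalProjectionOnto z)

lemma split_mp (K : Submodule ℂ E) :
    MeasurePreserving (split K) (volume : Measure E) ((volume : Measure K).prod volume) := by
  let e : E ≃ₗᵢ[ℝ] WithLp 2 (K × Kᗮ) :=
    { toLinearEquiv := LinearEquiv.restrictScalars ℝ K.orthogonalDecomposition.toLinearEquiv
      norm_map' := fun x => K.orthogonalDecomposition.norm_map x }
  have h1 := e.measurePreserving
  have h2 := WithLp.volume_preserving_ofLp K Kᗮ
  have h3 := h2.comp h1
  have : split K = (@WithLp.ofLp 2 (K × Kᗮ)) ∘ e := by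
    funext z
    change _ = WithLp.ofLp (K.orthogonalDecomposition z)
    rw [Submodule.orthogonalDecomposition_apply]
    rfl
  rw [this]
  exact h3

lemma split_map (K : Submodule ℂ E) :
    MeasurePreserving (split K) (gauss E) ((gauss K).prod (gauss Kᗮ)) := by
  have h := split_mp K
  refine ⟨h.measurable, ?_⟩
  unfold gauss
  rw [prod_withDensity measurable_dens measurable_dens]
  ext s hs
  rw [Measure.map_apply h.measurable hs, withDensity_apply _ (h.measurable hs),
    withDensity_apply _ hs, ← h.setLIntegral_comp_preimage hs (by fun_prop)]
  refine lintegral_congr fun z => ?_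
  rw [← ENNReal.ofReal_mul (Real.exp_pos _).le, ← Real.exp_add,
    Submodule.norm_sq_eq_add_norm_sq_projection z K]
  congr 2
  simp only [split]
  ring

lemma tail4 (hE : finrank ℂ E = 2) (t : ℝ) (ht : 0 ≤ t) :
    gauss E {u : E | t ≤ ‖u‖ ^ 2} =
      ENNReal.ofReal ((1 + Real.pi * t) * Real.exp (-Real.pi * t)) := by
  have hR : finrank ℝ E = 2 * 2 := by rw [finrank_real_of_complex, hE]
  have : Nontrivial E := Module.nontrivial_of_finrank_pos (R := ℂ) (by omega)
  have hms : MeasurableSet {u : E | t ≤ ‖u‖ ^ 2} := measurableSet_le (by fun_prop) (by fun_prop)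
  let f : ℝ → ℝ := fun y => if t ≤ y ^ 2 then Real.exp (-Real.pi * y ^ 2) else 0
  have h_intble : Integrable (fun z : E => Real.exp (-Real.pi * ‖z‖ ^ 2)) := by
    by_contra hc
    have h := GaussianFourier.integral_rexp_neg_mul_sq_norm (V := E) Real.pi_pos
    rw [div_self Real.pi_ne_zero, Real.one_rpow, integral_undef hc] at h
    exact zero_ne_one h
  rw [gauss, withDensity_apply _ hms, ← ofReal_integral_eq_lintegral_ofReal h_intble.integrableOn
    (Eventually.of_forall fun _ => (Real.exp_pos _).le), ← integral_indicator hms]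
  congr 1
  have h1 : (({u : E | t ≤ ‖u‖ ^ 2}).indicator fun z : E => Real.exp (-Real.pi * ‖z‖ ^ 2))
      = fun z => f ‖z‖ := by
    funext z
    simp [indicator, f]
  rw [h1, integral_fun_norm_addHaar]
  have hb : (volume : Measure E).real (Metric.ball 0 1) = Real.pi ^ 2 / 2 := by
    rw [measureReal_def, InnerProductSpace.volume_ball_of_dim_even hR]
    simp only [ENNReal.ofReal_one, one_pow, one_mul]
    rw [ENNReal.toReal_ofReal (by positivity)]
    norm_num [Nat.factorial]
  rw [hb, hR]
  have h2 : ∫ y in Ioi (0:ℝ), y ^ (2 * 2 - 1) • f y =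
      ∫ y in Ioi (√t), y ^ 3 * Real.exp (-Real.pi * y ^ 2) := by
    have : ∀ y ∈ Ioi (0:ℝ), y ^ (2*2-1) • f y =
        (Ici (√t)).indicator (fun y => y ^ 3 * Real.exp (-Real.pi * y ^ 2)) y := by
      intro y hy
      simp only [f, indicator, mem_Ici, Real.sqrt_le_left (le_of_lt hy), smul_eq_mul]
      split_ifs <;> simp
    rw [setIntegral_congr_fun measurableSet_Ioi this, setIntegral_indicator measurableSet_Ici,
      ← integral_Ici_eq_integral_Ioi' (by simp)]
    rcases eq_or_lt_of_le ht with h | h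
    · subst h
      simp only [Real.sqrt_zero]
      rw [inter_eq_left.mpr Ioi_subset_Ici_self, integral_Ici_eq_integral_Ioi]
    · rw [inter_eq_right.mpr]
      intro y hy
      exact lt_of_lt_of_le (Real.sqrt_pos.mpr h) hy
  rw [h2]
  have h3 : ∫ y in Ioi (√t), 2 * Real.pi ^ 2 * (y ^ 3 * Real.exp (-Real.pi * y ^ 2)) =
      0 - (-(1 + Real.pi * (√t) ^ 2) * Real.exp (-Real.pi * (√t) ^ 2)) := by
    refine integral_Ioi_of_hasDerivAt_of_nonneg
      (g := fun y => -(1 + Real.pi * y ^ 2) * Real.exp (-Real.pi * y ^ 2))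
      (by fun_prop) ?_ ?_ ?_
    · intro x _
      have a1 : HasDerivAt (fun y : ℝ => y ^ 2) (2 * x) x := by simpa using hasDerivAt_pow 2 x
      have a2 := (((a1.const_mul Real.pi).const_add 1).neg).mul ((a1.const_mul (-Real.pi)).exp)
      refine a2.congr_deriv ?_
      simp only [Pi.neg_apply]
      ring
    · intro x hx
      have : 0 < x := lt_of_le_of_lt (Real.sqrt_nonneg _) hx
      positivity
    · have a := (tendsto_pow_atTop (two_ne_zero)).const_mul_atTop Real.pi_pos (β := ℝ) (α := ℝ)
      have b1 := (Real.tendsto_pow_mul_exp_neg_atTop_nhds_zero 1).comp a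
      have b0 := (Real.tendsto_pow_mul_exp_neg_atTop_nhds_zero 0).comp a
      have := (b0.add b1).neg
      simp only [add_zero, neg_zero] at this
      refine this.congr fun y => ?_
      simp only [Function.comp, pow_one, pow_zero, neg_mul]
      ring
  rw [integral_const_mul, Real.sq_sqrt ht] at h3
  simp only [nsmul_eq_mul, smul_eq_mul]
  push_cast
  linarith


/-- CDF of the Beta(m,2) law. -/
def H (m : ℕ) (s : ℝ) : ℝ := s ^ m * (1 + m * (1 - s))

lemma radial_even (m : ℕ) (hm : 1 ≤ m) (hE : finrank ℂ E = m) (a : ℝ) (ha : 0 ≤ a) :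
    ∫⁻ w : E, ENNReal.ofReal ((1 + Real.pi * (a * ‖w‖ ^ 2)) * Real.exp (-Real.pi * (a * ‖w‖ ^ 2)))
      ∂(gauss E) = ENNReal.ofReal (((1 + a) ^ m)⁻¹ + a * m * ((1 + a) ^ (m + 1))⁻¹) := by
  have hR : finrank ℝ E = 2 * m := by rw [finrank_real_of_complex, hE]
  have : Nontrivial E := Module.nontrivial_of_finrank_pos (R := ℂ) (by omega)
  let f : ℝ → ℝ := fun y => (1 + Real.pi * (a * y ^ 2)) * Real.exp (-(Real.pi * (1 + a)) * y ^ 2)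
  have hb : (volume : Measure E).real (Metric.ball 0 1) = Real.pi ^ m / m.factorial := by
    rw [measureReal_def, InnerProductSpace.volume_ball_of_dim_even hR]
    simp only [ENNReal.ofReal_one, one_pow, one_mul]
    rw [ENNReal.toReal_ofReal (by positivity)]
  have hc : 0 < Real.pi * (1 + a) := by positivity
  have hcE : ∀ y : ℝ, y ^ (2 * m - 1) • f y =
      y ^ (2 * m - 1) * Real.exp (-(Real.pi * (1 + a)) * y ^ 2)
      + Real.pi * a * (y ^ (2 * m + 1) * Real.exp (-(Real.pi * (1 + a)) * y ^ 2)) := by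
    intro y
    have : y ^ (2 * m + 1) = y ^ (2 * m - 1) * y ^ 2 := by
      rw [← pow_add]; congr 1; omega
    rw [this]
    simp only [f, smul_eq_mul]
    ring
  have I1 := integral_rpow_mul_exp_neg_mul_rpow (p := 2) (q := ((2 * m - 1 : ℕ) : ℝ)) (by norm_num)
    (by have : (0:ℝ) ≤ ((2 * m - 1 : ℕ) : ℝ) := Nat.cast_nonneg _
        linarith) hc
  have I2 := integral_rpow_mul_exp_neg_mul_rpow (p := 2) (q := ((2 * m + 1 : ℕ) : ℝ)) (by norm_num)
    (by have : (0:ℝ) ≤ ((2 * m + 1 : ℕ) : ℝ) := Nat.cast_nonneg _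
        linarith) hc
  have J : ∀ n : ℕ, IntegrableOn
      (fun y : ℝ => y ^ n * Real.exp (-(Real.pi * (1 + a)) * y ^ 2)) (Ioi 0) := by
    intro n
    have := integrableOn_rpow_mul_exp_neg_mul_sq hc (s := (n:ℝ))
      (by have : (0:ℝ) ≤ (n : ℝ) := Nat.cast_nonneg _
          linarith)
    simpa only [Real.rpow_natCast] using this
  simp only [Real.rpow_natCast, Real.rpow_two] at I1 I2
  have e1 : (((2 * m - 1 : ℕ) : ℝ) + 1) = 2 * m := by
    have : ((2 * m - 1 : ℕ) : ℝ) + 1 = ((2 * m - 1 + 1 : ℕ) : ℝ) := by push_cast; ring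
    rw [this, Nat.sub_add_cancel (by omega)]; push_cast; ring
  have e2 : (((2 * m + 1 : ℕ) : ℝ) + 1) = 2 * (m + 1 : ℕ) := by push_cast; ring
  have e3 : ∀ k : ℕ, -(2 * (k:ℝ)) / 2 = -(k : ℝ) := by intro k; ring
  have e4 : ∀ k : ℕ, (2 * (k:ℝ)) / 2 = (k : ℝ) := by intro k; ring
  rw [e1, e3, e4, Real.rpow_neg hc.le, Real.rpow_natCast] at I1
  rw [e2, e3, e4, Real.rpow_neg hc.le, Real.rpow_natCast, Nat.cast_succ, Real.Gamma_nat_eq_factorial] at I2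
  obtain ⟨k, rfl⟩ : ∃ k, m = k + 1 := ⟨m - 1, by omega⟩
  rw [Nat.cast_succ, Real.Gamma_nat_eq_factorial] at I1
  have hfint : IntegrableOn (fun y : ℝ => y ^ (finrank ℝ E - 1) • f y) (Ioi 0) := by
    rw [hR]
    simp only [hcE]
    exact (J _).add ((J _).const_mul _)
  have hfI := (integrable_fun_norm_addHaar (E := E) volume (f := f)).mpr hfint
  rw [gauss, lintegral_withDensity_eq_lintegral_mul _ measurable_dens (by fun_prop)]
  have h1 : ∀ w : E, ((fun z : E => ENNReal.ofReal (Real.exp (-Real.pi * ‖z‖ ^ 2))) *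
      fun w : E => ENNReal.ofReal ((1 + Real.pi * (a * ‖w‖ ^ 2)) *
        Real.exp (-Real.pi * (a * ‖w‖ ^ 2)))) w = ENNReal.ofReal (f ‖w‖) := by
    intro w
    simp only [Pi.mul_apply]
    rw [← ENNReal.ofReal_mul (Real.exp_pos _).le]
    congr 1
    simp only [f]
    rw [mul_left_comm, ← Real.exp_add]
    congr 2
    ring
  rw [lintegral_congr h1, ← ofReal_integral_eq_lintegral_ofReal hfI
    (Eventually.of_forall fun w => by simp only [f, Pi.zero_apply]; positivity)]
  congr 1
  rw [integral_fun_norm_addHaar, hb, hR]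
  simp only [hcE]
  rw [integral_add (J _) ((J _).const_mul _), integral_const_mul, I1, I2]
  simp only [nsmul_eq_mul, smul_eq_mul, Nat.factorial_succ]
  push_cast
  have hk : (k.factorial : ℝ) ≠ 0 := by positivity
  have hk1 : (k + 1 : ℝ) ≠ 0 := by positivity
  have ha1 : (1 + a) ≠ 0 := by positivity
  have hpi := Real.pi_ne_zero
  rw [mul_pow, mul_pow]
  field_simp
  ring

lemma beta_law (K : Submodule ℂ E) (m : ℕ) (hm : 1 ≤ m) (hK : finrank ℂ K = m)
    (hE : finrank ℂ E = m + 2) (s : ℝ) (hs : 0 < s) (hs1 : s ≤ 1) :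
    gauss E {z : E | ‖K.orthogonalProjectionOnto z‖ ^ 2 ≤ s * ‖z‖ ^ 2} = ENNReal.ofReal (H m s) := by
  have hKo : finrank ℂ Kᗮ = 2 := by
    have := Submodule.finrank_add_finrank_orthogonal K
    omega
  set a : ℝ := (1 - s) / s with ha
  have ha0 : 0 ≤ a := div_nonneg (by linarith) hs.le
  have hA : MeasurableSet {p : K × Kᗮ | a * ‖p.1‖ ^ 2 ≤ ‖p.2‖ ^ 2} :=
    measurableSet_le (by fun_prop) (by fun_prop)
  have h1 : {z : E | ‖K.orthogonalProjectionOnto z‖ ^ 2 ≤ s * ‖z‖ ^ 2} =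
      split K ⁻¹' {p : K × Kᗮ | a * ‖p.1‖ ^ 2 ≤ ‖p.2‖ ^ 2} := by
    ext z
    simp only [mem_ofPred_eq, mem_preimage, split]
    rw [Submodule.norm_sq_eq_add_norm_sq_projection z K, ha, div_mul_eq_mul_div, div_le_iff₀ hs]
    constructor <;> intro h <;> linarith
  rw [h1, (split_map K).measure_preimage hA.nullMeasurableSet, Measure.prod_apply hA]
  have h2 : ∀ w : K, gauss Kᗮ (Prod.mk w ⁻¹' {p : K × Kᗮ | a * ‖p.1‖ ^ 2 ≤ ‖p.2‖ ^ 2}) =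
      ENNReal.ofReal ((1 + Real.pi * (a * ‖w‖ ^ 2)) * Real.exp (-Real.pi * (a * ‖w‖ ^ 2))) := by
    intro w
    exact tail4 hKo (a * ‖w‖ ^ 2) (by positivity)
  rw [lintegral_congr h2, radial_even m hm hK a ha0]
  congr 1
  have : 1 + a = s⁻¹ := by rw [ha]; field_simp; ring
  rw [this, ha, H, inv_pow, inv_pow, inv_inv, inv_inv]
  field_simp
  ring

/-- relative version inside a subspace `S`. -/
lemma beta_law_rel (K S : Submodule ℂ E) (hKS : K ≤ S) (m : ℕ) (hm : 1 ≤ m) (hK : finrank ℂ K = m)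
    (hS : finrank ℂ S = m + 2) (s : ℝ) (hs : 0 < s) (hs1 : s ≤ 1) :
    gauss E {z : E | ‖K.starProjection z‖ ^ 2 ≤ s * ‖S.starProjection z‖ ^ 2} =
      ENNReal.ofReal (H m s) := by
  let K' : Submodule ℂ S := K.comap S.subtype
  have hK' : finrank ℂ K' = m := by
    rw [← hK]
    exact (Submodule.comapSubtypeEquivOfLe hKS).finrank_eq
  have key : ∀ z : E, ((K'.orthogonalProjectionOnto (S.orthogonalProjectionOnto z) : S) : E)
      = K.starProjection z := by
    intro z
    symm
    refine Submodule.eq_starProjection_of_mem_of_inner_eq_zero ?_ ?_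
    · exact (K'.orthogonalProjectionOnto (S.orthogonalProjectionOnto z)).2
    · intro w hw
      have hwS : w ∈ S := hKS hw
      have a1 : inner ℂ (z - (S.orthogonalProjectionOnto z : E)) w = 0 :=
        Submodule.starProjection_inner_eq_zero (K := S) z w hwS
      have a2 : inner ℂ ((S.orthogonalProjectionOnto z) -
          ((K'.orthogonalProjectionOnto (S.orthogonalProjectionOnto z) : S))) (⟨w, hwS⟩ : S) = 0 :=
        Submodule.starProjection_inner_eq_zero (K := K') _ _ hw
      rw [Submodule.coe_inner] at a2
      simp only [AddSubgroupClass.coe_sub] at a2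
      rw [← sub_add_sub_cancel z (S.orthogonalProjectionOnto z : E), inner_add_left, a1, a2, add_zero]
  have hA : MeasurableSet {y : S | ‖K'.orthogonalProjectionOnto y‖ ^ 2 ≤ s * ‖y‖ ^ 2} :=
    measurableSet_le (by fun_prop) (by fun_prop)
  have h1 : {z : E | ‖K.starProjection z‖ ^ 2 ≤ s * ‖S.starProjection z‖ ^ 2} =
      split S ⁻¹' ({y : S | ‖K'.orthogonalProjectionOnto y‖ ^ 2 ≤ s * ‖y‖ ^ 2} ×ˢ univ) := by
    ext z
    simp only [mem_ofPred_eq, mem_preimage, split, mem_prod, mem_univ, and_true]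
    rw [← key z]
    rfl
  rw [h1, (split_map S).measure_preimage (hA.prod MeasurableSet.univ).nullMeasurableSet,
    Measure.prod_prod, measure_univ, mul_one]
  exact beta_law K' m hm hK' hS s hs hs1

/-- density of Beta(m+1,2) -/
def dens (m : ℕ) (b : ℝ) : ℝ := (m + 2) * (m + 1) * b ^ m * (1 - b)

lemma dens_nonneg (m : ℕ) {b : ℝ} (h0 : 0 ≤ b) (h1 : b ≤ 1) : 0 ≤ dens m b := by
  have : 0 ≤ 1 - b := by linarith
  unfold dens; positivity

lemma H_nonneg (m : ℕ) {b : ℝ} (h0 : 0 ≤ b) (h1 : b ≤ 1) : 0 ≤ H m b := by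
  have : 0 ≤ 1 - b := by linarith
  unfold H; positivity

lemma H_deriv (m : ℕ) (b : ℝ) : HasDerivAt (H (m + 1)) (dens m b) b := by
  have h1 := hasDerivAt_pow (m + 1) b
  have h2 := (((hasDerivAt_id b).const_sub 1).const_mul ((m : ℝ) + 1)).const_add 1
  have := h1.mul h2
  unfold H dens
  refine (this.congr_deriv ?_).congr_of_eventuallyEq (Eventually.of_forall fun x => ?_)
  · simp only [Nat.add_sub_cancel, id]
    push_cast
    ring
  · simp

lemma dens_integral (m : ℕ) {x y : ℝ} (h0 : 0 ≤ x) (hxy : x ≤ y) (h1 : y ≤ 1) :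
    ∫⁻ b in Ioc x y, ENNReal.ofReal (dens m b) = ENNReal.ofReal (H (m + 1) y - H (m + 1) x) := by
  have hc : Continuous (dens m) := by unfold dens; fun_prop
  rw [← ofReal_integral_eq_lintegral_ofReal, ← intervalIntegral.integral_of_le hxy,
    intervalIntegral.integral_eq_sub_of_hasDerivAt (fun b _ => H_deriv m b)
      (hc.intervalIntegrable _ _)]
  · exact (hc.integrableOn_Icc).mono_set Ioc_subset_Icc_self
  · filter_upwards [ae_restrict_mem measurableSet_Ioc] with b hb
    exact dens_nonneg m (h0.trans hb.1.le) (hb.2.trans h1)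

/-- the CDF of the chordal product determinant, with `m = T - 3` -/
def FF (m : ℕ) (δ : ℝ) : ℝ :=
  1 / 2 * δ ^ m * ((m + 2) * (m + 1) ^ 2 - 2 * δ * (m + 2) * m - (m + 1) ^ 2 * m * δ ^ 2
    + 2 * (m + 2) * (m + 1) * m * δ * Real.log δ)

def phi (m : ℕ) (δ b : ℝ) : ENNReal := if b ≤ δ then 1 else ENNReal.ofReal (H m (δ / b))

lemma measurable_phi (m : ℕ) (δ : ℝ) : Measurable (phi m δ) := by
  unfold phi H
  refine Measurable.ite measurableSet_Iic measurable_const ?_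
  fun_prop

lemma prod_integral (m : ℕ) {δ : ℝ} (h0 : 0 < δ) (h1 : δ < 1) :
    0 ≤ FF m δ - H (m + 1) δ ∧
    ∫⁻ b in Ioc δ 1, ENNReal.ofReal (dens m b) * ENNReal.ofReal (H m (δ / b)) =
      ENNReal.ofReal (FF m δ - H (m + 1) δ) := by
  have hpos : ∀ b ∈ uIcc δ 1, 0 < b := by
    intro b hb
    rw [uIcc_of_le h1.le] at hb
    exact h0.trans_le hb.1
  have e : ∫⁻ b in Ioc δ 1, ENNReal.ofReal (dens m b) * ENNReal.ofReal (H m (δ / b)) =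
      ∫⁻ b in Ioc δ 1, ENNReal.ofReal (dens m b * H m (δ / b)) := by
    refine setLIntegral_congr_fun measurableSet_Ioc fun b hb => ?_
    rw [ENNReal.ofReal_mul (dens_nonneg m (h0.trans hb.1).le hb.2)]
  have hc : ContinuousOn (fun b => dens m b * H m (δ / b)) (uIcc δ 1) := by
    have : ContinuousOn (fun b => δ / b) (uIcc δ 1) :=
      continuousOn_const.div continuousOn_id fun b hb => (hpos b hb).ne'
    unfold dens H
    fun_prop
  have hd : ∀ b ∈ uIcc δ 1, HasDerivAt (fun b => (m + 2) * (m + 1) * δ ^ m *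
      ((1 + m + m * δ) * b - (1 + m) * (b ^ 2 / 2) - m * δ * Real.log b))
      (dens m b * H m (δ / b)) b := by
    intro b hb
    have hb0 := (hpos b hb).ne'
    have d1 := (hasDerivAt_id b).const_mul (1 + (m:ℝ) + m * δ)
    have d2 := ((hasDerivAt_pow 2 b).div_const 2).const_mul (1 + (m:ℝ))
    have d3 := (Real.hasDerivAt_log hb0).const_mul ((m:ℝ) * δ)
    have := ((d1.sub d2).sub d3).const_mul (((m:ℝ) + 2) * (m + 1) * δ ^ m)
    refine this.congr_deriv ?_
    unfold dens H
    rw [div_pow]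
    field_simp
    simp only [Nat.cast_ofNat]
    ring
  have hnn : ∀ b ∈ Ioc δ 1, 0 ≤ dens m b * H m (δ / b) := by
    intro b hb
    have hb0 := h0.trans hb.1
    exact mul_nonneg (dens_nonneg m hb0.le hb.2)
      (H_nonneg m (by positivity) (div_le_one_of_le₀ hb.1.le hb0.le))
  have hI : ∫ b in Ioc δ 1, dens m b * H m (δ / b) = FF m δ - H (m + 1) δ := by
    rw [← intervalIntegral.integral_of_le h1.le,
      intervalIntegral.integral_eq_sub_of_hasDerivAt hd hc.intervalIntegrable]
    simp only [Real.log_one]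
    unfold FF H
    push_cast
    ring
  refine ⟨?_, ?_⟩
  · rw [← hI]
    exact setIntegral_nonneg measurableSet_Ioc hnn
  rw [e, ← ofReal_integral_eq_lintegral_ofReal, hI]
  · rw [uIcc_of_le h1.le] at hc
    exact (hc.integrableOn_Icc).mono_set Ioc_subset_Icc_self
  · filter_upwards [ae_restrict_mem measurableSet_Ioc] with b hb
    exact hnn b hb

lemma product_law (m : ℕ) (ν : Measure ℝ) [IsProbabilityMeasure ν]
    (hν : ∀ s, 0 < s → s ≤ 1 → ν (Iic s) = ENNReal.ofReal (H (m + 1) s))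
    {δ : ℝ} (h0 : 0 < δ) (h1 : δ < 1) :
    ∫⁻ b, phi m δ b ∂ν ≤ ENNReal.ofReal (FF m δ) := by
  have hν1 : ν (Ioi 1) = 0 := by
    have : ν (Iic 1) = 1 := by rw [hν 1 one_pos le_rfl]; simp [H]
    rw [← compl_Iic, prob_compl_eq_zero_iff measurableSet_Iic]
    exact this
  have hmono : ∀ x y, 0 ≤ x → x ≤ y → y ≤ 1 → H (m + 1) x ≤ H (m + 1) y := by
    intro x y hx hxy hy
    refine monotoneOn_of_deriv_nonneg (convex_Icc (0:ℝ) 1)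
      (fun b _ => (H_deriv m b).continuousAt.continuousWithinAt)
      (fun b _ => (H_deriv m b).differentiableAt.differentiableWithinAt) ?_
      ⟨hx, hxy.trans hy⟩ ⟨hx.trans hxy, hy⟩ hxy
    intro b hb
    rw [interior_Icc] at hb
    rw [(H_deriv m b).deriv]
    exact dens_nonneg m hb.1.le hb.2.le
  have hIoc : ∀ c, δ ≤ c → c ≤ 1 → ν (Ioc δ c) = ENNReal.ofReal (H (m + 1) c - H (m + 1) δ) := by
    intro c hc hc1
    rw [← Iic_sdiff_Iic, measure_sdiff (Iic_subset_Iic.mpr hc) measurableSet_Iic.nullMeasurableSet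
      (measure_ne_top _ _), hν c (h0.trans_le hc) hc1, hν δ h0 h1.le,
      ENNReal.ofReal_sub _ (H_nonneg _ h0.le h1.le)]
  have hres : ν.restrict (Ioc δ 1) =
      ((volume : Measure ℝ).restrict (Ioc δ 1)).withDensity (fun b => ENNReal.ofReal (dens m b)) := by
    refine Measure.ext_of_Iic _ _ fun a => ?_
    rw [Measure.restrict_apply measurableSet_Iic, withDensity_apply _ measurableSet_Iic,
      Measure.restrict_restrict measurableSet_Iic]
    have : Iic a ∩ Ioc δ 1 = Ioc δ (min a 1) := by
      ext x; simp only [mem_inter_iff, mem_Iic, mem_Ioc, le_min_iff]; tauto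
    rw [this]
    rcases le_total δ (min a 1) with h | h
    · rw [hIoc _ h (min_le_right _ _), dens_integral m h0.le h (min_le_right _ _)]
    · rw [Ioc_eq_empty (not_lt.mpr h)]; simp
  have hI : ν.restrict (Ioi δ) = ν.restrict (Ioc δ 1) := by
    refine Measure.restrict_congr_set ?_
    rw [← Ioc_union_Ioi_eq_Ioi h1.le]
    refine union_ae_eq_left_of_ae_eq_empty ?_
    exact ae_eq_empty.mpr hν1
  rw [← lintegral_add_compl _ (measurableSet_Iic (a := δ)), compl_Iic, hI]
  have p1 : ∫⁻ b in Iic δ, phi m δ b ∂ν = ENNReal.ofReal (H (m + 1) δ) := by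
    rw [setLIntegral_congr_fun (g := fun _ => 1) measurableSet_Iic]
    · simp [hν δ h0 h1.le]
    · intro b hb
      simp only [phi, if_pos (mem_Iic.mp hb)]
  have p2 : ∫⁻ b in Ioc δ 1, phi m δ b ∂ν = ENNReal.ofReal (FF m δ - H (m + 1) δ) := by
    rw [hres, lintegral_withDensity_eq_lintegral_mul _ (by unfold dens; fun_prop) (measurable_phi m δ),
      ← (prod_integral m h0 h1).2]
    refine setLIntegral_congr_fun measurableSet_Ioc fun b hb => ?_
    simp only [phi, Pi.mul_apply, if_neg (not_le.mpr hb.1)]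
  rw [p1, p2, ← ENNReal.ofReal_add (H_nonneg _ h0.le h1.le)
    (prod_integral m h0 h1).1, add_sub_cancel]

/-- Gram determinant of the projections of `z₁, z₂` to `N`. -/
def G (N : Submodule ℂ E) (z₁ z₂ : E) : ℝ :=
  ‖N.starProjection z₁‖ ^ 2 * ‖N.starProjection z₂‖ ^ 2
    - ‖inner ℂ (N.starProjection z₁) (N.starProjection z₂)‖ ^ 2

lemma G_eq (N : Submodule ℂ E) (z₁ z₂ : E) (h : N.starProjection z₁ ≠ 0) :
    G N z₁ z₂ = ‖N.starProjection z₁‖ ^ 2 *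
      ‖(N ⊓ (ℂ ∙ z₁)ᗮ).starProjection z₂‖ ^ 2 := by
  set p := N.starProjection z₁ with hp
  set q := N.starProjection z₂ with hq
  have hpN : p ∈ N := Submodule.starProjection_apply_mem N z₁
  have hqN : q ∈ N := Submodule.starProjection_apply_mem N z₂
  have hz1 : ∀ v ∈ N, inner ℂ z₁ v = inner ℂ p v := by
    intro v hv
    have := Submodule.starProjection_inner_eq_zero (K := N) z₁ v hv
    rw [inner_sub_left, sub_eq_zero] at this
    exact this
  have hz2 : ∀ v ∈ N, inner ℂ z₂ v = inner ℂ q v := by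
    intro v hv
    have := Submodule.starProjection_inner_eq_zero (K := N) z₂ v hv
    rw [inner_sub_left, sub_eq_zero] at this
    exact this
  have hpp : inner ℂ p p ≠ 0 := inner_self_ne_zero.mpr h
  set c : ℂ := inner ℂ p q / inner ℂ p p with hc
  have hproj : (N ⊓ (ℂ ∙ z₁)ᗮ).starProjection z₂ = q - c • p := by
    refine Submodule.eq_starProjection_of_mem_of_inner_eq_zero ?_ ?_
    · have hm : q - c • p ∈ N := N.sub_mem hqN (N.smul_mem _ hpN)
      refine ⟨hm, ?_⟩
      rw [SetLike.mem_coe, Submodule.mem_orthogonal_singleton_iff_inner_right, hz1 _ hm,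
        inner_sub_right, inner_smul_right, hc, div_mul_cancel₀ _ hpp, sub_self]
    · rintro w ⟨hwN, hw⟩
      rw [SetLike.mem_coe, Submodule.mem_orthogonal_singleton_iff_inner_right, hz1 _ hwN] at hw
      rw [inner_sub_left, inner_sub_left, inner_smul_left, hz2 w hwN, hw]
      simp
  have hort : inner ℂ (q - c • p) (c • p) = 0 := by
    rw [inner_smul_right, inner_sub_left, inner_smul_left, hc, map_div₀, inner_conj_symm,
      inner_conj_symm, div_mul_cancel₀ _ hpp, sub_self, mul_zero]
  have hpyth : ‖q‖ ^ 2 = ‖q - c • p‖ ^ 2 + ‖c • p‖ ^ 2 := by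
    have := norm_add_sq_eq_norm_sq_add_norm_sq_of_inner_eq_zero (q - c • p) (c • p) hort
    rw [sub_add_cancel] at this
    nlinarith [this]
  have hnp : ‖p‖ ≠ 0 := norm_ne_zero_iff.mpr h
  have hcn : ‖c • p‖ ^ 2 * ‖p‖ ^ 2 = ‖inner ℂ p q‖ ^ 2 := by
    rw [norm_smul, hc, norm_div, inner_self_eq_norm_sq_to_K]
    simp only [norm_pow, Complex.norm_real, norm_norm, Complex.coe_algebraMap]
    field_simp
  rw [hproj, G, ← hp, ← hq, ← hcn, hpyth]
  ring

lemma G_top (z₁ z₂ : E) (h : z₁ ≠ 0) :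
    G ⊤ z₁ z₂ = ‖z₁‖ ^ 2 * ‖((ℂ ∙ z₁)ᗮ).starProjection z₂‖ ^ 2 := by
  have ht : (⊤ : Submodule ℂ E).starProjection z₁ = z₁ :=
    Submodule.starProjection_eq_self_iff.mpr Submodule.mem_top
  have := G_eq ⊤ z₁ z₂ (by rw [ht]; exact h)
  rw [this, ht]
  simp only [top_inf_eq]

lemma finrank_inf (N : Submodule ℂ E) (z : E) (h : N.starProjection z ≠ 0) (n : ℕ)
    (hN : finrank ℂ N = n + 1) : finrank ℂ (N ⊓ (ℂ ∙ z)ᗮ : Submodule ℂ E) = n := by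
  have hz : z ≠ 0 := by rintro rfl; simp at h
  have e : (N ⊓ (ℂ ∙ z)ᗮ : Submodule ℂ E) = (Nᗮ ⊔ (ℂ ∙ z))ᗮ := by
    rw [← Submodule.inf_orthogonal, Submodule.orthogonal_orthogonal]
  have hd : Nᗮ ⊓ (ℂ ∙ z) = ⊥ := by
    rw [← disjoint_iff, Submodule.disjoint_span_singleton' hz]
    intro hzN
    exact h ((Submodule.starProjection_apply_eq_zero_iff N).mpr hzN)
  have h1 := Submodule.finrank_sup_add_finrank_inf_eq Nᗮ (ℂ ∙ z)
  rw [hd, finrank_bot, finrank_span_singleton hz] at h1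
  have h2 := Submodule.finrank_add_finrank_orthogonal N
  have h3 := Submodule.finrank_add_finrank_orthogonal (Nᗮ ⊔ (ℂ ∙ z))
  rw [e]
  omega

lemma finrank_perp (z : E) (h : z ≠ 0) (n : ℕ) (hE : finrank ℂ E = n + 1) :
    finrank ℂ ((ℂ ∙ z)ᗮ : Submodule ℂ E) = n := by
  have h2 := Submodule.finrank_add_finrank_orthogonal (ℂ ∙ z)
  rw [finrank_span_singleton h] at h2
  omega

def bad (N : Submodule ℂ E) (δ : ℝ) : Set (E × E) := {p | G N p.1 p.2 ≤ δ * G ⊤ p.1 p.2}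

lemma measurableSet_bad (N : Submodule ℂ E) (δ : ℝ) : MeasurableSet (bad N δ) := by
  have : ProperSpace E := FiniteDimensional.proper ℂ E
  have hc : ∀ M : Submodule ℂ E, Continuous (fun p : E × E => G M p.1 p.2) := by
    intro M
    unfold G
    fun_prop
  exact (isClosed_le (hc N) ((hc ⊤).const_mul δ)).measurableSet

lemma bad_le (N : Submodule ℂ E) (m : ℕ) (hm : 1 ≤ m) (hN : finrank ℂ N = m + 1)
    (hE : finrank ℂ E = m + 3) {δ : ℝ} (h0 : 0 < δ) (h1 : δ < 1) :
    (gauss E).prod (gauss E) (bad N δ) ≤ ENNReal.ofReal (FF m δ) := by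
  let b : E → ℝ := fun z => ‖N.starProjection z‖ ^ 2 / ‖z‖ ^ 2
  have hb : Measurable b := by fun_prop
  rw [Measure.prod_apply (measurableSet_bad N δ)]
  have hslice : ∀ z, gauss E (Prod.mk z ⁻¹' bad N δ) ≤ phi m δ (b z) := by
    intro z
    unfold phi
    split_ifs with hbz
    · exact prob_le_one
    · have hbz := not_le.mp hbz
      have hz : z ≠ 0 := by
        rintro rfl
        simp only [b] at hbz
        simp at hbz
        linarith
      have hP : N.starProjection z ≠ 0 := by
        intro hP
        simp only [b, hP] at hbz
        simp at hbz
        linarith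
      have hb0 : 0 < b z := h0.trans hbz
      rw [← beta_law_rel (N ⊓ (ℂ ∙ z)ᗮ) (ℂ ∙ z)ᗮ inf_le_right m hm (finrank_inf N z hP m hN)
        (finrank_perp z hz (m + 2) hE) (δ / b z) (by positivity) ((div_le_one hb0).mpr hbz.le)]
      refine measure_mono fun z₂ hz₂ => ?_
      simp only [bad, mem_preimage, mem_ofPred_eq] at hz₂ ⊢
      rw [G_eq N z z₂ hP, G_top z z₂ hz] at hz₂
      have hnP : 0 < ‖N.starProjection z‖ ^ 2 := by positivity
      have : δ / b z = δ * ‖z‖ ^ 2 / ‖N.starProjection z‖ ^ 2 := by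
        simp only [b]; field_simp
      rw [this, div_mul_eq_mul_div, le_div_iff₀ hnP]
      linarith
  refine (lintegral_mono hslice).trans ?_
  rw [← lintegral_map (measurable_phi m δ) hb]
  have : IsProbabilityMeasure (Measure.map b (gauss E)) :=
    Measure.isProbabilityMeasure_map hb.aemeasurable
  refine product_law m _ ?_ h0 h1
  intro s hs hs1
  rw [Measure.map_apply hb measurableSet_Iic, ← beta_law N (m + 1) (by omega) hN hE s hs hs1]
  congr 1
  ext z
  simp only [mem_preimage, mem_Iic, mem_ofPred_eq, b]
  by_cases hz : z = 0
  · subst hz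
    simp [hs.le]
  · have : 0 < ‖z‖ ^ 2 := by positivity
    rw [div_le_iff₀ this]
    rfl

/-- random choice avoiding the bad sets of finitely many subspaces -/
lemma exists_good {k : ℕ} (hk : k ≠ 0) (N : Fin k → Submodule ℂ E) (m : ℕ) (hm : 1 ≤ m)
    (hN : ∀ i, finrank ℂ (N i) = m + 1)
    (hE : finrank ℂ E = m + 3) {δ : ℝ} (h0 : 0 < δ) (h1 : δ < 1) (hF : k * FF m δ < 1) :
    ∃ y₁ y₂ : E, ‖y₁‖ = 1 ∧ ‖y₂‖ = 1 ∧ inner ℂ y₁ y₂ = 0 ∧ ∀ i, δ ≤ G (N i) y₁ y₂ := by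
  have hU : (gauss E).prod (gauss E) (⋃ i, bad (N i) δ) < 1 := by
    calc _ ≤ ∑ i, (gauss E).prod (gauss E) (bad (N i) δ) := measure_iUnion_fintype_le _ _
      _ ≤ ∑ i : Fin k, ENNReal.ofReal (FF m δ) :=
        Finset.sum_le_sum fun i _ => bad_le (N i) m hm (hN i) hE h0 h1
      _ = ENNReal.ofReal (k * FF m δ) := by
        rw [ENNReal.ofReal_mul (by positivity)]; simp
      _ < 1 := by rw [← ENNReal.ofReal_one]; exact (ENNReal.ofReal_lt_ofReal_iff one_pos).mpr hF
  have hne : (⋃ i, bad (N i) δ) ≠ univ := by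
    intro h
    rw [h, measure_univ] at hU
    exact lt_irrefl _ hU
  obtain ⟨⟨z₁, z₂⟩, hz⟩ := (ne_univ_iff_exists_notMem _).mp hne
  simp only [mem_iUnion, not_exists, bad, mem_ofPred_eq, not_le] at hz
  set S : Submodule ℂ E := (ℂ ∙ z₁)ᗮ with hS
  have hP : ∀ i, (N i).starProjection z₁ ≠ 0 := by
    intro i hi
    have h := hz i
    by_cases hz0 : z₁ = 0
    · subst hz0
      simp [G] at h
    · rw [G_top _ _ hz0] at h
      have : G (N i) z₁ z₂ = 0 := by simp [G, hi]
      rw [this] at h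
      have : 0 ≤ δ * (‖z₁‖ ^ 2 * ‖((ℂ ∙ z₁)ᗮ).starProjection z₂‖ ^ 2) := by positivity
      linarith
  have i0 : Fin k := ⟨0, Nat.pos_of_ne_zero hk⟩
  have hz1 : z₁ ≠ 0 := by
    rintro rfl
    exact hP i0 (by simp)
  have h2 : ∀ i, δ * (‖z₁‖ ^ 2 * ‖S.starProjection z₂‖ ^ 2) <
      ‖(N i).starProjection z₁‖ ^ 2 * ‖(N i ⊓ S).starProjection z₂‖ ^ 2 := by
    intro i
    have h := hz i
    rw [G_eq _ _ _ (hP i), G_top _ _ hz1] at h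
    exact h
  have hKS : ∀ i, ∀ z, (N i ⊓ S).starProjection (S.starProjection z) = (N i ⊓ S).starProjection z := by
    intro i z
    symm
    refine Submodule.eq_starProjection_of_mem_of_inner_eq_zero
      (Submodule.starProjection_apply_mem _ _) fun w hw => ?_
    have a1 := Submodule.starProjection_inner_eq_zero (K := S) z w hw.2
    have a2 := Submodule.starProjection_inner_eq_zero (K := N i ⊓ S) (S.starProjection z) w hw
    rw [← sub_add_sub_cancel z (S.starProjection z), inner_add_left, a1, a2, add_zero]
  have hz2 : S.starProjection z₂ ≠ 0 := by
    intro h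
    have := h2 i0
    rw [← hKS, h] at this
    simp at this
  have hn1 : ‖z₁‖ ≠ 0 := norm_ne_zero_iff.mpr hz1
  have hn2 : ‖S.starProjection z₂‖ ≠ 0 := norm_ne_zero_iff.mpr hz2
  have hc1 : ((‖z₁‖ : ℂ)⁻¹) ≠ 0 := by simpa using hz1
  refine ⟨(‖z₁‖ : ℂ)⁻¹ • z₁, (‖S.starProjection z₂‖ : ℂ)⁻¹ • S.starProjection z₂, ?_, ?_, ?_, ?_⟩
  · rw [norm_smul]; simp [hn1]
  · rw [norm_smul]; simp [hn2]
  · rw [inner_smul_left, inner_smul_right]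
    have : S.starProjection z₂ ∈ (ℂ ∙ z₁)ᗮ := Submodule.starProjection_apply_mem _ _
    rw [Submodule.mem_orthogonal_singleton_iff_inner_right] at this
    rw [this]; simp
  · intro i
    have hspan : (ℂ ∙ ((‖z₁‖ : ℂ)⁻¹ • z₁)) = ℂ ∙ z₁ :=
      Submodule.span_singleton_smul_eq (IsUnit.mk0 _ hc1) _
    rw [G_eq _ _ _ (by rw [map_smul]; exact smul_ne_zero hc1 (hP i)), hspan, ← hS,
      map_smul, map_smul, hKS, norm_smul, norm_smul]
    have h := h2 i
    simp only [norm_inv, Complex.norm_real, norm_norm]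
    rw [mul_pow, mul_pow, inv_pow, inv_pow]
    have : ∀ a b c d : ℝ, 0 < a → 0 < c → δ * (a * c) < b * d → δ ≤ a⁻¹ * b * (c⁻¹ * d) := by
      intro a b c d ha hc h
      have : a⁻¹ * b * (c⁻¹ * d) = b * d / (a * c) := by field_simp
      rw [this, le_div_iff₀ (by positivity)]
      exact h.le
    exact this _ _ _ _ (by positivity) (by positivity) h

lemma G_inner (x : Fin 2 → E) (hx : Orthonormal ℂ x) (u v : E) :
    inner ℂ ((Submodule.span ℂ (range x))ᗮ.starProjection u)
      ((Submodule.span ℂ (range x))ᗮ.starProjection v) =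
    inner ℂ u v - ∑ k, inner ℂ u (x k) * inner ℂ (x k) v := by
  set N := (Submodule.span ℂ (range x))ᗮ with hN
  have hv : N.starProjection v = v - ∑ k, (inner ℂ (x k) v : ℂ) • x k := by
    refine Submodule.eq_starProjection_of_mem_of_inner_eq_zero ?_ ?_
    · rw [hN, Submodule.mem_orthogonal]
      intro w hw
      refine Submodule.span_induction (p := fun w _ => inner ℂ w
        (v - ∑ k, (inner ℂ (x k) v : ℂ) • x k) = 0) ?_ ?_ ?_ ?_ hw
      · rintro _ ⟨j, rfl⟩
        rw [inner_sub_right, hx.inner_right_fintype, sub_self]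
      · simp
      · intro a b _ _ ha hb
        rw [inner_add_left, ha, hb, add_zero]
      · intro c a _ ha
        rw [inner_smul_left, ha, mul_zero]
    · intro w hw
      rw [sub_sub_cancel, sum_inner]
      refine Finset.sum_eq_zero fun k _ => ?_
      rw [inner_smul_left, (Submodule.mem_orthogonal _ _).mp hw _
        (Submodule.subset_span ⟨k, rfl⟩), mul_zero]
  rw [Submodule.inner_starProjection_left_eq_right,
    Submodule.starProjection_eq_self_iff.mpr (Submodule.starProjection_apply_mem _ _), hv,
    inner_sub_right, inner_sum]
  congr 1
  refine Finset.sum_congr rfl fun k _ => ?_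
  rw [inner_smul_right, mul_comm]

end

section mat

/-- columns as Euclidean vectors -/
noncomputable def col {T : ℕ} (A : Matrix (Fin T) (Fin 2) ℂ) (j : Fin 2) : EuclideanSpace ℂ (Fin T) :=
  WithLp.toLp 2 (fun i => A i j)

lemma inner_col {T : ℕ} (A B : Matrix (Fin T) (Fin 2) ℂ) (i j : Fin 2) :
    inner ℂ (col A i) (col B j) = (Aᴴ * B) i j := by
  simp only [col, PiLp.inner_apply, Matrix.mul_apply, Matrix.conjTranspose_apply]
  refine Finset.sum_congr rfl fun k _ => ?_
  simp [mul_comm]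

lemma orthonormal_col {T : ℕ} (A : Matrix (Fin T) (Fin 2) ℂ) (hA : Aᴴ * A = 1) :
    Orthonormal ℂ (col A) := by
  rw [orthonormal_iff_ite]
  intro i j
  rw [inner_col, hA, Matrix.one_apply]

lemma det_eq {T : ℕ} (X Y : Matrix (Fin T) (Fin 2) ℂ) (hX : Xᴴ * X = 1) (hY : Yᴴ * Y = 1) :
    ((1 - Yᴴ * X * Xᴴ * Y).det).re =
      G (Submodule.span ℂ (range (col X)))ᗮ (col Y 0) (col Y 1) := by
  set N := (Submodule.span ℂ (range (col X)))ᗮ with hN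
  have hent : ∀ i j, (1 - Yᴴ * X * Xᴴ * Y : Matrix (Fin 2) (Fin 2) ℂ) i j =
      inner ℂ (N.starProjection (col Y i)) (N.starProjection (col Y j)) := by
    intro i j
    rw [G_inner (col X) (orthonormal_col X hX), Matrix.mul_assoc (Yᴴ * X), ← hY, Matrix.sub_apply,
      Matrix.mul_apply (M := Yᴴ * X)]
    simp only [inner_col]
  rw [Matrix.det_fin_two, hent, hent, hent, hent, inner_self_eq_norm_sq_to_K,
    inner_self_eq_norm_sq_to_K, ← inner_conj_symm (N.starProjection (col Y 1)),
    Complex.mul_conj, Complex.normSq_eq_norm_sq, G]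
  norm_cast

lemma det_symm {T : ℕ} (X Y : Matrix (Fin T) (Fin 2) ℂ) :
    (1 - Yᴴ * X * Xᴴ * Y).det = (1 - Xᴴ * Y * Yᴴ * X).det := by
  rw [Matrix.mul_assoc (Yᴴ * X), Matrix.det_one_sub_mul_comm, Matrix.mul_assoc (Xᴴ * Y)]

lemma finrank_N {T : ℕ} (X : Matrix (Fin T) (Fin 2) ℂ) (hX : Xᴴ * X = 1) (n : ℕ) (hT : T = n + 2) :
    finrank ℂ ((Submodule.span ℂ (range (col X)))ᗮ : Submodule ℂ (EuclideanSpace ℂ (Fin T))) = n := by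
  have h := Submodule.finrank_add_finrank_orthogonal (Submodule.span ℂ (range (col X)))
  rw [finrank_span_eq_card (orthonormal_col X hX).linearIndependent, finrank_euclideanSpace_fin,
    Fintype.card_fin] at h
  omega

lemma step {m k : ℕ} (hm : 1 ≤ m) {δ : ℝ} (h0 : 0 < δ) (h1 : δ < 1)
    (hF : k * FF m δ < 1) (X : Fin k → Matrix (Fin (m + 3)) (Fin 2) ℂ)
    (hX : ∀ i, (X i)ᴴ * X i = 1) :
    ∃ Y : Matrix (Fin (m + 3)) (Fin 2) ℂ, Yᴴ * Y = 1 ∧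
      ∀ i, δ ≤ ((1 - Yᴴ * X i * (X i)ᴴ * Y).det).re := by
  by_cases hk : k = 0
  · subst hk
    refine ⟨(1 : Matrix (Fin (m + 3)) (Fin (m + 3)) ℂ).submatrix id (Fin.castLE (by omega)),
      ?_, fun i => i.elim0⟩
    ext i j
    simp [Matrix.mul_apply, Matrix.one_apply]
  · obtain ⟨y₁, y₂, hy1, hy2, hy, hG⟩ := exists_good hk
      (fun i => (Submodule.span ℂ (range (col (X i))))ᗮ) m hm
      (fun i => finrank_N (X i) (hX i) (m + 1) rfl) (by simp) h0 h1 hF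
    let Y : Matrix (Fin (m + 3)) (Fin 2) ℂ := fun i j => if j = 0 then y₁ i else y₂ i
    have c0 : col Y 0 = y₁ := by ext i; simp [col, Y]
    have c1 : col Y 1 = y₂ := by ext i; simp [col, Y]
    have hYY : Yᴴ * Y = 1 := by
      ext i j
      rw [← inner_col]
      have hy' : inner ℂ y₂ y₁ = 0 := by rw [← inner_conj_symm, hy, map_zero]
      fin_cases i <;> fin_cases j <;>
        simp [c0, c1, hy, hy', inner_self_eq_norm_sq_to_K, hy1, hy2]
    refine ⟨Y, hYY, fun i => ?_⟩
    rw [det_eq (X i) Y (hX i) hYY, c0, c1]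
    exact hG i

lemma code {m : ℕ} (hm : 1 ≤ m) {δ : ℝ} (h0 : 0 < δ) (h1 : δ < 1) (k : ℕ)
    (hF : ∀ j < k, (j : ℝ) * FF m δ < 1) :
    ∃ X : Fin k → Matrix (Fin (m + 3)) (Fin 2) ℂ, (∀ i, (X i)ᴴ * X i = 1) ∧
        ∀ i j, i ≠ j → δ ≤ ((1 - (X i)ᴴ * X j * (X j)ᴴ * X i).det).re := by
  induction k with
  | zero => exact ⟨fun i => i.elim0, fun i => i.elim0, fun i => i.elim0⟩
  | succ k ih =>
    obtain ⟨X, hX, hd⟩ := ih fun j hj => hF j (by omega)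
    obtain ⟨Y, hY, hYd⟩ := step hm h0 h1 (hF k (by omega)) X hX
    refine ⟨Fin.cons Y X, ?_, ?_⟩
    · intro i
      refine Fin.cases ?_ (fun i => ?_) i
      · simpa using hY
      · simpa using hX i
    · intro i j
      refine Fin.cases ?_ (fun i => ?_) i <;> refine Fin.cases ?_ (fun j => ?_) j
      · intro h; exact absurd rfl h
      · intro _; simpa using hYd j
      · intro _
        simp only [Fin.cons_zero, Fin.cons_succ]
        rw [det_symm]
        exact hYd i
      · intro h
        simp only [Fin.cons_succ]
        exact hd i j fun e => h (by rw [e])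

end mat
end GV

theorem gilbert_varshamov_M2
    (T : ℕ) (hT : 4 ≤ T) (δ : ℝ) (hδ0 : 0 < δ) (hδ1 : δ < 1) :
    ∃ K : ℕ,
      1 / ((1 / 2) * ((T : ℝ) - 1) * ((T : ℝ) - 2) ^ 2 * ((T : ℝ) - 3) * δ ^ (T - 3) *
            (1 / ((T : ℝ) - 3) - 2 * δ / ((T : ℝ) - 2) ^ 2 - δ ^ 2 / ((T : ℝ) - 1) +
              2 * δ * Real.log δ / ((T : ℝ) - 2)))
        ≤ (K : ℝ) ∧
      ∃ X : Fin K → Matrix (Fin T) (Fin 2) ℂ,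
        (∀ i, (X i)ᴴ * X i = 1) ∧
        ∀ i j, i ≠ j → δ ≤ ((1 - (X i)ᴴ * X j * (X j)ᴴ * X i).det).re := by
  obtain ⟨m, rfl⟩ : ∃ m, T = m + 3 := ⟨T - 3, by omega⟩
  have hm : 1 ≤ m := by omega
  have hm0 : (0:ℝ) < m := by exact_mod_cast hm
  have hF : (1 / 2) * (((m + 3 : ℕ) : ℝ) - 1) * (((m + 3 : ℕ) : ℝ) - 2) ^ 2 *
      (((m + 3 : ℕ) : ℝ) - 3) * δ ^ (m + 3 - 3) *
            (1 / (((m + 3 : ℕ) : ℝ) - 3) - 2 * δ / (((m + 3 : ℕ) : ℝ) - 2) ^ 2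
              - δ ^ 2 / (((m + 3 : ℕ) : ℝ) - 1) +
              2 * δ * Real.log δ / (((m + 3 : ℕ) : ℝ) - 2)) = GV.FF m δ := by
    have e1 : ((m + 3 : ℕ) : ℝ) - 1 = m + 2 := by push_cast; ring
    have e2 : ((m + 3 : ℕ) : ℝ) - 2 = m + 1 := by push_cast; ring
    have e3 : ((m + 3 : ℕ) : ℝ) - 3 = m := by push_cast; ring
    rw [e1, e2, e3, GV.FF, Nat.add_sub_cancel]
    have a1 : (m:ℝ) + 2 ≠ 0 := by positivity
    have a2 : (m:ℝ) + 1 ≠ 0 := by positivity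
    field_simp
  rw [hF]
  refine ⟨⌈1 / GV.FF m δ⌉₊, Nat.le_ceil _, GV.code hm hδ0 hδ1 _ fun j hj => ?_⟩
  rw [Nat.lt_ceil] at hj
  have hpos : 0 < GV.FF m δ := by
    have : 0 < 1 / GV.FF m δ := lt_of_le_of_lt (Nat.cast_nonneg j) hj
    exact one_div_pos.mp this
  exact (lt_div_iff₀ hpos).mp hj
end

section
/- Let T and M be positive integers with T ≥ 2M, let μ be the Haar probability measure on U(T), and let f : ℂ^{T×M} → [0,∞] be a measurable function satisfying f(XG) = f(X) for every X ∈ ℂ^{T×M} and every invertible G ∈ GL(M,ℂ). Then ∫_{U(T)} f(UE) dμ(U) = (1/V_{T,M}) ∫_{ℂ^{(T−M)×M}} f( stack(I_M, Ã) ) · det(I_M + Ã^H Ã)^{−T} dÃ, where the right-hand integral is with respect to Lebesgue measure on ℂ^{(T−M)×M}, stack(I_M, Ã) denotes the T×M matrix obtained by placing I_M on top of Ã, and V_{T,M} = π^{M(T−M)} ∏_{m=1}^{M} (m−1)! / (T−m)!. In particular, the affine-chart coordinate Ã of a uniformly random point of the Grassmannian has density V_{T,M}^{−1} det(I_M + Ã^H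 Ã)^{−T}, a matrix-variate t distribution with 1 degree of freedom. -/
open Matrix MeasureTheory
open scoped ENNReal

/-- The `T × M` matrix obtained by placing the `M × M` block `P` on top of the
`(T - M) × M` block `Q` (junk values if `M > T`). -/
def stack (T M : ℕ) (P : Matrix (Fin M) (Fin M) ℂ) (Q : Matrix (Fin (T - M)) (Fin M) ℂ) :
    Matrix (Fin T) (Fin M) ℂ :=
  Matrix.of fun i j =>
    if hi : (i : ℕ) < M then P ⟨i, hi⟩ j
    else if h2 : (i : ℕ) - M < T - M then Q ⟨(i : ℕ) - M, h2⟩ j else 0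



section
variable {m n : ℕ}
instance : BorelSpace (Matrix (Fin m) (Fin n) ℂ) :=
  inferInstanceAs (BorelSpace (Fin m → Fin n → ℂ))
instance : SecondCountableTopology (Matrix (Fin m) (Fin n) ℂ) :=
  inferInstanceAs (SecondCountableTopology (Fin m → Fin n → ℂ))
instance : Measure.IsAddHaarMeasure (volume : Measure (Fin m → Fin n → ℂ)) :=
  Measure.pi.isAddHaarMeasure (fun _ : Fin m => (volume : Measure (Fin n → ℂ)))
instance : Measure.IsAddHaarMeasure (volume : Measure (Matrix (Fin m) (Fin n) ℂ)) :=
  inferInstanceAs (Measure.IsAddHaarMeasure (volume : Measure (Fin m → Fin n → ℂ)))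
instance : SigmaFinite (volume : Measure (Matrix (Fin m) (Fin n) ℂ)) :=
  inferInstanceAs (SigmaFinite (volume : Measure (Fin m → Fin n → ℂ)))
end

theorem lintegral_linear_aux {E : Type*} [NormedAddCommGroup E] [NormedSpace ℂ E]
    [NormedSpace ℝ E] [IsScalarTower ℝ ℂ E] [FiniteDimensional ℂ E] [FiniteDimensional ℝ E]
    [MeasureSpace E] [BorelSpace E] [Measure.IsAddHaarMeasure (volume : Measure E)]
    (L : E →ₗ[ℂ] E)
    (hd : LinearMap.det L ≠ 0) (g : E → ℝ≥0∞) (hg : Measurable g) :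
    ∫⁻ A, g A = ENNReal.ofReal (‖LinearMap.det L‖ ^ 2) * ∫⁻ A, g (L A) := by
  have hdet : LinearMap.det (L.restrictScalars ℝ) = ‖LinearMap.det L‖ ^ 2 := by
    rw [LinearMap.det_restrictScalars, Algebra.norm_complex_apply, Complex.normSq_eq_norm_sq]
  have hne : LinearMap.det (L.restrictScalars ℝ) ≠ 0 := by
    rw [hdet]; positivity
  have hpos : 0 < ‖LinearMap.det L‖ ^ 2 := by positivity
  have hmap := Measure.map_linearMap_addHaar_eq_smul_addHaar
    (volume : Measure E) hne
  have hL : Measurable L := (L.continuous_of_finiteDimensional).measurable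
  have h2 : ∫⁻ A, g (L A) = ENNReal.ofReal (‖LinearMap.det L‖ ^ 2)⁻¹ * ∫⁻ A, g A := by
    calc ∫⁻ A, g (L A) = ∫⁻ A, g A ∂(Measure.map (L.restrictScalars ℝ) volume) :=
          (lintegral_map hg hL).symm
      _ = _ := by
          rw [hmap, lintegral_smul_measure, hdet, abs_of_pos (by positivity), smul_eq_mul]
  rw [h2, ← mul_assoc, ← ENNReal.ofReal_mul hpos.le, mul_inv_cancel₀ hpos.ne']
  simp

theorem det_vecMulLinear_aux {n : ℕ} (B : Matrix (Fin n) (Fin n) ℂ) :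
    LinearMap.det (B.vecMulLinear) = B.det := by
  rw [← Matrix.det_transpose, ← LinearMap.det_toLin']
  congr 1
  ext1
  ext
  simp

def rightL (m : ℕ) {n : ℕ} (B : Matrix (Fin n) (Fin n) ℂ) :
    (Fin m → Fin n → ℂ) →ₗ[ℂ] (Fin m → Fin n → ℂ) :=
  LinearMap.pi fun i => (B.vecMulLinear).comp (LinearMap.proj i)

theorem det_rightL (m : ℕ) {n : ℕ} (B : Matrix (Fin n) (Fin n) ℂ) :
    LinearMap.det (rightL m B) = B.det ^ m := by
  have := LinearMap.det_pi (fun _ : Fin m => B.vecMulLinear)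
  rw [det_vecMulLinear_aux] at this
  simpa [rightL] using this

theorem lintegral_mul_right_mat {m n : ℕ} (B : Matrix (Fin n) (Fin n) ℂ) (hB : B.det ≠ 0)
    (g : Matrix (Fin m) (Fin n) ℂ → ℝ≥0∞) (hg : Measurable g) :
    ∫⁻ A, g A = ENNReal.ofReal (‖B.det‖ ^ (2 * m)) * ∫⁻ A : Matrix (Fin m) (Fin n) ℂ, g (A * B) := by
  have := lintegral_linear_aux (rightL m B) (by rw [det_rightL]; exact pow_ne_zero _ hB) g hg
  rw [det_rightL] at this
  rw [norm_pow, ← pow_mul, mul_comm m 2] at this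
  exact this

def transL (m n : ℕ) : (Fin m → Fin n → ℂ) ≃ₗ[ℂ] (Fin n → Fin m → ℂ) where
  toFun A i j := A j i
  invFun A i j := A j i
  map_add' _ _ := rfl
  map_smul' _ _ := rfl
  left_inv _ := rfl
  right_inv _ := rfl

theorem lintegral_mul_left_mat {m n : ℕ} (B : Matrix (Fin m) (Fin m) ℂ) (hB : B.det ≠ 0)
    (g : Matrix (Fin m) (Fin n) ℂ → ℝ≥0∞) (hg : Measurable g) :
    ∫⁻ A, g A = ENNReal.ofReal (‖B.det‖ ^ (2 * n)) * ∫⁻ A : Matrix (Fin m) (Fin n) ℂ, g (B * A) := by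
  have hd : LinearMap.det (((transL n m : (Fin n → Fin m → ℂ) →ₗ[ℂ] _) ∘ₗ rightL n Bᵀ) ∘ₗ
      ((transL n m).symm : (Fin m → Fin n → ℂ) →ₗ[ℂ] _)) = B.det ^ n := by
    rw [LinearMap.comp_assoc, LinearMap.det_conj, det_rightL, det_transpose]
  have := lintegral_linear_aux (E := Fin m → Fin n → ℂ) _ (by rw [hd]; exact pow_ne_zero _ hB) g hg
  rw [hd, norm_pow, ← pow_mul, mul_comm n 2] at this
  refine this.trans ?_
  congr 1
  refine lintegral_congr fun A => congrArg g ?_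
  ext i j
  simp [rightL, transL]
  rfl

theorem det_ne_zero_ae (n : ℕ) : ∀ᵐ P : Matrix (Fin n) (Fin n) ℂ, P.det ≠ 0 := by
  have hcd : Continuous fun P : Matrix (Fin n) (Fin n) ℂ => P.det := by fun_prop
  have hZ : MeasurableSet {P : Matrix (Fin n) (Fin n) ℂ | P.det = 0} :=
    (isClosed_singleton.preimage hcd).measurableSet
  set Z := {P : Matrix (Fin n) (Fin n) ℂ | P.det = 0} with hZdef
  have hm : Measurable fun p : Matrix (Fin n) (Fin n) ℂ × ℂ => 
      Z.indicator (1 : Matrix (Fin n) (Fin n) ℂ → ℝ≥0∞) (p.1 + p.2 • 1) := by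
    refine (measurable_one.indicator hZ).comp ?_
    have : Continuous fun p : Matrix (Fin n) (Fin n) ℂ × ℂ => p.1 + p.2 • (1 : Matrix (Fin n) (Fin n) ℂ) := by
      fun_prop
    exact this.measurable
  have h1 : ∫⁻ P : Matrix (Fin n) (Fin n) ℂ, ∫⁻ t : ℂ, 
      Z.indicator (1 : Matrix (Fin n) (Fin n) ℂ → ℝ≥0∞) (P + t • 1) = 0 := by
    refine (lintegral_congr fun P => ?_).trans lintegral_zero
    have hfin : Set.Finite {t : ℂ | P + t • 1 ∈ Z} := by
      refine Set.Finite.subset (Polynomial.rootSet_finite ((-P).charpoly) ℂ) ?_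
      intro t ht
      rw [Polynomial.mem_rootSet]
      refine ⟨(Matrix.charpoly_monic _).ne_zero, ?_⟩
      have : (P + t • (1 : Matrix (Fin n) (Fin n) ℂ)).det = 0 := ht
      simp only [Polynomial.coe_aeval_eq_eval]
      rw [Matrix.eval_charpoly, ← this]
      congr 1
      rw [sub_neg_eq_add, add_comm, Matrix.smul_one_eq_diagonal]
      rfl
    have : ∀ t, Z.indicator (1 : Matrix (Fin n) (Fin n) ℂ → ℝ≥0∞) (P + t • 1) 
        = {t : ℂ | P + t • 1 ∈ Z}.indicator 1 t := fun t => by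
      simp [Set.indicator]
    simp_rw [this]
    rw [lintegral_indicator_one hfin.measurableSet]
    exact hfin.measure_zero _
  rw [lintegral_lintegral_swap hm.aemeasurable] at h1
  have h2 : ∀ t : ℂ, ∫⁻ P : Matrix (Fin n) (Fin n) ℂ, 
      Z.indicator (1 : Matrix (Fin n) (Fin n) ℂ → ℝ≥0∞) (P + t • 1) = volume Z := by
    intro t
    rw [lintegral_add_right_eq_self (fun P => Z.indicator (1 : Matrix (Fin n) (Fin n) ℂ → ℝ≥0∞) P),
      lintegral_indicator_one hZ]
  simp_rw [h2] at h1
  rw [lintegral_const] at h1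
  have : volume Z = 0 := by simpa using h1
  rw [ae_iff]
  simpa [hZdef] using this


theorem oneD_radial (t : ℝ) (ht : 0 < t) (k : ℕ) :
    ∫⁻ r in Set.Ioi (0 : ℝ), ENNReal.ofReal (r * ((t + r ^ 2) ^ (k + 2))⁻¹)
      = ENNReal.ofReal (1 / (2 * (k + 1)) * (t ^ (k + 1))⁻¹) := by
  have hder : ∀ r ∈ Set.Ici (0 : ℝ), HasDerivAt (fun r : ℝ => - (1 / (2 * ((k : ℝ) + 1))) * ((t + r ^ 2) ^ (k + 1))⁻¹)
      (r * ((t + r ^ 2) ^ (k + 2))⁻¹) r := by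
    intro r _
    have hp : 0 < t + r ^ 2 := by positivity
    have h1 : HasDerivAt (fun r : ℝ => t + r ^ 2) (2 * r) r := by
      simpa using (hasDerivAt_pow 2 r).const_add t
    have h2 := ((h1.pow (k + 1)).inv (pow_pos hp _).ne').const_mul (- (1 / (2 * ((k : ℝ) + 1))))
    refine h2.congr_deriv ?_
    have : (k : ℝ) + 1 ≠ 0 := by positivity
    change - (1 / (2 * ((k : ℝ) + 1))) * (-(((k + 1 : ℕ) : ℝ) * (t + r ^ 2) ^ (k + 1 - 1) * (2 * r)) /
      ((t + r ^ 2) ^ (k + 1)) ^ 2) = _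
    rw [Nat.add_sub_cancel, pow_succ _ (k + 1), pow_succ _ k]
    push_cast
    field_simp
  have hnn : ∀ r ∈ Set.Ioi (0 : ℝ), 0 ≤ r * ((t + r ^ 2) ^ (k + 2))⁻¹ := by
    intro r hr
    have : 0 < r := hr
    positivity
  have hlim : Filter.Tendsto (fun r : ℝ => - (1 / (2 * ((k : ℝ) + 1))) * ((t + r ^ 2) ^ (k + 1))⁻¹)
      Filter.atTop (nhds 0) := by
    have h1 : Filter.Tendsto (fun r : ℝ => (t + r ^ 2) ^ (k + 1)) Filter.atTop Filter.atTop := by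
      refine (Filter.tendsto_pow_atTop (by omega)).comp ?_
      exact Filter.tendsto_atTop_add_const_left _ _ (Filter.tendsto_pow_atTop (by omega))
    simpa using (h1.inv_tendsto_atTop).const_mul (- (1 / (2 * ((k : ℝ) + 1))))
  rw [← ofReal_integral_eq_lintegral_ofReal (integrableOn_Ioi_deriv_of_nonneg' hder hnn hlim),
    integral_Ioi_of_hasDerivAt_of_nonneg' hder hnn hlim]
  · congr 1
    simp
  · exact (ae_restrict_mem measurableSet_Ioi).mono hnn

theorem oneD (t : ℝ) (ht : 0 < t) (k : ℕ) :
    ∫⁻ z : ℂ, ENNReal.ofReal (((t + ‖z‖ ^ 2) ^ (k + 2))⁻¹)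
      = ENNReal.ofReal (Real.pi / (k + 1) * (t ^ (k + 1))⁻¹) := by
  rw [← Complex.lintegral_comp_polarCoord_symm]
  have hm : MeasurableSet (Set.Ioi (0 : ℝ) ×ˢ Set.Ioo (-Real.pi) Real.pi) :=
    measurableSet_Ioi.prod measurableSet_Ioo
  have : ∫⁻ p in polarCoord.target, ENNReal.ofReal p.1 •
      ENNReal.ofReal (((t + ‖Complex.polarCoord.symm p‖ ^ 2) ^ (k + 2))⁻¹) =
      ∫⁻ p in Set.Ioi (0 : ℝ) ×ˢ Set.Ioo (-Real.pi) Real.pi,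
        ENNReal.ofReal (p.1 * ((t + p.1 ^ 2) ^ (k + 2))⁻¹) * 1 := by
    refine setLIntegral_congr_fun hm ?_
    rintro ⟨r, θ⟩ ⟨hr, -⟩
    have hr : 0 < r := hr
    simp only [Complex.norm_polarCoord_symm, sq_abs, smul_eq_mul, mul_one]
    rw [ENNReal.ofReal_mul hr.le]
  rw [this, Measure.volume_eq_prod, ← Measure.prod_restrict,
    lintegral_prod_mul (f := fun r : ℝ => ENNReal.ofReal (r * ((t + r ^ 2) ^ (k + 2))⁻¹)) (g := fun _ => 1)
      (by fun_prop) (by fun_prop), oneD_radial t ht k]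
  simp only [lintegral_const, one_mul, Measure.restrict_apply MeasurableSet.univ, Set.univ_inter, Real.volume_Ioo]
  rw [← ENNReal.ofReal_mul (by positivity)]
  congr 1
  have : (k : ℝ) + 1 ≠ 0 := by positivity
  field_simp
  ring

theorem vecInt (M : ℕ) : ∀ (t : ℝ) (_ : 0 < t) (k : ℕ), 
    ∫⁻ b : Fin M → ℂ, ENNReal.ofReal (((t + ∑ i, ‖b i‖ ^ 2) ^ (k + 1 + M))⁻¹)
      = ENNReal.ofReal (Real.pi ^ M * (k.factorial / (k + M).factorial) * (t ^ (k + 1))⁻¹) := by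
  induction M with
  | zero =>
    intro t ht k
    have : (k.factorial : ℝ) ≠ 0 := by positivity
    simp [lintegral_unique, volume_pi, this]
  | succ M ih =>
    intro t ht k
    have hmp := (volume_preserving_piFinSuccAbove (fun _ : Fin (M + 1) => ℂ) 0).symm
    rw [← hmp.lintegral_comp_emb (MeasurableEquiv.measurableEmbedding _), Measure.volume_eq_prod,
      lintegral_prod_symm' _ (by fun_prop)]
    have : ∀ y : Fin M → ℂ, ∫⁻ z : ℂ, ENNReal.ofReal (((t + ∑ i, ‖((MeasurableEquiv.piFinSuccAbove (fun _ : Fin (M + 1) => ℂ) 0).symm (z, y)) i‖ ^ 2) ^ (k + 1 + (M + 1)))⁻¹)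
       = ENNReal.ofReal (Real.pi / ((k + M : ℕ) + 1)) * ENNReal.ofReal (((t + ∑ i, ‖y i‖ ^ 2) ^ (k + 1 + M))⁻¹) := by
      intro y
      have hs : 0 < t + ∑ i, ‖y i‖ ^ 2 := by positivity
      rw [← ENNReal.ofReal_mul (by positivity), show k + 1 + M = k + M + 1 by ring, ← oneD _ hs]
      refine lintegral_congr fun z => ?_
      congr 2
      simp [MeasurableEquiv.piFinSuccAbove, Fin.sum_univ_succ]
      ring
    simp_rw [this]
    rw [lintegral_const_mul _ (by fun_prop), ih t ht k, ← ENNReal.ofReal_mul (by positivity)]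
    congr 1
    rw [show k + (M + 1) = k + M + 1 by ring, Nat.factorial_succ]
    push_cast
    have : (k : ℝ) + M + 1 ≠ 0 := by positivity
    field_simp
    ring

open scoped ComplexOrder

open scoped MatrixOrder in
theorem exists_factor {n : ℕ} {S : Matrix (Fin n) (Fin n) ℂ} (hS : S.PosDef) :
    ∃ B : Matrix (Fin n) (Fin n) ℂ, S = Bᴴ * B ∧ B.det ≠ 0 ∧ S.det.re = ‖B.det‖ ^ 2 := by
  obtain ⟨B, hB⟩ := CStarAlgebra.nonneg_iff_eq_star_mul_self.1 hS.posSemidef.nonneg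
  have h : S.det = (‖B.det‖ ^ 2 : ℝ) := by
    rw [hB, det_mul, star_eq_conjTranspose, det_conjTranspose]
    simp [← Complex.normSq_eq_norm_sq, Complex.normSq_eq_conj_mul_self]
  refine ⟨B, hB, ?_, ?_⟩
  · intro h0
    have := hS.det_pos
    rw [h, h0] at this
    simp at this
  · rw [h, Complex.ofReal_re]

theorem posDef_one_add {m n : ℕ} (A : Matrix (Fin m) (Fin n) ℂ) : (1 + Aᴴ * A).PosDef :=
  Matrix.PosDef.one.add_posSemidef (posSemidef_conjTranspose_mul_self A)

theorem rowInt {M : ℕ} (k : ℕ) {S : Matrix (Fin M) (Fin M) ℂ} (hS : S.PosDef) :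
    ∫⁻ b : Fin M → ℂ, ENNReal.ofReal (((S + vecMulVec (star b) b).det.re ^ (k + 1 + M))⁻¹)
      = ENNReal.ofReal (Real.pi ^ M * (k.factorial / (k + M).factorial)) * 
        ENNReal.ofReal ((S.det.re ^ (k + M))⁻¹) := by
  obtain ⟨B, hSB, hB, hdet⟩ := exists_factor hS
  have hBp : 0 < ‖B.det‖ := norm_pos_iff.2 hB
  rw [lintegral_linear_aux B.vecMulLinear (by rwa [det_vecMulLinear_aux])]
  · have h1 : ∀ b : Fin M → ℂ, (S + vecMulVec (star (B.vecMulLinear b)) (B.vecMulLinear b)).det.re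
        = ‖B.det‖ ^ 2 * (1 + ∑ i, ‖b i‖ ^ 2) := by
      intro b
      have : S + vecMulVec (star (B.vecMulLinear b)) (B.vecMulLinear b)
          = Bᴴ * (1 + vecMulVec (star b) b) * B := by
        rw [Matrix.mul_add, Matrix.add_mul, Matrix.mul_one, ← hSB]
        rw [Matrix.mul_vecMulVec, Matrix.vecMulVec_mul, Matrix.vecMulLinear_apply,
          Matrix.star_vecMul]
      rw [this, det_mul, det_mul, det_conjTranspose, vecMulVec_eq Unit, 
        det_one_add_replicateCol_mul_replicateRow]
      have h2 : (1 : ℂ) + b ⬝ᵥ star b = ((1 + ∑ i, ‖b i‖ ^ 2 : ℝ) : ℂ) := by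
        simp [dotProduct, Complex.mul_conj, Complex.normSq_eq_norm_sq]
      rw [h2]
      have h3 : star B.det * ((1 + ∑ i, ‖b i‖ ^ 2 : ℝ) : ℂ) * B.det = 
          ((‖B.det‖ ^ 2 * (1 + ∑ i, ‖b i‖ ^ 2) : ℝ) : ℂ) := by
        rw [← Complex.normSq_eq_norm_sq, Complex.ofReal_mul, Complex.normSq_eq_conj_mul_self]
        simp only [Complex.star_def]
        ring
      rw [h3, Complex.ofReal_re]
    simp_rw [h1, det_vecMulLinear_aux, mul_pow, mul_inv]
    have h4 : ∀ b : Fin M → ℂ, ENNReal.ofReal (((‖B.det‖ ^ 2) ^ (k + 1 + M))⁻¹ * ((1 + ∑ i, ‖b i‖ ^ 2) ^ (k + 1 + M))⁻¹)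
        = ENNReal.ofReal (((‖B.det‖ ^ 2) ^ (k + 1 + M))⁻¹) * ENNReal.ofReal ( ((1 + ∑ i, ‖b i‖ ^ 2) ^ (k + 1 + M))⁻¹) :=
      fun b => ENNReal.ofReal_mul (by positivity)
    simp_rw [h4]
    rw [lintegral_const_mul _ (by fun_prop), vecInt M 1 one_pos k, hdet, ← ENNReal.ofReal_mul (by positivity), ← ENNReal.ofReal_mul (by positivity), ← ENNReal.ofReal_mul (by positivity)]
    congr 1
    rw [show k + 1 + M = k + M + 1 by ring, pow_succ _ (k + M)]
    field_simp
    simp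
  · have : Continuous fun b : Fin M → ℂ => (S + vecMulVec (star b) b).det.re := by fun_prop
    have := this.measurable
    fun_prop

theorem lintegral_cons_row {M n : ℕ} (g : Matrix (Fin (n + 1)) (Fin M) ℂ → ℝ≥0∞)
    (hg : Measurable g) :
    ∫⁻ A, g A = ∫⁻ y : Matrix (Fin n) (Fin M) ℂ, ∫⁻ b : Fin M → ℂ,
      g (Matrix.of (Fin.cons b y : Fin (n + 1) → Fin M → ℂ)) := by
  have hmp := (volume_preserving_piFinSuccAbove (fun _ : Fin (n + 1) => Fin M → ℂ) 0).symm
  have h0 := hmp.lintegral_comp_emb (MeasurableEquiv.measurableEmbedding _) g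
  refine h0.symm.trans ?_
  rw [Measure.volume_eq_prod]
  refine (lintegral_prod_symm' _ (hg.comp (MeasurableEquiv.measurable _))).trans ?_
  refine lintegral_congr fun y => lintegral_congr fun b => ?_
  exact congrArg g (Fin.insertNth_zero' (β := Fin M → ℂ) b y)

theorem gram_cons_row {M n : ℕ} (y : Matrix (Fin n) (Fin M) ℂ) (b : Fin M → ℂ) :
    (Matrix.of (Fin.cons b y : Fin (n + 1) → Fin M → ℂ))ᴴ *
      (Matrix.of (Fin.cons b y : Fin (n + 1) → Fin M → ℂ)) = yᴴ * y + vecMulVec (star b) b := by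
  ext i j
  simp only [Matrix.mul_apply, Fin.sum_univ_succ, vecMulVec_apply, Matrix.add_apply,
    conjTranspose_apply, of_apply, Pi.star_apply]
  rw [add_comm]
  rfl

theorem measurable_weight (M n s : ℕ) : Measurable fun A : Matrix (Fin n) (Fin M) ℂ =>
    ENNReal.ofReal (((1 + Aᴴ * A).det.re ^ s)⁻¹) := by
  have : Continuous fun A : Matrix (Fin n) (Fin M) ℂ => (1 + Aᴴ * A).det.re := by fun_prop
  exact ENNReal.measurable_ofReal.comp ((this.measurable.pow_const s).inv)

theorem matInt (M n : ℕ) :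
    ∫⁻ A : Matrix (Fin n) (Fin M) ℂ, ENNReal.ofReal (((1 + Aᴴ * A).det.re ^ (n + M))⁻¹)
      = ENNReal.ofReal (∏ i ∈ Finset.range n, Real.pi ^ M * (i.factorial / (i + M).factorial)) := by
  induction n with
  | zero =>
    have : ∀ A : Matrix (Fin 0) (Fin M) ℂ, Aᴴ * A = 0 := fun A => by ext; simp [Matrix.mul_apply]
    simp_rw [this]
    simp only [lintegral_const]
    have h : (volume : Measure (Fin 0 → Fin M → ℂ)) Set.univ = 1 := by
      simp [volume_pi]
    erw [h]
    simp
  | succ n ih =>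
    rw [lintegral_cons_row _ (measurable_weight M (n + 1) _)]
    have h2 : ∀ (y : Matrix (Fin n) (Fin M) ℂ), ∫⁻ b : Fin M → ℂ,
        ENNReal.ofReal (((1 + (Matrix.of (Fin.cons b y : Fin (n + 1) → Fin M → ℂ))ᴴ *
      (Matrix.of (Fin.cons b y : Fin (n + 1) → Fin M → ℂ))).det.re ^ (n + 1 + M))⁻¹)
       = ENNReal.ofReal (Real.pi ^ M * (n.factorial / (n + M).factorial)) *
        ENNReal.ofReal (((1 + yᴴ * y).det.re ^ (n + M))⁻¹) := by
      intro y
      rw [← rowInt n (posDef_one_add y)]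
      refine lintegral_congr fun b => ?_
      rw [gram_cons_row, ← add_assoc (1 : Matrix (Fin M) (Fin M) ℂ)]
    rw [lintegral_congr h2, lintegral_const_mul _ (measurable_weight M n _), ih,
      ← ENNReal.ofReal_mul (by positivity), Finset.prod_range_succ, mul_comm]

theorem const_eq (M n : ℕ) : 
    ∏ i ∈ Finset.range n, Real.pi ^ M * (i.factorial / (i + M).factorial)
    = Real.pi ^ (M * n) *
            ∏ m ∈ Finset.Icc 1 M, (Nat.factorial (m - 1) : ℝ) / (Nat.factorial (n + M - m) : ℝ) := by
  rw [Finset.prod_mul_distrib, Finset.prod_const, Finset.card_range, ← pow_mul]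
  congr 1
  induction n with
  | zero =>
    rw [Finset.range_zero, Finset.prod_empty, Finset.prod_div_distrib, eq_comm, div_eq_one_iff_eq (by positivity)]
    refine Finset.prod_nbij' (fun i => M + 1 - i) (fun i => M + 1 - i) ?_ ?_ ?_ ?_ ?_
    all_goals intro i hi; simp only [Finset.mem_Icc] at *
    any_goals omega
    congr 2; omega
  | succ n ih =>
    rw [Finset.prod_range_succ, ih, Finset.prod_div_distrib, Finset.prod_div_distrib]
    have h1 : ∀ r : ℕ, (∏ m ∈ Finset.Icc 1 M, ((r + M - m).factorial : ℝ)) = ∏ j ∈ Finset.range M, ((r + j).factorial : ℝ) := by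
      intro r
      refine Finset.prod_nbij' (fun i => M - i) (fun i => M - i) ?_ ?_ ?_ ?_ ?_
      all_goals intro i hi; simp only [Finset.mem_Icc, Finset.mem_range] at *
      any_goals omega
      congr 2; omega
    rw [h1, h1]
    have h2 : (∏ j ∈ Finset.range M, ((n + 1 + j).factorial : ℝ)) * n.factorial = (∏ j ∈ Finset.range M, ((n + j).factorial : ℝ)) * (n + M).factorial := by
      have := Finset.prod_range_succ (fun j => ((n + j).factorial : ℝ)) M
      have h3 := Finset.prod_range_succ' (fun j => ((n + j).factorial : ℝ)) M
      rw [← this, h3]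
      simp only [add_zero]
      congr 1
      refine Finset.prod_congr rfl fun j _ => ?_
      congr 2; ring
    field_simp
    linear_combination h2

def sumE (T M : ℕ) (h : M ≤ T) : Fin M ⊕ Fin (T - M) ≃ Fin T :=
  finSumFinEquiv.trans (finCongr (by omega))

theorem stack_inl (T M : ℕ) (h : M ≤ T) (P : Matrix (Fin M) (Fin M) ℂ)
    (Q : Matrix (Fin (T - M)) (Fin M) ℂ) (a : Fin M) (j : Fin M) :
    stack T M P Q (sumE T M h (Sum.inl a)) j = P a j := by
  simp [stack, sumE]

theorem stack_inr (T M : ℕ) (h : M ≤ T) (P : Matrix (Fin M) (Fin M) ℂ)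
    (Q : Matrix (Fin (T - M)) (Fin M) ℂ) (a : Fin (T - M)) (j : Fin M) :
    stack T M P Q (sumE T M h (Sum.inr a)) j = Q a j := by
  simp [stack, sumE]

theorem stack_mul (T M : ℕ) (h : M ≤ T) (P G : Matrix (Fin M) (Fin M) ℂ)
    (Q : Matrix (Fin (T - M)) (Fin M) ℂ) :
    stack T M P Q * G = stack T M (P * G) (Q * G) := by
  ext i j
  obtain ⟨a, rfl⟩ := (sumE T M h).surjective i
  rcases a with a | a
  · simp only [Matrix.mul_apply, stack_inl]
  · simp only [Matrix.mul_apply, stack_inr]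

theorem gram_stack (T M : ℕ) (h : M ≤ T) (P : Matrix (Fin M) (Fin M) ℂ)
    (Q : Matrix (Fin (T - M)) (Fin M) ℂ) :
    (stack T M P Q)ᴴ * stack T M P Q = Pᴴ * P + Qᴴ * Q := by
  ext i j
  simp only [Matrix.mul_apply, Matrix.add_apply, conjTranspose_apply]
  rw [← (sumE T M h).sum_comp, Fintype.sum_sum_type]
  simp only [stack_inl, stack_inr]

theorem continuous_stack (T M : ℕ) (h : M ≤ T) :
    Continuous fun p : Matrix (Fin M) (Fin M) ℂ × Matrix (Fin (T - M)) (Fin M) ℂ =>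
      stack T M p.1 p.2 := by
  refine continuous_matrix fun i j => ?_
  obtain ⟨a, rfl⟩ := (sumE T M h).surjective i
  rcases a with a | a
  · simp only [stack_inl]
    exact continuous_fst.matrix_elem a j
  · simp only [stack_inr]
    exact continuous_snd.matrix_elem a j

theorem lintegral_stack (T M : ℕ) (h : M ≤ T) (g : Matrix (Fin T) (Fin M) ℂ → ℝ≥0∞)
    (hg : Measurable g) :
    ∫⁻ X, g X = ∫⁻ P : Matrix (Fin M) (Fin M) ℂ, ∫⁻ Q : Matrix (Fin (T - M)) (Fin M) ℂ,
      g (stack T M P Q) := by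
  have mp1 := volume_measurePreserving_piCongrLeft (fun _ : Fin T => Fin M → ℂ) (sumE T M h)
  have mp2 := volume_measurePreserving_sumPiEquivProdPi_symm
    (fun _ : Fin M ⊕ Fin (T - M) => Fin M → ℂ)
  have h1 := mp1.lintegral_comp_emb (MeasurableEquiv.measurableEmbedding _) g
  have h2 := mp2.lintegral_comp_emb (MeasurableEquiv.measurableEmbedding _)
    (fun a => g (MeasurableEquiv.piCongrLeft (fun _ : Fin T => Fin M → ℂ) (sumE T M h) a))
  refine h1.symm.trans (h2.symm.trans ?_)
  rw [Measure.volume_eq_prod]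
  have hm : Measurable fun p : (Fin M → Fin M → ℂ) × (Fin (T - M) → Fin M → ℂ) =>
      g (MeasurableEquiv.piCongrLeft (fun _ : Fin T => Fin M → ℂ) (sumE T M h)
        ((MeasurableEquiv.sumPiEquivProdPi
          (fun _ : Fin M ⊕ Fin (T - M) => Fin M → ℂ)).symm p)) :=
    hg.comp ((MeasurableEquiv.measurable _).comp (MeasurableEquiv.measurable _))
  refine (lintegral_prod _ hm.aemeasurable).trans ?_
  refine lintegral_congr fun P => lintegral_congr fun Q => congrArg g ?_
  funext i
  obtain ⟨a, rfl⟩ := (sumE T M h).surjective i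
  refine (Equiv.piCongrLeft_apply_apply (fun _ : Fin T => Fin M → ℂ) (sumE T M h) _ a).trans ?_
  rcases a with a | a
  · funext j
    exact (stack_inl T M h P Q a j).symm
  · funext j
    exact (stack_inr T M h P Q a j).symm

theorem exists_unitary_frame (T M : ℕ) (h : M ≤ T) (X : Matrix (Fin T) (Fin M) ℂ)
    (hX : (Xᴴ * X).PosDef) : ∃ (V : Matrix.unitaryGroup (Fin T) ℂ) (G : Matrix (Fin M) (Fin M) ℂ),
      IsUnit G ∧ X = (V : Matrix (Fin T) (Fin T) ℂ) * stdFrame T M * G := by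
  obtain ⟨B, hXB, hB, -⟩ := exists_factor hX
  have hBu : IsUnit B.det := isUnit_iff_ne_zero.2 hB
  set Y := X * B⁻¹ with hY
  have hYY : Yᴴ * Y = 1 := by
    rw [hY, conjTranspose_mul, Matrix.mul_assoc, ← Matrix.mul_assoc Xᴴ, hXB, Matrix.mul_assoc Bᴴ,
      Matrix.mul_nonsing_inv _ hBu, Matrix.mul_one, ← conjTranspose_mul,
      Matrix.mul_nonsing_inv _ hBu, conjTranspose_one]
  let v : Fin T → EuclideanSpace ℂ (Fin T) := fun i =>
    if hi : (i : ℕ) < M then WithLp.toLp 2 (fun k => Y k ⟨i, hi⟩) else 0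
  let s : Set (Fin T) := {i | (i : ℕ) < M}
  have hv : Orthonormal ℂ (s.domRestrict v) := by
    rw [orthonormal_iff_ite]
    rintro ⟨i, hi⟩ ⟨j, hj⟩
    have hi' : (i : ℕ) < M := hi
    have hj' : (j : ℕ) < M := hj
    have := congrFun (congrFun hYY ⟨i, hi'⟩) ⟨j, hj'⟩
    rw [Matrix.mul_apply, Matrix.one_apply] at this
    simp only [Set.domRestrict_apply, v, hi', hj', dif_pos, PiLp.inner_apply]
    simp only [Subtype.mk.injEq, Fin.ext_iff] at this ⊢
    rw [← this]
    refine Finset.sum_congr rfl fun k _ => ?_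
    simp
    exact mul_comm _ _
  obtain ⟨b, hb⟩ := hv.exists_orthonormalBasis_extension_of_card_eq (by simp)
  let V : Matrix (Fin T) (Fin T) ℂ := Matrix.of fun i j => b j i
  have hV : V ∈ Matrix.unitaryGroup (Fin T) ℂ := by
    rw [Matrix.mem_unitaryGroup_iff']
    ext i j
    have := orthonormal_iff_ite.1 b.orthonormal i j
    rw [Matrix.mul_apply, Matrix.one_apply, ← this, PiLp.inner_apply]
    refine Finset.sum_congr rfl fun k _ => ?_
    simp [V, mul_comm]
  refine ⟨⟨V, hV⟩, B, (Matrix.isUnit_iff_isUnit_det _).2 hBu, ?_⟩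
  have hVE : V * stdFrame T M = Y := by
    ext i j
    have hj : (j : ℕ) < T := j.2.trans_le h
    rw [Matrix.mul_apply, Finset.sum_eq_single (⟨j, hj⟩ : Fin T)]
    · have := hb ⟨j, hj⟩ j.2
      simp [V, stdFrame, this, v]
    · intro k _ hk
      have : (k : ℕ) ≠ j := fun e => hk (Fin.ext e)
      simp [stdFrame, this]
    · simp
  change X = V * stdFrame T M * B
  rw [hVE, hY, Matrix.mul_assoc, Matrix.nonsing_inv_mul _ hBu, Matrix.mul_one]

theorem lintegral_mul_right_of_left_invariant {G : Type*} [Group G] [MeasurableSpace G]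
    [MeasurableMul₂ G] [MeasurableInv G] (μ : Measure G) [IsProbabilityMeasure μ]
    [μ.IsMulLeftInvariant] (g : G → ℝ≥0∞) (hg : Measurable g) (v : G) :
    ∫⁻ u, g (u * v) ∂μ = ∫⁻ u, g u ∂μ := by
  have key : ∀ g : G → ℝ≥0∞, Measurable g → ∫⁻ u, g u⁻¹ ∂μ = ∫⁻ u, g u ∂μ := by
    intro g hg
    have h1 : ∫⁻ v, ∫⁻ u, g (v⁻¹ * u) ∂μ ∂μ = ∫⁻ u, g u ∂μ := by
      have : ∀ v, ∫⁻ u, g (v⁻¹ * u) ∂μ = ∫⁻ u, g u ∂μ := fun v =>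
        lintegral_mul_left_eq_self g v⁻¹
      simp [this]
    have h2 : ∫⁻ u, ∫⁻ v, g (v⁻¹ * u) ∂μ ∂μ = ∫⁻ u, g u⁻¹ ∂μ := by
      have : ∀ u, ∫⁻ v, g (v⁻¹ * u) ∂μ = ∫⁻ v, g v⁻¹ ∂μ := fun u => by
        rw [← lintegral_mul_left_eq_self (fun v => g v⁻¹) u⁻¹]
        refine lintegral_congr fun v => ?_
        simp
      simp [this]
    rw [← h1, ← h2, lintegral_lintegral_swap]
    have hm : Measurable fun p : G × G => p.2⁻¹ * p.1 := by fun_prop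
    exact (hg.comp hm).aemeasurable
  rw [← key (fun u => g (u * v)) (hg.comp (measurable_mul_const v)), ← key g hg,
    ← lintegral_mul_left_eq_self (fun u => g u⁻¹) v⁻¹]
  refine lintegral_congr fun u => ?_
  simp

instance (T : ℕ) : BorelSpace (Matrix.unitaryGroup (Fin T) ℂ) :=
  Subtype.borelSpace (α := Matrix (Fin T) (Fin T) ℂ) _
instance (T : ℕ) : SecondCountableTopology (Matrix.unitaryGroup (Fin T) ℂ) :=
  TopologicalSpace.Subtype.secondCountableTopology (α := Matrix (Fin T) (Fin T) ℂ) _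
instance (T : ℕ) : MeasurableMul₂ (Matrix.unitaryGroup (Fin T) ℂ) := inferInstance
instance (T : ℕ) : MeasurableInv (Matrix.unitaryGroup (Fin T) ℂ) := inferInstance

/-- Cut-off weight: the indicator of the matrices with trace (real part) below `1`. -/
noncomputable def wgt {M : ℕ} (S : Matrix (Fin M) (Fin M) ℂ) : ℝ≥0∞ :=
  {S : Matrix (Fin M) (Fin M) ℂ | S.trace.re < 1}.indicator 1 S

theorem isOpen_wgt (M : ℕ) : IsOpen {S : Matrix (Fin M) (Fin M) ℂ | S.trace.re < 1} := by
  have : Continuous fun S : Matrix (Fin M) (Fin M) ℂ => S.trace.re := by fun_prop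
  exact isOpen_lt this continuous_const

theorem measurable_wgt {M : ℕ} : Measurable (wgt (M := M)) :=
  measurable_one.indicator (isOpen_wgt M).measurableSet

theorem trace_gram {m n : ℕ} (X : Matrix (Fin m) (Fin n) ℂ) :
    (Xᴴ * X).trace.re = ∑ j, ∑ i, ‖X i j‖ ^ 2 := by
  simp [Matrix.trace, Matrix.mul_apply, ← Complex.normSq_eq_norm_sq, Complex.normSq_apply]

theorem wgt_mass {T M : ℕ} :
    ∫⁻ X : Matrix (Fin T) (Fin M) ℂ, wgt (Xᴴ * X) ≠ 0 ∧
    ∫⁻ X : Matrix (Fin T) (Fin M) ℂ, wgt (Xᴴ * X) ≠ ∞ := by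
  let O : Set (Matrix (Fin T) (Fin M) ℂ) := {X | (Xᴴ * X).trace.re < 1}
  have hc : Continuous fun X : Matrix (Fin T) (Fin M) ℂ => Xᴴ * X := by fun_prop
  have hO : IsOpen O := (isOpen_wgt M).preimage hc
  have hI : ∫⁻ X : Matrix (Fin T) (Fin M) ℂ, wgt (Xᴴ * X) = volume O := by
    rw [← lintegral_indicator_one hO.measurableSet]
    rfl
  rw [hI]
  refine ⟨(hO.measure_pos volume ⟨0, by simp [O]⟩).ne', ?_⟩
  let K : Set (Matrix (Fin T) (Fin M) ℂ) :=
    (Set.univ.pi fun _ : Fin T => Set.univ.pi fun _ : Fin M => Metric.closedBall (0 : ℂ) 1 :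
      Set (Fin T → Fin M → ℂ))
  have hsub : O ⊆ K := by
    intro X hX i _ j _
    have hX : (Xᴴ * X).trace.re < 1 := hX
    rw [trace_gram] at hX
    have h1 : ‖X i j‖ ^ 2 ≤ ∑ j, ∑ i, ‖X i j‖ ^ 2 :=
      (Finset.single_le_sum (f := fun i => ‖X i j‖ ^ 2) (fun _ _ => by positivity)
        (Finset.mem_univ i)).trans
      (Finset.single_le_sum (f := fun j => ∑ i, ‖X i j‖ ^ 2) (fun _ _ => by positivity)
        (Finset.mem_univ j))
    have h0 := norm_nonneg (X i j)
    rw [mem_closedBall_zero_iff]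
    nlinarith
  have hK : IsCompact K :=
    isCompact_univ_pi fun _ => isCompact_univ_pi fun _ => isCompact_closedBall _ _
  exact ((measure_mono hsub).trans_lt (hK.measure_lt_top (μ := volume))).ne

noncomputable def KK (M N : ℕ) : ℝ≥0∞ :=
  ∫⁻ R : Matrix (Fin M) (Fin M) ℂ, ENNReal.ofReal (‖R.det‖ ^ (2 * N)) * wgt (Rᴴ * R)

theorem measurable_ofReal_det {M : ℕ} (N : ℕ) :
    Measurable fun R : Matrix (Fin M) (Fin M) ℂ => ENNReal.ofReal (‖R.det‖ ^ (2 * N)) := by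
  have : Continuous fun R : Matrix (Fin M) (Fin M) ℂ => ‖R.det‖ ^ (2 * N) := by fun_prop
  exact ENNReal.measurable_ofReal.comp this.measurable

theorem KK_scale {M N : ℕ} {S : Matrix (Fin M) (Fin M) ℂ} (hS : S.PosDef) :
    ∫⁻ P : Matrix (Fin M) (Fin M) ℂ, ENNReal.ofReal (‖P.det‖ ^ (2 * N)) * wgt (Pᴴ * S * P)
      = ENNReal.ofReal ((S.det.re ^ (M + N))⁻¹) * KK M N := by
  obtain ⟨B, hSB, hB, hdet⟩ := exists_factor hS
  have hBp : 0 < ‖B.det‖ := norm_pos_iff.2 hB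
  have hc : Continuous fun X : Matrix (Fin M) (Fin M) ℂ => Xᴴ * X := by fun_prop
  have hc2 : Continuous fun X : Matrix (Fin M) (Fin M) ℂ => Xᴴ * S * X := by fun_prop
  have hm1 : Measurable fun R : Matrix (Fin M) (Fin M) ℂ =>
      ENNReal.ofReal (‖R.det‖ ^ (2 * N)) * wgt (Rᴴ * R) :=
    (measurable_ofReal_det N).mul (measurable_wgt.comp hc.measurable)
  have hm2 : Measurable fun R : Matrix (Fin M) (Fin M) ℂ =>
      ENNReal.ofReal (‖R.det‖ ^ (2 * N)) * wgt (Rᴴ * S * R) :=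
    (measurable_ofReal_det N).mul (measurable_wgt.comp hc2.measurable)
  rw [KK, lintegral_mul_left_mat B hB _ hm1]
  have h1 : ∀ P : Matrix (Fin M) (Fin M) ℂ,
      ENNReal.ofReal (‖(B * P).det‖ ^ (2 * N)) * wgt ((B * P)ᴴ * (B * P)) =
      ENNReal.ofReal (‖B.det‖ ^ (2 * N)) *
        (ENNReal.ofReal (‖P.det‖ ^ (2 * N)) * wgt (Pᴴ * S * P)) := by
    intro P
    rw [det_mul, norm_mul, mul_pow, ENNReal.ofReal_mul (by positivity), mul_assoc, hSB,
      conjTranspose_mul]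
    simp only [Matrix.mul_assoc]
  simp_rw [h1]
  rw [lintegral_const_mul _ hm2, ← mul_assoc, ← mul_assoc,
    ← ENNReal.ofReal_mul (by rw [hdet]; positivity), ← ENNReal.ofReal_mul (by rw [hdet]; positivity)]
  have : (S.det.re ^ (M + N))⁻¹ * ‖B.det‖ ^ (2 * M) * ‖B.det‖ ^ (2 * N) = 1 := by
    rw [hdet, ← pow_mul, mul_add, pow_add]
    field_simp
  rw [this]
  simp

theorem lintegral_chart (T M : ℕ) (h : M ≤ T) (f : Matrix (Fin T) (Fin M) ℂ → ℝ≥0∞)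
    (hf : Measurable f)
    (hinv : ∀ (X : Matrix (Fin T) (Fin M) ℂ) (G : Matrix (Fin M) (Fin M) ℂ),
      IsUnit G → f (X * G) = f X) :
    ∫⁻ X : Matrix (Fin T) (Fin M) ℂ, f X * wgt (Xᴴ * X) =
      (∫⁻ A : Matrix (Fin (T - M)) (Fin M) ℂ,
          f (stack T M 1 A) * ENNReal.ofReal ((((1 + Aᴴ * A).det).re ^ T)⁻¹)) * KK M (T - M) := by
  have hc : Continuous fun X : Matrix (Fin T) (Fin M) ℂ => Xᴴ * X := by fun_prop
  have hm0 : Measurable fun X : Matrix (Fin T) (Fin M) ℂ => f X * wgt (Xᴴ * X) :=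
    hf.mul (measurable_wgt.comp hc.measurable)
  rw [lintegral_stack T M h _ hm0]
  have hcs1 : Continuous fun A : Matrix (Fin (T - M)) (Fin M) ℂ => stack T M 1 A :=
    (continuous_stack T M h).comp (Continuous.prodMk continuous_const continuous_id)
  have hm1 : Measurable fun A : Matrix (Fin (T - M)) (Fin M) ℂ => f (stack T M 1 A) :=
    hf.comp hcs1.measurable
  have hcP : ∀ P : Matrix (Fin M) (Fin M) ℂ,
      Continuous fun Q : Matrix (Fin (T - M)) (Fin M) ℂ => stack T M P Q := fun P =>
    (continuous_stack T M h).comp (Continuous.prodMk continuous_const continuous_id)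
  have hstep : ∀ᵐ P : Matrix (Fin M) (Fin M) ℂ,
      ∫⁻ Q : Matrix (Fin (T - M)) (Fin M) ℂ,
        f (stack T M P Q) * wgt ((stack T M P Q)ᴴ * stack T M P Q) =
      ∫⁻ A : Matrix (Fin (T - M)) (Fin M) ℂ, f (stack T M 1 A) *
        (ENNReal.ofReal (‖P.det‖ ^ (2 * (T - M))) * wgt (Pᴴ * (1 + Aᴴ * A) * P)) := by
    filter_upwards [det_ne_zero_ae M] with P hP
    have hPu : IsUnit P := (Matrix.isUnit_iff_isUnit_det _).2 (isUnit_iff_ne_zero.2 hP)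
    have hmP : Measurable fun Q : Matrix (Fin (T - M)) (Fin M) ℂ =>
        f (stack T M P Q) * wgt ((stack T M P Q)ᴴ * stack T M P Q) :=
      hm0.comp (hcP P).measurable
    rw [lintegral_mul_right_mat P hP _ hmP,
      ← lintegral_const_mul' _ _ ENNReal.ofReal_ne_top]
    refine lintegral_congr fun A => ?_
    have h1 : stack T M P (A * P) = stack T M 1 A * P := by
      rw [stack_mul T M h, Matrix.one_mul]
    rw [h1, hinv _ _ hPu, conjTranspose_mul, ← Matrix.mul_assoc, Matrix.mul_assoc Pᴴ, gram_stack T M h,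
      conjTranspose_one, Matrix.one_mul]
    ring
  rw [lintegral_congr_ae hstep]
  have hc3 : Continuous fun p : Matrix (Fin M) (Fin M) ℂ × Matrix (Fin (T - M)) (Fin M) ℂ =>
      p.1ᴴ * (1 + p.2ᴴ * p.2) * p.1 := by fun_prop
  have hc4 : ∀ A : Matrix (Fin (T - M)) (Fin M) ℂ, Continuous fun P : Matrix (Fin M) (Fin M) ℂ =>
      Pᴴ * (1 + Aᴴ * A) * P := fun A => by fun_prop
  rw [lintegral_lintegral_swap]
  · have hmA : Measurable fun A : Matrix (Fin (T - M)) (Fin M) ℂ =>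
        f (stack T M 1 A) * ENNReal.ofReal ((((1 + Aᴴ * A).det).re ^ T)⁻¹) :=
      hm1.mul (measurable_weight M (T - M) T)
    rw [← lintegral_mul_const _ hmA]
    refine lintegral_congr fun A => ?_
    have hmP : Measurable fun P : Matrix (Fin M) (Fin M) ℂ =>
        ENNReal.ofReal (‖P.det‖ ^ (2 * (T - M))) * wgt (Pᴴ * (1 + Aᴴ * A) * P) :=
      (measurable_ofReal_det _).mul (measurable_wgt.comp (hc4 A).measurable)
    rw [lintegral_const_mul _ hmP,
      KK_scale (posDef_one_add A), mul_assoc, show M + (T - M) = T by omega]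
  · exact ((hm1.comp measurable_snd).mul (((measurable_ofReal_det _).comp measurable_fst).mul
      (measurable_wgt.comp hc3.measurable))).aemeasurable

theorem lintegral_haar (T M : ℕ) (h : M ≤ T)
    (μ : Measure (Matrix.unitaryGroup (Fin T) ℂ))
    [IsProbabilityMeasure μ] [μ.IsMulLeftInvariant]
    (f : Matrix (Fin T) (Fin M) ℂ → ℝ≥0∞) (hf : Measurable f)
    (hinv : ∀ (X : Matrix (Fin T) (Fin M) ℂ) (G : Matrix (Fin M) (Fin M) ℂ),
      IsUnit G → f (X * G) = f X) :
    ∫⁻ X : Matrix (Fin T) (Fin M) ℂ, f X * wgt (Xᴴ * X) =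
      (∫⁻ U : Matrix.unitaryGroup (Fin T) ℂ,
        f ((U : Matrix (Fin T) (Fin T) ℂ) * stdFrame T M) ∂μ) *
      ∫⁻ X : Matrix (Fin T) (Fin M) ℂ, wgt (Xᴴ * X) := by
  have hc : Continuous fun X : Matrix (Fin T) (Fin M) ℂ => Xᴴ * X := by fun_prop
  have hmw : Measurable fun X : Matrix (Fin T) (Fin M) ℂ => wgt (Xᴴ * X) :=
    measurable_wgt.comp hc.measurable
  have hcU : Continuous fun p : Matrix.unitaryGroup (Fin T) ℂ × Matrix (Fin T) (Fin M) ℂ =>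
      (p.1 : Matrix (Fin T) (Fin T) ℂ) * p.2 := by fun_prop
  have hmU : Measurable fun p : Matrix.unitaryGroup (Fin T) ℂ × Matrix (Fin T) (Fin M) ℂ =>
      f ((p.1 : Matrix (Fin T) (Fin T) ℂ) * p.2) := hf.comp hcU.measurable
  have h1 : ∀ U : Matrix.unitaryGroup (Fin T) ℂ,
      ∫⁻ X : Matrix (Fin T) (Fin M) ℂ, f ((U : Matrix (Fin T) (Fin T) ℂ) * X) * wgt (Xᴴ * X) =
      ∫⁻ X : Matrix (Fin T) (Fin M) ℂ, f X * wgt (Xᴴ * X) := by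
    intro U
    have hUU : (U : Matrix (Fin T) (Fin T) ℂ)ᴴ * (U : Matrix (Fin T) (Fin T) ℂ) = 1 :=
      Matrix.mem_unitaryGroup_iff'.1 U.2
    have hn : ‖(U : Matrix (Fin T) (Fin T) ℂ).det‖ = 1 := by
      have := congrArg (fun A => ‖Matrix.det A‖) hUU
      simp only [det_mul, det_conjTranspose, norm_mul, norm_star, det_one, norm_one] at this
      nlinarith [norm_nonneg (U : Matrix (Fin T) (Fin T) ℂ).det]
    have hne : (U : Matrix (Fin T) (Fin T) ℂ).det ≠ 0 := by
      rw [← norm_pos_iff, hn]; exact one_pos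
    have hm0 : Measurable fun X : Matrix (Fin T) (Fin M) ℂ => f X * wgt (Xᴴ * X) := hf.mul hmw
    have e := lintegral_mul_left_mat (U : Matrix (Fin T) (Fin T) ℂ) hne _ hm0
    rw [hn] at e
    simp only [one_pow, ENNReal.ofReal_one, one_mul] at e
    rw [e]
    refine lintegral_congr fun X => ?_
    rw [conjTranspose_mul, Matrix.mul_assoc, ← Matrix.mul_assoc _ _ X, hUU, Matrix.one_mul]
  have h2 : ∫⁻ X : Matrix (Fin T) (Fin M) ℂ, f X * wgt (Xᴴ * X) =
      ∫⁻ U : Matrix.unitaryGroup (Fin T) ℂ, (∫⁻ X : Matrix (Fin T) (Fin M) ℂ,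
        f ((U : Matrix (Fin T) (Fin T) ℂ) * X) * wgt (Xᴴ * X)) ∂μ := by
    simp_rw [h1]
    simp
  have hmUw : Measurable fun p : Matrix.unitaryGroup (Fin T) ℂ × Matrix (Fin T) (Fin M) ℂ =>
      f ((p.1 : Matrix (Fin T) (Fin T) ℂ) * p.2) * wgt (p.2ᴴ * p.2) :=
    hmU.mul (hmw.comp measurable_snd)
  rw [h2, lintegral_lintegral_swap hmUw.aemeasurable, ← lintegral_const_mul _ hmw,
    lintegral_stack T M h _ hmUw.lintegral_prod_left',
    lintegral_stack T M h _ (hmw.const_mul _)]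
  refine lintegral_congr_ae ?_
  filter_upwards [det_ne_zero_ae M] with P hP
  refine lintegral_congr fun Q => ?_
  set X := stack T M P Q with hX
  have hpd : (Xᴴ * X).PosDef := by
    rw [hX, gram_stack T M h]
    refine Matrix.PosDef.add_posSemidef ?_ (posSemidef_conjTranspose_mul_self Q)
    refine Matrix.PosDef.conjTranspose_mul_self P ?_
    exact Matrix.mulVec_injective_of_isUnit
      ((Matrix.isUnit_iff_isUnit_det _).2 (isUnit_iff_ne_zero.2 hP))
  obtain ⟨V, G, hG, hXV⟩ := exists_unitary_frame T M h X hpd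
  have hmX : ∀ X : Matrix (Fin T) (Fin M) ℂ, Measurable fun U : Matrix.unitaryGroup (Fin T) ℂ =>
      f ((U : Matrix (Fin T) (Fin T) ℂ) * X) := fun X =>
    hmU.comp (measurable_id.prodMk measurable_const)
  rw [lintegral_mul_const _ (hmX X)]
  congr 1
  rw [← lintegral_mul_right_of_left_invariant μ _ (hmX (stdFrame T M)) V]
  refine lintegral_congr fun U => ?_
  rw [hXV, ← Matrix.mul_assoc, hinv _ _ hG, Submonoid.coe_mul, Matrix.mul_assoc]

theorem grassmannian_affine_chart_density
    (T M : ℕ) (hT : 0 < T) (hM : 0 < M) (hTM : 2 * M ≤ T)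
    (μ : Measure (Matrix.unitaryGroup (Fin T) ℂ))
    [IsProbabilityMeasure μ] [μ.IsMulLeftInvariant]
    (f : Matrix (Fin T) (Fin M) ℂ → ℝ≥0∞) (hf : Measurable f)
    (hinv : ∀ (X : Matrix (Fin T) (Fin M) ℂ) (G : Matrix (Fin M) (Fin M) ℂ),
      IsUnit G → f (X * G) = f X) :
    ∫⁻ U : Matrix.unitaryGroup (Fin T) ℂ,
        f ((U : Matrix (Fin T) (Fin T) ℂ) * stdFrame T M) ∂μ
      = (ENNReal.ofReal (Real.pi ^ (M * (T - M)) *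
            ∏ m ∈ Finset.Icc 1 M, (Nat.factorial (m - 1) : ℝ) / (Nat.factorial (T - m) : ℝ)))⁻¹ *
        ∫⁻ A : Matrix (Fin (T - M)) (Fin M) ℂ,
          f (stack T M 1 A) * ENNReal.ofReal ((((1 + Aᴴ * A).det).re ^ T)⁻¹) := by
  have h : M ≤ T := by omega
  set V : ℝ := Real.pi ^ (M * (T - M)) *
    ∏ m ∈ Finset.Icc 1 M, (Nat.factorial (m - 1) : ℝ) / (Nat.factorial (T - m) : ℝ) with hV
  have hVpos : 0 < V := by
    have := Real.pi_pos
    rw [hV]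
    refine mul_pos (by positivity) (Finset.prod_pos fun m _ => by positivity)
  have hW : ∫⁻ A : Matrix (Fin (T - M)) (Fin M) ℂ,
      ENNReal.ofReal ((((1 + Aᴴ * A).det).re ^ T)⁻¹) = ENNReal.ofReal V := by
    have := matInt M (T - M)
    rw [const_eq, Nat.sub_add_cancel h] at this
    exact this
  have hZ : ∫⁻ X : Matrix (Fin T) (Fin M) ℂ, wgt (Xᴴ * X) = ENNReal.ofReal V * KK M (T - M) := by
    have := lintegral_chart T M h (fun _ => 1) measurable_const (fun _ _ _ => rfl)
    simpa only [one_mul, hW] using this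
  have hmain := (lintegral_haar T M h μ f hf hinv).symm.trans (lintegral_chart T M h f hf hinv)
  obtain ⟨hZ0, hZt⟩ := wgt_mass (T := T) (M := M)
  rw [hZ] at hmain hZ0 hZt
  have hV0 : ENNReal.ofReal V ≠ 0 := (ENNReal.ofReal_pos.2 hVpos).ne'
  have hVt : ENNReal.ofReal V ≠ ∞ := ENNReal.ofReal_ne_top
  have hK0 : KK M (T - M) ≠ 0 := right_ne_zero_of_mul hZ0
  have hKt : KK M (T - M) ≠ ∞ := fun e => hZt (by rw [e, ENNReal.mul_top hV0])
  rw [← mul_assoc] at hmain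
  have h2 := (ENNReal.mul_left_inj hK0 hKt).1 hmain
  rw [← h2, mul_comm, mul_assoc, ENNReal.mul_inv_cancel hV0 hVt, mul_one]
end
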